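/- arXiv:2406.03167 — 4 statements merged into one kernel-verified Lean document; each statement's English description precedes it below -/
import Mathlib

section
/- Let Γ be a linearly ordered abelian group, E a finite set, r and s positive integers, p a function from the r-subsets of E to Γ∪{∞}, q a function from the s-subsets of E to Γ∪{∞}, and u ∈ Γ^E. Call an r-subset I u-minimal for p if p(I) ≠ ∞ and p(I) − Σ_{i∈I}u_i ≤ p(I') − Σ_{i∈I'}u_i for every r-subset I' (and similarly for q on s-subsets). Suppose I is u-minimal for p and J is u-minimal for q, and let I' be an r-subset and J' an s-subset with I∪J = I'∪J' and I∩J = I'∩J'. Then p(I) + q(J) ≤ p(I') + q(J') in Γ∪{∞}, with equality if and only if I' is u-minimal for p and J' is u-minimal for q. -/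
/-- Subtraction of a group element from `Γ ∪ {∞}`, with `∞ - g = ∞`. -/
def wsub {Γ : Type*} [AddCommGroup Γ] [LinearOrder Γ] [IsOrderedAddMonoid Γ] (x : WithTop Γ) (g : Γ) : WithTop Γ :=
  x.map fun γ => γ - g

/-- `I` is `u`-minimal for `p` among `r`-subsets: `p(I) ≠ ∞` and `p(I) - ∑_{i∈I} u_i` is minimal
among all `r`-subsets. -/
def UMinimal {E : Type*} [Fintype E] {Γ : Type*} [AddCommGroup Γ] [LinearOrder Γ] [IsOrderedAddMonoid Γ]
    (p : Finset E → WithTop Γ) (r : ℕ) (u : E → Γ) (I : Finset E) : Prop :=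
  p I ≠ ⊤ ∧ ∀ I' : Finset E, I'.card = r →
    wsub (p I) (∑ i ∈ I, u i) ≤ wsub (p I') (∑ i ∈ I', u i)

theorem uMinimal_iff_aux
    {E : Type*} [Fintype E] {Γ : Type*} [AddCommGroup Γ] [LinearOrder Γ] [IsOrderedAddMonoid Γ]
    (p : Finset E → WithTop Γ) (r : ℕ) (u : E → Γ) (I I' : Finset E)
    (hI : I.card = r) (hI' : I'.card = r) (hIu : UMinimal p r u I) :
    UMinimal p r u I' ↔
      p I' ≠ ⊤ ∧ wsub (p I) (∑ i ∈ I, u i) = wsub (p I') (∑ i ∈ I', u i) := by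
  constructor
  · intro h
    exact ⟨h.1, le_antisymm (hIu.2 _ hI') (h.2 _ hI)⟩
  · rintro ⟨h1, h2⟩
    exact ⟨h1, fun K hK => h2 ▸ hIu.2 K hK⟩

/-- If `I` is `u`-minimal for `p` and `J` is `u`-minimal for `q`, and `I'`, `J'`
satisfy `I ∪ J = I' ∪ J'` and `I ∩ J = I' ∩ J'`, then `p(I) + q(J) ≤ p(I') + q(J')` in
`Γ ∪ {∞}`, with equality iff `I'` is `u`-minimal for `p` and `J'` is `u`-minimal for `q`. -/
theorem uMinimal_pair_le_and_eq_iff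
    {E : Type*} [Fintype E] [DecidableEq E] {Γ : Type*} [AddCommGroup Γ] [LinearOrder Γ] [IsOrderedAddMonoid Γ]
    (r s : ℕ) (hr : 0 < r) (hs : 0 < s)
    (p : Finset E → WithTop Γ) (q : Finset E → WithTop Γ) (u : E → Γ)
    (I J I' J' : Finset E)
    (hI : I.card = r) (hJ : J.card = s) (hI' : I'.card = r) (hJ' : J'.card = s)
    (hIu : UMinimal p r u I) (hJu : UMinimal q s u J)
    (hcup : I ∪ J = I' ∪ J') (hcap : I ∩ J = I' ∩ J') :
    p I + q J ≤ p I' + q J' ∧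
      (p I + q J = p I' + q J' ↔ (UMinimal p r u I' ∧ UMinimal q s u J')) := by
  have hsum : ∑ i ∈ I, u i + ∑ i ∈ J, u i = ∑ i ∈ I', u i + ∑ i ∈ J', u i := by
    rw [← Finset.sum_union_inter, hcup, hcap, Finset.sum_union_inter]
  rw [uMinimal_iff_aux p r u I I' hI hI' hIu, uMinimal_iff_aux q s u J J' hJ hJ' hJu]
  have h1 := hIu.2 I' hI'
  have h2 := hJu.2 J' hJ'
  have t1 := hIu.1
  have t2 := hJu.1
  generalize ∑ i ∈ I, u i = A at *
  generalize ∑ i ∈ J, u i = B at *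
  generalize ∑ i ∈ I', u i = A' at *
  generalize ∑ i ∈ J', u i = B' at *
  clear hIu hJu
  generalize p I = a at *
  generalize q J = b at *
  generalize p I' = a' at *
  generalize q J' = b' at *
  lift a to Γ using t1
  lift b to Γ using t2
  induction a' using WithTop.recTopCoe with
  | top => simp [← WithTop.coe_add]
  | coe a' =>
  induction b' using WithTop.recTopCoe with
  | top => simp [← WithTop.coe_add]
  | coe b' =>
  simp only [wsub, WithTop.map_coe, WithTop.coe_le_coe] at h1 h2
  simp only [wsub, WithTop.map_coe, ← WithTop.coe_add, WithTop.coe_le_coe, WithTop.coe_inj,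
    ne_eq, WithTop.coe_ne_top, not_false_eq_true, true_and]
  have e1 : a + b = (a - A + (b - B)) + (A + B) := by abel
  have e2 : a' + b' = (a' - A' + (b' - B')) + (A + B) := by rw [hsum]; abel
  rw [e1, e2, add_left_inj, add_le_add_iff_right]
  exact ⟨add_le_add h1 h2, add_eq_add_iff_eq_and_eq h1 h2⟩
end

section
/- Let Γ be a linearly ordered abelian group, E a finite set, 1 ≤ r ≤ |E|, and P a function from the r-subsets of E to Γ∪{∞} that is not identically ∞. Then P is a valuated matroid (i.e. satisfies all tropical Plücker relations) if and only if, for every u : E → Γ, the initial system 𝓑^u(P) is the set of bases of a matroid on E. (This is Theorem A of the paper for F = 𝕂 the Krasner hyperfield, generalising the Murota–Speyer theorem on valuated matroids to arbitrary value groups.) -/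
open scoped Classical

/-- The tropical Plücker relations for `P : binom(E,r) → Γ ∪ {∞}`: for every `(r-1)`-subset `I`
and `(r+1)`-subset `J`, the minimum over `j ∈ J ∖ I` of `P(I∪{j}) + P(J∖{j})` is either `∞`
or attained at least twice. -/
def TropPlucker {E : Type*} [Fintype E] [DecidableEq E]
    {Γ : Type*} [AddCommGroup Γ] [LinearOrder Γ] [IsOrderedAddMonoid Γ] (P : Finset E → WithTop Γ) (r : ℕ) : Prop :=
  ∀ I J : Finset E, I.card + 1 = r → J.card = r + 1 →
    ∀ j ∈ J \ I,
      (∀ k ∈ J \ I, P (insert j I) + P (J.erase j) ≤ P (insert k I) + P (J.erase k)) →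
      P (insert j I) + P (J.erase j) = ⊤ ∨
        ∃ j' ∈ J \ I, j' ≠ j ∧ P (insert j' I) + P (J.erase j') = P (insert j I) + P (J.erase j)

/-- `B` belongs to the initial system `𝓑^u(P)`: it is an `r`-subset with `P(B) ≠ ∞` on which
`P(B) - ∑_{i∈B} u_i` is minimal among all `r`-subsets. -/
def InitBasis {E : Type*} [Fintype E] {Γ : Type*} [AddCommGroup Γ] [LinearOrder Γ] [IsOrderedAddMonoid Γ]
    (P : Finset E → WithTop Γ) (r : ℕ) (u : E → Γ) (B : Finset E) : Prop :=
  B.card = r ∧ P B ≠ ⊤ ∧ ∀ B' : Finset E, B'.card = r →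
    wsub (P B) (∑ i ∈ B, u i) ≤ wsub (P B') (∑ i ∈ B', u i)

section Helpers

lemma matroid_strong_exchange {α : Type*} (M : Matroid α) {B₁ B₂ : Set α} (h1 : M.IsBase B₁)
    (h2 : M.IsBase B₂) {i : α} (hi1 : i ∈ B₁) (hi2 : i ∉ B₂) :
    ∃ j ∈ B₂, j ∉ B₁ ∧ M.IsBase (insert j (B₁ \ {i})) ∧ M.IsBase (insert i (B₂ \ {j})) := by
  have hiE : i ∈ M.E := h1.subset_ground hi1
  have hecl : i ∈ M.closure B₂ := by rw [h2.closure_eq]; exact hiE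
  have hC := h2.fundCircuit_isCircuit hiE hi2
  have hic : i ∈ M.closure (M.fundCircuit i B₂ \ {i}) :=
    (hC.sdiff_singleton_isBasis (M.mem_fundCircuit i B₂)).subset_closure (M.mem_fundCircuit i B₂)
  have hni : i ∉ M.closure (B₁ \ {i}) := h1.indep.notMem_closure_sdiff_of_mem hi1
  obtain ⟨j, hj, hj'⟩ : ∃ j ∈ M.fundCircuit i B₂ \ {i}, j ∉ M.closure (B₁ \ {i}) := by
    by_contra! hcon
    exact hni (M.closure_subset_closure_of_subset_closure hcon hic)
  have hjne : j ≠ i := hj.2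
  have hjB2 : j ∈ B₂ := by
    have := M.fundCircuit_subset_insert i B₂ hj.1
    exact this.resolve_left hjne
  have hjE := h2.subset_ground hjB2
  have hjB1 : j ∉ B₁ := fun h => hj' (M.mem_closure_of_mem' ⟨h, hjne⟩ hjE)
  refine ⟨j, hjB2, hjB1, ?_, ?_⟩
  · have hI : M.Indep (insert j B₁ \ {i}) := by
      rw [← Set.insert_sdiff_singleton_comm hjne, (h1.indep.sdiff {i}).insert_indep_iff]
      exact Or.inl ⟨hjE, hj'⟩
    have h := h1.exchange_isBase_of_indep' hi1 hjB1 hI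
    rwa [← Set.insert_sdiff_singleton_comm hjne] at h
  · have h := h2.exchange_isBase_of_indep' hjB2 hi2
      ((h2.indep.mem_fundCircuit_iff hecl hi2).1 hj.1)
    rwa [← Set.insert_sdiff_singleton_comm hjne.symm] at h

variable {E : Type*} [Fintype E] [DecidableEq E] {Γ : Type*} [AddCommGroup Γ] [LinearOrder Γ]
  [IsOrderedAddMonoid Γ]

lemma initBasis_iff (P : Finset E → WithTop Γ) (r : ℕ) (u : E → Γ) (B : Finset E) :
    InitBasis P r u B ↔ B.card = r ∧ ∃ p : Γ, P B = p ∧ ∀ B' : Finset E, B'.card = r →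
      ∀ q : Γ, P B' = q → p - ∑ i ∈ B, u i ≤ q - ∑ i ∈ B', u i := by
  unfold InitBasis wsub
  refine and_congr_right fun _ => ?_
  constructor
  · rintro ⟨h1, h2⟩
    obtain ⟨p, hp⟩ := WithTop.ne_top_iff_exists.1 h1
    refine ⟨p, hp.symm, fun B' hB' q hq => ?_⟩
    have := h2 B' hB'
    rw [← hp, hq] at this
    exact WithTop.coe_le_coe.1 this
  · rintro ⟨p, hp, h⟩
    refine ⟨by simp [hp], fun B' hB' => ?_⟩
    rcases hq : P B' with _ | q
    · exact le_top
    · have := h B' hB' q hq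
      rw [hp]
      exact WithTop.coe_le_coe.2 this

def GoodEx (P : Finset E → WithTop Γ) (r : ℕ) : Prop :=
  ∀ (u : E → Γ) (B₁ B₂ : Finset E), InitBasis P r u B₁ → InitBasis P r u B₂ →
    ∀ i ∈ B₁, i ∉ B₂ → ∃ j ∈ B₂, j ∉ B₁ ∧ InitBasis P r u (insert j (B₁.erase i)) ∧
      InitBasis P r u (insert i (B₂.erase j))

def restr (P : Finset E → WithTop Γ) (S T : Finset E) : Finset E → WithTop Γ :=
  fun X => if S ⊆ X ∧ X ⊆ T then P X else ⊤

lemma exists_bound [Nontrivial Γ] (f : Finset E → Γ) :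
    ∃ N : Γ, 0 < N ∧ ∀ X Y, f X - f Y < N := by
  obtain ⟨e, he⟩ := exists_zero_lt (α := Γ)
  obtain ⟨p, hp⟩ := Finite.exists_max (fun p : Finset E × Finset E => f p.1 - f p.2)
  have h0 := hp (p.1, p.1)
  simp only [sub_self] at h0
  refine ⟨f p.1 - f p.2 + e, by positivity, fun X Y => ?_⟩
  exact lt_of_le_of_lt (hp (X, Y)) (lt_add_of_pos_right _ he)

/-- the score function -/
def score (S T : Finset E) (N : Γ) (e : E) : Γ :=
  (if e ∈ S then N else 0) + (if e ∈ T then 0 else -N)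

lemma sum_score (S T X : Finset E) (N : Γ) :
    ∑ e ∈ X, score S T N e = (X ∩ S).card • N - (X \ T).card • N := by
  unfold score
  rw [Finset.sum_add_distrib, Finset.sum_ite_mem, Finset.sum_ite]
  simp [Finset.sdiff_eq_filter, sub_eq_add_neg]

lemma score_eq (S T X : Finset E) (N : Γ) (h1 : S ⊆ X) (h2 : X ⊆ T) :
    ∑ e ∈ X, score S T N e = S.card • N := by
  rw [sum_score, Finset.inter_eq_right.2 h1, Finset.sdiff_eq_empty_iff_subset.2 h2]; simp

lemma score_le (S T X : Finset E) (N : Γ) (hN : 0 < N) (h : ¬ (S ⊆ X ∧ X ⊆ T)) :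
    ∑ e ∈ X, score S T N e + N ≤ S.card • N := by
  rw [sum_score]
  have key : (X ∩ S).card + 1 ≤ S.card + (X \ T).card := by
    have h1 : (X ∩ S).card ≤ S.card := Finset.card_le_card Finset.inter_subset_right
    by_cases hS : S ⊆ X
    · have : (X \ T).Nonempty := by
        rw [Finset.sdiff_nonempty]; tauto
      have := this.card_pos
      omega
    · have : (X ∩ S).card < S.card := by
        apply Finset.card_lt_card
        refine ⟨Finset.inter_subset_right, fun h' => hS ?_⟩
        exact h'.trans Finset.inter_subset_left
      omega
  have := nsmul_le_nsmul_left hN.le key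
  rw [add_nsmul, add_nsmul, one_nsmul] at this
  rw [sub_add_eq_add_sub, sub_le_iff_le_add]
  exact this

lemma restr_init [Nontrivial Γ] (P : Finset E → WithTop Γ) (r : ℕ) (S T X₀ : Finset E)
    (hX₀ : X₀.card = r) (hf : restr P S T X₀ ≠ ⊤) (u : E → Γ) :
    ∃ u' : E → Γ, ∀ X, InitBasis (restr P S T) r u X ↔ InitBasis P r u' X := by
  have hval : ∀ X (q : Γ), restr P S T X = q ↔ (S ⊆ X ∧ X ⊆ T) ∧ P X = q := by
    intro X q
    unfold restr
    split_ifs with h <;> simp [h]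
  obtain ⟨q₀, hq₀⟩ := WithTop.ne_top_iff_exists.1 hf
  obtain ⟨hX₀', hq₀⟩ := (hval _ _).1 hq₀.symm
  obtain ⟨N, hN, hb⟩ := exists_bound (fun X => (P X).untopD 0 - ∑ i ∈ X, u i)
  have hb' : ∀ X Y (p q : Γ), P X = p → P Y = q →
      (p - ∑ i ∈ X, u i) - (q - ∑ i ∈ Y, u i) < N := by
    intro X Y p q h1 h2
    simpa [h1, h2] using hb X Y
  refine ⟨u + score S T N, fun X => ?_⟩
  simp only [initBasis_iff, Pi.add_apply, Finset.sum_add_distrib]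
  refine and_congr_right fun hX => ?_
  constructor
  · rintro ⟨p, hp, hmin⟩
    obtain ⟨hX', hp⟩ := (hval _ _).1 hp
    refine ⟨p, hp, fun Y hY q hq => ?_⟩
    rw [score_eq S T X N hX'.1 hX'.2]
    by_cases hY' : S ⊆ Y ∧ Y ⊆ T
    · rw [score_eq S T Y N hY'.1 hY'.2]
      have := hmin Y hY q ((hval _ _).2 ⟨hY', hq⟩)
      grind
    · have h1 := score_le S T Y N hN hY'
      have h2 := hb' X Y p q hp hq
      grind
  · rintro ⟨p, hp, hmin⟩
    have hX' : S ⊆ X ∧ X ⊆ T := by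
      by_contra hX'
      have h1 := score_le S T X N hN hX'
      have h2 := hb' X₀ X q₀ p hq₀ hp
      have h3 := hmin X₀ hX₀ q₀ hq₀
      rw [score_eq S T X₀ N hX₀'.1 hX₀'.2] at h3
      grind
    refine ⟨p, (hval _ _).2 ⟨hX', hp⟩, fun Y hY q hq => ?_⟩
    obtain ⟨hY', hq⟩ := (hval _ _).1 hq
    have h3 := hmin Y hY q hq
    rw [score_eq S T X N hX'.1 hX'.2, score_eq S T Y N hY'.1 hY'.2] at h3
    grind

lemma restr_good [Nontrivial Γ] (P : Finset E → WithTop Γ) (r : ℕ) (S T X₀ : Finset E)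
    (hX₀ : X₀.card = r) (hf : restr P S T X₀ ≠ ⊤) (hg : GoodEx P r) :
    GoodEx (restr P S T) r := by
  intro u
  obtain ⟨u', hu'⟩ := restr_init P r S T X₀ hX₀ hf u
  simp only [hu']
  exact hg u'

/-- neighbour -/
lemma neighbour [Nontrivial Γ] (P : Finset E → WithTop Γ) (r : ℕ) (hg : GoodEx P r)
    (B X : Finset E) (hB : B.card = r) (hX : X.card = r) (hPB : P B ≠ ⊤) (hPX : P X ≠ ⊤)
    (x : E) (hxX : x ∈ X) (hxB : x ∉ B) : ∃ v ∈ B, P (insert x (B.erase v)) ≠ ⊤ := by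
  have hrB : restr P B B B ≠ ⊤ := by simpa [restr] using hPB
  obtain ⟨u, hu⟩ := restr_init P r B B B hB hrB 0
  have hBi : InitBasis P r u B := by
    rw [← hu]
    obtain ⟨b, hb⟩ := WithTop.ne_top_iff_exists.1 hrB
    rw [initBasis_iff]
    refine ⟨hB, b, hb.symm, fun Y hY q hq => ?_⟩
    have : Y = B := by
      by_contra hne
      have : ¬ (B ⊆ Y ∧ Y ⊆ B) := fun h => hne (h.2.antisymm h.1)
      simp [restr, this] at hq
    subst this
    rw [hq] at hb
    rw [WithTop.coe_injective hb]
  rw [initBasis_iff] at hBi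
  obtain ⟨-, b, hb, hmin⟩ := hBi
  let F : Finset (Finset E) := Finset.univ.filter fun Y => Y.card = r ∧ P Y ≠ ⊤ ∧ x ∈ Y
  obtain ⟨Y, hYF, hYmin⟩ := Finset.exists_min_image F
    (fun Y => (P Y).untopD 0 - ∑ i ∈ Y, u i) ⟨X, by simp [F, hX, hPX, hxX]⟩
  simp only [F, Finset.mem_filter, Finset.mem_univ, true_and] at hYF hYmin
  obtain ⟨hY, hPY, hxY⟩ := hYF
  obtain ⟨y, hy⟩ := WithTop.ne_top_iff_exists.1 hPY
  let t : Γ := (y - ∑ i ∈ Y, u i) - (b - ∑ i ∈ B, u i)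
  let u' : E → Γ := fun e => u e + if e = x then t else 0
  have hsum : ∀ Z : Finset E, ∑ i ∈ Z, u' i = ∑ i ∈ Z, u i + if x ∈ Z then t else 0 := by
    intro Z
    simp [u', Finset.sum_add_distrib]
  have ht : 0 ≤ t := sub_nonneg.2 (hmin Y hY y hy.symm)
  have hmin' : ∀ Z : Finset E, Z.card = r → ∀ q : Γ, P Z = q →
      b - ∑ i ∈ B, u i ≤ q - ∑ i ∈ Z, u' i := by
    intro Z hZ q hq
    rw [hsum]
    split_ifs with hxZ
    · have := hYmin Z ⟨hZ, by simp [hq], hxZ⟩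
      simp only [← hy, hq, WithTop.untopD_coe] at this
      grind
    · simpa using hmin Z hZ q hq
  have h1 : InitBasis P r u' B := by
    rw [initBasis_iff]
    refine ⟨hB, b, hb, ?_⟩
    rw [hsum B, if_neg hxB, add_zero]
    exact hmin'
  have h2 : InitBasis P r u' Y := by
    rw [initBasis_iff]
    refine ⟨hY, y, hy.symm, ?_⟩
    have : y - ∑ i ∈ Y, u' i = b - ∑ i ∈ B, u i := by
      rw [hsum Y, if_pos hxY]; grind
    rw [this]
    exact hmin'
  obtain ⟨v, hvB, hvY, -, h3⟩ := hg u' Y B h2 h1 x hxY hxB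
  exact ⟨v, hvB, h3.2.1⟩

lemma neighbour' [Nontrivial Γ] (P : Finset E → WithTop Γ) (r : ℕ) (hg : GoodEx P r)
    (B X : Finset E) (hB : B.card = r) (hX : X.card = r) (hPB : P B ≠ ⊤) (hPX : P X ≠ ⊤)
    (x : E) (hxX : x ∈ X) (hxB : x ∉ B) : ∃ v ∈ B \ X, P (insert x (B.erase v)) ≠ ⊤ := by
  have h1 : restr P (B ∩ X) (B ∪ X) B ≠ ⊤ := by
    simpa [restr, Finset.subset_union_left, Finset.inter_subset_left] using hPB
  have h2 : restr P (B ∩ X) (B ∪ X) X ≠ ⊤ := by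
    simpa [restr, Finset.subset_union_right, Finset.inter_subset_right] using hPX
  obtain ⟨v, hv, h⟩ := neighbour _ r (restr_good P r (B ∩ X) (B ∪ X) B hB h1 hg) B X hB hX h1 h2
    x hxX hxB
  unfold restr at h
  split_ifs at h with hc
  · refine ⟨v, ?_, h⟩
    rw [Finset.mem_sdiff]
    refine ⟨hv, fun hvX => ?_⟩
    have := hc.1 (Finset.mem_inter.2 ⟨hv, hvX⟩)
    grind
  · exact absurd rfl h

lemma trop_between (a b : WithTop Γ) (c : Γ) (h : (c : WithTop Γ) ≤ a + b) :
    ∃ x : Γ, ((x : Γ) : WithTop Γ) ≤ a ∧ ((c - x : Γ) : WithTop Γ) ≤ b := by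
  induction a with
  | top =>
    induction b with
    | top => exact ⟨0, le_top, le_top⟩
    | coe b => exact ⟨c - b, le_top, by simp⟩
  | coe a =>
    refine ⟨a, le_rfl, ?_⟩
    induction b with
    | top => exact le_top
    | coe b =>
      norm_cast at *
      exact sub_le_iff_le_add'.2 h

lemma sandwich_pairs (S Y : Finset E) (a b c d : E) (r : ℕ) (hS : S.card + 2 = r)
    (ha : a ∉ S) (hb : b ∉ S) (hc : c ∉ S) (hd : d ∉ S)
    (hY : Y.card = r) (h1 : S ⊆ Y) (h2 : Y ⊆ insert a (insert b (insert c (insert d S)))) :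
    ∃ x y, x ≠ y ∧ x ∈ ({a, b, c, d} : Finset E) ∧ y ∈ ({a, b, c, d} : Finset E) ∧
      Y = insert x (insert y S) := by
  have hcard : (Y \ S).card = 2 := by
    rw [Finset.card_sdiff_of_subset h1]; omega
  obtain ⟨x, y, hxy, hYS⟩ := Finset.card_eq_two.1 hcard
  refine ⟨x, y, hxy, ?_, ?_, ?_⟩
  · have : x ∈ Y \ S := by simp [hYS]
    have h3 := h2 (Finset.mem_sdiff.1 this).1
    grind
  · have : y ∈ Y \ S := by simp [hYS]
    have h3 := h2 (Finset.mem_sdiff.1 this).1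
    grind
  · rw [← Finset.sdiff_union_of_subset h1, hYS]
    ext z; simp [or_assoc]

lemma local_exchange [Nontrivial Γ] (P : Finset E → WithTop Γ) (r : ℕ) (hg : GoodEx P r)
    (S : Finset E) (hS : S.card + 2 = r) (a b c d : E)
    (hab : a ≠ b) (hac : a ≠ c) (had : a ≠ d) (hbc : b ≠ c) (hbd : b ≠ d) (hcd : c ≠ d)
    (ha : a ∉ S) (hb : b ∉ S) (hc : c ∉ S) (hd : d ∉ S)
    (hPab : P (insert a (insert b S)) ≠ ⊤) (hPcd : P (insert c (insert d S)) ≠ ⊤) :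
    P (insert a (insert c S)) + P (insert b (insert d S)) ≤
      P (insert a (insert b S)) + P (insert c (insert d S)) ∨
    P (insert a (insert d S)) + P (insert b (insert c S)) ≤
      P (insert a (insert b S)) + P (insert c (insert d S)) := by
  by_contra! hcon
  obtain ⟨hcon1, hcon2⟩ := hcon
  obtain ⟨p, hp⟩ := WithTop.ne_top_iff_exists.1 hPab
  obtain ⟨q, hq⟩ := WithTop.ne_top_iff_exists.1 hPcd
  rw [← hp, ← hq, ← WithTop.coe_add] at hcon1 hcon2
  -- `x = u_a + q`, `c - x = p - u_a`
  obtain ⟨x, hx1, hx2⟩ := trop_between _ _ _ hcon1.le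
  obtain ⟨y, hy1, hy2⟩ := trop_between _ _ _ hcon2.le
  -- u_d = 0, u_a = x - q, M = u_a - y
  let ua : Γ := x - q
  let M : Γ := ua - y
  let ub : Γ := M + p - ua
  let uc : Γ := M + q
  let u : E → Γ := fun e => if e = a then ua else if e = b then ub else if e = c then uc else 0
  let T := insert a (insert b (insert c (insert d S)))
  have hsum : ∀ s t, s ≠ t → s ∉ S → t ∉ S →
      ∑ i ∈ insert s (insert t S), u i = u s + (u t + ∑ i ∈ S, u i) := by
    intro s t h1 h2 h3
    rw [Finset.sum_insert (by simp [h1, h2]), Finset.sum_insert h3]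
  have hSu : ∑ i ∈ S, u i = 0 := by
    apply Finset.sum_eq_zero
    intro i hi
    have : i ≠ a := by rintro rfl; exact ha hi
    have : i ≠ b := by rintro rfl; exact hb hi
    have : i ≠ c := by rintro rfl; exact hc hi
    simp [u, *]
  have hua : u a = ua := by simp [u]
  have hub : u b = ub := by simp [u, hab.symm]
  have huc : u c = uc := by simp [u, hac.symm, hbc.symm]
  have hud : u d = 0 := by simp [u, had.symm, hbd.symm, hcd.symm]
  have hr1 : restr P S T (insert a (insert b S)) = p := by
    rw [restr, if_pos, hp]; constructor <;> grind
  have hr2 : restr P S T (insert c (insert d S)) = q := by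
    rw [restr, if_pos, hq]; constructor <;> grind
  have hcard : ∀ s t, s ≠ t → s ∉ S → t ∉ S → (insert s (insert t S)).card = r := by
    intro s t h1 h2 h3
    rw [Finset.card_insert_of_notMem (by simp [h1, h2]), Finset.card_insert_of_notMem h3]; omega
  have hmin : ∀ Y : Finset E, Y.card = r → ∀ w : Γ, restr P S T Y = w →
      -M ≤ w - ∑ i ∈ Y, u i := by
    intro Y hY w hw
    unfold restr at hw
    split_ifs at hw with hYT
    swap
    · exact absurd hw (by simp)
    obtain ⟨s, t, hst, hs, ht, rfl⟩ := sandwich_pairs S Y a b c d r hS ha hb hc hd hY hYT.1 hYT.2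
    have comm : ∀ s t, insert s (insert t S) = insert t (insert s S) :=
      fun s t => Finset.insert_comm _ _ _
    have kab : ∀ w : Γ, P (insert a (insert b S)) = w → -M ≤ w - (u a + (u b + 0)) := by
      intro w hw
      rw [← hp] at hw
      have := WithTop.coe_injective hw
      grind
    have kcd : ∀ w : Γ, P (insert c (insert d S)) = w → -M ≤ w - (u c + (u d + 0)) := by
      intro w hw
      rw [← hq] at hw
      have := WithTop.coe_injective hw
      grind
    have kac : ∀ w : Γ, P (insert a (insert c S)) = w → -M ≤ w - (u a + (u c + 0)) := by
      intro w hw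
      rw [hw, WithTop.coe_le_coe] at hx1
      grind
    have kbd : ∀ w : Γ, P (insert b (insert d S)) = w → -M ≤ w - (u b + (u d + 0)) := by
      intro w hw
      rw [hw, WithTop.coe_le_coe] at hx2
      grind
    have kad : ∀ w : Γ, P (insert a (insert d S)) = w → -M ≤ w - (u a + (u d + 0)) := by
      intro w hw
      rw [hw, WithTop.coe_le_coe] at hy1
      grind
    have kbc : ∀ w : Γ, P (insert b (insert c S)) = w → -M ≤ w - (u b + (u c + 0)) := by
      intro w hw
      rw [hw, WithTop.coe_le_coe] at hy2
      grind
    have hs' : s ∉ S := by simp at hs; rcases hs with rfl | rfl | rfl | rfl <;> assumption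
    have ht' : t ∉ S := by simp at ht; rcases ht with rfl | rfl | rfl | rfl <;> assumption
    rw [hsum s t hst hs' ht', hSu]
    have flip : ∀ s t, (∀ w : Γ, P (insert s (insert t S)) = w → -M ≤ w - (u s + (u t + 0))) →
        (∀ w : Γ, P (insert t (insert s S)) = w → -M ≤ w - (u t + (u s + 0))) := by
      intro s t h w hw
      rw [comm] at hw
      have := h w hw
      rwa [add_zero, add_comm (u t), ← add_zero (u t)]
    revert w
    simp only [Finset.mem_insert, Finset.mem_singleton] at hs ht
    clear hY hYT hs' ht' hx1 hx2 hy1 hy2 hcon1 hcon2 hr1 hr2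
    intro w hw
    rcases hs with rfl | rfl | rfl | rfl <;> rcases ht with rfl | rfl | rfl | rfl <;>
      first
      | exact absurd rfl hst
      | exact kab w hw
      | exact kcd w hw
      | exact kac w hw
      | exact kbd w hw
      | exact kad w hw
      | exact kbc w hw
      | exact flip _ _ kab w hw
      | exact flip _ _ kcd w hw
      | exact flip _ _ kac w hw
      | exact flip _ _ kbd w hw
      | exact flip _ _ kad w hw
      | exact flip _ _ kbc w hw
  have hg' := restr_good P r S T _ (hcard a b hab ha hb) (by rw [hr1]; simp) hg
  have i1 : InitBasis (restr P S T) r u (insert a (insert b S)) := by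
    rw [initBasis_iff]
    refine ⟨hcard a b hab ha hb, p, hr1, ?_⟩
    have : p - ∑ i ∈ insert a (insert b S), u i = -M := by
      rw [hsum a b hab ha hb, hSu]; grind
    rw [this]; exact hmin
  have i2 : InitBasis (restr P S T) r u (insert c (insert d S)) := by
    rw [initBasis_iff]
    refine ⟨hcard c d hcd hc hd, q, hr2, ?_⟩
    have : q - ∑ i ∈ insert c (insert d S), u i = -M := by
      rw [hsum c d hcd hc hd, hSu]; grind
    rw [this]; exact hmin
  have tight : ∀ s t, s ≠ t → s ∉ S → t ∉ S → InitBasis (restr P S T) r u (insert s (insert t S)) →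
      P (insert s (insert t S)) = ((u s + u t - M : Γ) : WithTop Γ) := by
    intro s t hst hs ht hi
    rw [initBasis_iff] at hi
    obtain ⟨-, w, hw, hle⟩ := hi
    have h1 := hle _ (hcard a b hab ha hb) p hr1
    have h2 := hmin _ (hcard s t hst hs ht) w hw
    rw [hsum a b hab ha hb, hsum s t hst hs ht, hSu] at h1
    rw [hsum s t hst hs ht, hSu] at h2
    have : restr P S T (insert s (insert t S)) = P (insert s (insert t S)) := by
      unfold restr at hw ⊢
      split_ifs at hw ⊢ with hc
      · rfl
      · exact absurd hw (by simp)
    rw [← this, hw]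
    congr 1
    grind
  obtain ⟨j, hj, hj', e1, e2⟩ := hg' u _ _ i1 i2 a (by simp) (by simp [hac, had, ha])
  have hj2 : j = c ∨ j = d := by grind
  rcases hj2 with rfl | rfl
  · have s1 : insert j ((insert a (insert b S)).erase a) = insert b (insert j S) := by grind
    have s2 : insert a ((insert j (insert d S)).erase j) = insert a (insert d S) := by grind
    rw [s1] at e1
    rw [s2] at e2
    rw [tight _ _ hbc hb hc e1, tight _ _ had ha hd e2, ← WithTop.coe_add,
      WithTop.coe_lt_coe] at hcon2
    grind
  · have s1 : insert j ((insert a (insert b S)).erase a) = insert b (insert j S) := by grind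
    have s2 : insert a ((insert c (insert j S)).erase j) = insert a (insert c S) := by grind
    rw [s1] at e1
    rw [s2] at e2
    rw [tight _ _ hbd hb hd e1, tight _ _ hac ha hc e2, ← WithTop.coe_add,
      WithTop.coe_lt_coe] at hcon1
    grind

lemma sdiff_swap (B B' : Finset E) (u v : E) (hv : v ∉ B) :
    B \ (insert u (B'.erase v)) = (B \ B').erase u := by
  ext z
  simp only [Finset.mem_sdiff, Finset.mem_insert, Finset.mem_erase]
  have : z ∈ B → z ≠ v := by rintro h rfl; exact hv h
  tauto

lemma swap_identities (B' : Finset E) (i u0 v0 v : E) (hi : i ∉ B') (hu : u0 ∉ B')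
    (hv0 : v0 ∈ B') (hv : v ∈ B') (hne : v ≠ v0) :
    insert v0 (insert v ((B'.erase v0).erase v)) = B' ∧
    insert u0 (insert i ((B'.erase v0).erase v)) = insert i ((insert u0 (B'.erase v0)).erase v) ∧
    insert v0 (insert u0 ((B'.erase v0).erase v)) = insert u0 (B'.erase v) ∧
    insert v (insert i ((B'.erase v0).erase v)) = insert i (B'.erase v0) ∧
    insert v0 (insert i ((B'.erase v0).erase v)) = insert i (B'.erase v) ∧
    insert v (insert u0 ((B'.erase v0).erase v)) = insert u0 (B'.erase v0) := by
  have hiv : v ≠ i := by rintro rfl; exact hi hv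
  have huv : u0 ≠ v := by rintro rfl; exact hu hv
  have e1 : insert v ((B'.erase v0).erase v) = B'.erase v0 :=
    Finset.insert_erase (Finset.mem_erase.2 ⟨hne, hv⟩)
  have e2 : insert v0 ((B'.erase v0).erase v) = B'.erase v := by
    rw [Finset.erase_right_comm]
    exact Finset.insert_erase (Finset.mem_erase.2 ⟨hne.symm, hv0⟩)
  refine ⟨?_, ?_, ?_, ?_, ?_, ?_⟩
  · rw [e1, Finset.insert_erase hv0]
  · rw [Finset.erase_insert_of_ne huv, Finset.insert_comm]
  · rw [Finset.insert_comm, e2]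
  · rw [Finset.insert_comm, e1]
  · rw [Finset.insert_comm, e2]
  · rw [Finset.insert_comm, e1]

lemma global_exchange [Nontrivial Γ] (P : Finset E → WithTop Γ) (r : ℕ) (hg : GoodEx P r) (n : ℕ) :
    ∀ B B' : Finset E, B.card = r → B'.card = r → P B ≠ ⊤ → P B' ≠ ⊤ → (B \ B').card = n + 1 →
    ∀ i ∈ B, i ∉ B' → ∃ v ∈ B', v ∉ B ∧
      P (insert v (B.erase i)) + P (insert i (B'.erase v)) ≤ P B + P B' := by
  induction n with
  | zero =>
    intro B B' hB hB' hPB hPB' hn i hi hi'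
    have hn' : (B' \ B).card = 1 := by
      rw [← Finset.card_sdiff_comm (hB.trans hB'.symm), hn]
    obtain ⟨v, hv⟩ := Finset.card_eq_one.1 hn'
    obtain ⟨w, hw⟩ := Finset.card_eq_one.1 hn
    simp only [Finset.ext_iff, Finset.mem_sdiff, Finset.mem_singleton] at hv hw
    have e1 : insert v (B.erase i) = B' := by grind
    have e2 : insert i (B'.erase v) = B := by grind
    refine ⟨v, by grind, by grind, ?_⟩
    rw [e1, e2, add_comm]
  | succ n ih =>
    intro B B' hB hB' hPB hPB' hn i hi hi'
    by_contra! hcon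
    obtain ⟨b, hb⟩ := WithTop.ne_top_iff_exists.1 hPB
    obtain ⟨b', hb'⟩ := WithTop.ne_top_iff_exists.1 hPB'
    obtain ⟨ε, hε⟩ := exists_zero_lt (α := Γ)
    have hp : ∀ v, ∃ p : Γ, v ∈ B' → v ∉ B →
        (P (insert v (B.erase i)) = ⊤ ∨ P (insert v (B.erase i)) = p) ∧
        ∀ q : Γ, P (insert i (B'.erase v)) = q → b + b' < q + p := by
      intro v
      by_cases h1 : P (insert v (B.erase i)) = ⊤
      · by_cases h2 : P (insert i (B'.erase v)) = ⊤
        · exact ⟨0, fun _ _ => ⟨Or.inl h1, by simp [h2]⟩⟩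
        · obtain ⟨q', hq'⟩ := WithTop.ne_top_iff_exists.1 h2
          refine ⟨b + b' - q' + ε, fun _ _ => ⟨Or.inl h1, fun q hq => ?_⟩⟩
          rw [← hq'] at hq
          have := WithTop.coe_injective hq
          grind
      · obtain ⟨p, hp⟩ := WithTop.ne_top_iff_exists.1 h1
        refine ⟨p, fun h3 h4 => ⟨Or.inr hp.symm, fun q hq => ?_⟩⟩
        have := hcon v h3 h4
        rw [← hp, hq, ← hb, ← hb'] at this
        norm_cast at this
        grind
    choose p hp using hp
    obtain ⟨u0, hu0, hu0i⟩ : ∃ u0 ∈ B \ B', u0 ≠ i :=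
      Finset.exists_mem_ne (by omega) i
    rw [Finset.mem_sdiff] at hu0
    obtain ⟨v1, hv1, hv1'⟩ := neighbour' P r hg B' B hB' hB hPB' hPB u0 hu0.1 hu0.2
    obtain ⟨v0, hv0, hv0min⟩ := Finset.exists_min_image (B' \ B)
      (fun v => P (insert u0 (B'.erase v)) + p v) ⟨v1, hv1⟩
    have hv0fin : P (insert u0 (B'.erase v0)) ≠ ⊤ := by
      intro h
      have := hv0min v1 hv1
      simp only [h, top_add, top_le_iff] at this
      simp [hv1'] at this
    rw [Finset.mem_sdiff] at hv0
    set B'' := insert u0 (B'.erase v0) with hB''def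
    have hB'' : B''.card = r := by
      rw [Finset.card_insert_of_notMem (by grind), Finset.card_erase_of_mem hv0.1]
      have := Finset.card_pos.2 ⟨v0, hv0.1⟩
      omega
    have hn'' : (B \ B'').card = n + 1 := by
      have : B \ B'' = (B \ B').erase u0 := sdiff_swap B B' u0 v0 hv0.2
      rw [this, Finset.card_erase_of_mem (by grind), hn]; omega
    obtain ⟨b'', hb''⟩ := WithTop.ne_top_iff_exists.1 hv0fin
    obtain ⟨v, hv, hvB, hle⟩ := ih B B'' hB hB'' hPB hv0fin hn'' i hi (by grind)
    have hvB' : v ∈ B' := by grind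
    have hvv0 : v ≠ v0 := by grind
    have hpv := hp v hvB' hvB
    have hpv0 := hp v0 hv0.1 hv0.2
    have hfin := hle
    rw [← hb, ← hb'', ← WithTop.coe_add] at hle
    have hne1 : P (insert v (B.erase i)) ≠ ⊤ := by
      intro h; rw [h] at hle; simp at hle
    have hne2 : P (insert i (B''.erase v)) ≠ ⊤ := by
      intro h; rw [h] at hle; simp at hle
    have hpv1 := hpv.1.resolve_left hne1
    obtain ⟨w, hw⟩ := WithTop.ne_top_iff_exists.1 hne2
    rw [hpv1, ← hw] at hle
    norm_cast at hle
    let S := (B'.erase v0).erase v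
    have hScard : S.card + 2 = r := by
      rw [Finset.card_erase_of_mem (by grind), Finset.card_erase_of_mem hv0.1]
      have : 1 < B'.card := Finset.one_lt_card.2 ⟨v, hvB', v0, hv0.1, hvv0⟩
      omega
    obtain ⟨s1, s2, s3, s4, s5, s6⟩ := swap_identities B' i u0 v0 v hi' hu0.2 hv0.1 hvB' hvv0
    have ne_of : ∀ {x y : E}, x ∈ B' → y ∉ B' → x ≠ y := by
      rintro x y h1 h2 rfl
      exact h2 h1
    have nS : ∀ {x : E}, x ∉ B' → x ∉ S := fun h h' =>
      h (Finset.mem_of_mem_erase (Finset.mem_of_mem_erase h'))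
    have hloc := local_exchange P r hg S hScard v0 v u0 i hvv0.symm (ne_of hv0.1 hu0.2)
      (ne_of hv0.1 hi') (ne_of hvB' hu0.2) (ne_of hvB' hi') hu0i
      (fun h => Finset.notMem_erase v0 B' (Finset.mem_of_mem_erase h))
      (Finset.notMem_erase v _) (nS hu0.2) (nS hi')
      (by rwa [s1]) (by rwa [s2])
    rw [s1, s2, s3, s4, s5, s6, ← hb', ← hw, ← hb'', ← WithTop.coe_add] at hloc
    have hmv := hv0min v (Finset.mem_sdiff.2 ⟨hvB', hvB⟩)
    rcases hloc with h | h
    · rcases h1 : P (insert u0 (B'.erase v)) with _ | z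
      · rw [h1] at h; exact absurd (top_le_iff.1 h) (by simp)
      rcases h2 : P (insert i (B'.erase v0)) with _ | z'
      · change P (insert i (B'.erase v0)) = ⊤ at h2
        rw [h2, add_top] at h; exact absurd (top_le_iff.1 h) (WithTop.coe_ne_top)
      have h3 := hpv0.2 z' h2
      change P (insert u0 (B'.erase v)) = (z : WithTop Γ) at h1
      change P (insert i (B'.erase v0)) = (z' : WithTop Γ) at h2
      simp only [h1, ← hb''] at hmv
      rw [h1, h2] at h
      norm_cast at h hmv
      clear hp ih hcon hv0min hpv hpv0 ne_of nS
      grind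
    · rcases h1 : P (insert i (B'.erase v)) with _ | z
      · rw [h1] at h; exact absurd (top_le_iff.1 h) (by simp)
      have h3 := hpv.2 z h1
      change P (insert i (B'.erase v)) = (z : WithTop Γ) at h1
      rw [h1] at h
      norm_cast at h
      clear hp ih hcon hv0min hpv hpv0 ne_of nS
      grind

lemma exchange_all (P : Finset E → WithTop Γ) (r : ℕ) (hg : GoodEx P r)
    (B B' : Finset E) (hB : B.card = r) (hB' : B'.card = r) (hPB : P B ≠ ⊤) (hPB' : P B' ≠ ⊤)
    (i : E) (hi : i ∈ B) (hi' : i ∉ B') : ∃ v ∈ B', v ∉ B ∧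
      P (insert v (B.erase i)) + P (insert i (B'.erase v)) ≤ P B + P B' := by
  rcases subsingleton_or_nontrivial Γ with hΓ | hΓ
  · have h0 : ∀ X : Finset E, X.card = r → P X ≠ ⊤ → InitBasis P r 0 X := by
      intro X hX hPX
      obtain ⟨x, hx⟩ := WithTop.ne_top_iff_exists.1 hPX
      rw [initBasis_iff]
      exact ⟨hX, x, hx.symm, fun _ _ _ _ => (Subsingleton.elim _ _).le⟩
    obtain ⟨j, hj, hj', e1, e2⟩ := hg 0 B B' (h0 B hB hPB) (h0 B' hB' hPB') i hi hi'
    refine ⟨j, hj, hj', ?_⟩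
    obtain ⟨w, hw⟩ := WithTop.ne_top_iff_exists.1 hPB
    obtain ⟨x, hx⟩ := WithTop.ne_top_iff_exists.1 hPB'
    obtain ⟨y, hy⟩ := WithTop.ne_top_iff_exists.1 e1.2.1
    obtain ⟨z, hz⟩ := WithTop.ne_top_iff_exists.1 e2.2.1
    rw [← hw, ← hx, ← hy, ← hz]
    norm_cast
    exact (Subsingleton.elim _ _).le
  · have : 0 < (B \ B').card := Finset.card_pos.2 ⟨i, Finset.mem_sdiff.2 ⟨hi, hi'⟩⟩
    exact global_exchange P r hg ((B \ B').card - 1) B B' hB hB' hPB hPB' (by omega) i hi hi'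

lemma tropPlucker_of_good (P : Finset E → WithTop Γ) (r : ℕ) (hg : GoodEx P r) :
    TropPlucker P r := by
  intro I J hI hJ j hj hmin
  rw [Finset.mem_sdiff] at hj
  by_cases htop : P (insert j I) + P (J.erase j) = ⊤
  · exact Or.inl htop
  right
  have h1 : P (insert j I) ≠ ⊤ := fun h => htop (by simp [h])
  have h2 : P (J.erase j) ≠ ⊤ := fun h => htop (by simp [h])
  obtain ⟨v, hv, hv', hle⟩ := exchange_all P r hg (insert j I) (J.erase j)
    (by rw [Finset.card_insert_of_notMem hj.2, hI])
    (by rw [Finset.card_erase_of_mem hj.1, hJ]; rfl) h1 h2 j (by simp) (by simp)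
  have e1 : insert v ((insert j I).erase j) = insert v I := by grind
  have e2 : insert j ((J.erase j).erase v) = J.erase v := by grind
  rw [e1, e2] at hle
  have hvm : v ∈ J \ I := by grind
  exact ⟨v, hvm, by grind, le_antisymm hle (hmin v hvm)⟩

lemma exists_init (P : Finset E → WithTop Γ) (r : ℕ)
    (hP : ∃ B : Finset E, B.card = r ∧ P B ≠ ⊤) (u : E → Γ) : ∃ B, InitBasis P r u B := by
  obtain ⟨B₀, hB₀⟩ := hP
  obtain ⟨Y, hY, hmin⟩ := Finset.exists_min_image
    (Finset.univ.filter fun Y : Finset E => Y.card = r ∧ P Y ≠ ⊤)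
    (fun Y => (P Y).untopD 0 - ∑ i ∈ Y, u i) ⟨B₀, by simpa using hB₀⟩
  simp only [Finset.mem_filter, Finset.mem_univ, true_and] at hY hmin
  obtain ⟨y, hy⟩ := WithTop.ne_top_iff_exists.1 hY.2
  refine ⟨Y, (initBasis_iff _ _ _ _).2 ⟨hY.1, y, hy.symm, fun B' hB' q hq => ?_⟩⟩
  simpa [← hy, hq] using hmin B' ⟨hB', by simp [hq]⟩

lemma init_exchange (P : Finset E → WithTop Γ) (r : ℕ) (hT : TropPlucker P r) (u : E → Γ)
    (B₁ B₂ : Finset E) (h1 : InitBasis P r u B₁) (h2 : InitBasis P r u B₂)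
    (i : E) (hi1 : i ∈ B₁) (hi2 : i ∉ B₂) :
    ∃ j ∈ B₂, j ∉ B₁ ∧ InitBasis P r u (insert j (B₁.erase i)) := by
  rw [initBasis_iff] at h1 h2
  obtain ⟨hc1, p, hp, hmin1⟩ := h1
  obtain ⟨hc2, q, hq, hmin2⟩ := h2
  have hpos : 0 < B₁.card := Finset.card_pos.2 ⟨i, hi1⟩
  have hpq1 := hmin1 B₂ hc2 q hq
  have hpq2 := hmin2 B₁ hc1 p hp
  have ei : insert i (B₁.erase i) = B₁ := Finset.insert_erase hi1
  have ei' : (insert i B₂).erase i = B₂ := Finset.erase_insert hi2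
  have key : ∀ k ∈ B₂, k ∉ B₁ → ∀ y z : Γ, P (insert k (B₁.erase i)) = y →
      P ((insert i B₂).erase k) = z →
      p - ∑ e ∈ B₁, u e ≤ y - ∑ e ∈ insert k (B₁.erase i), u e ∧
      p + q ≤ y + z ∧ (y + z = p + q →
        y - ∑ e ∈ insert k (B₁.erase i), u e = p - ∑ e ∈ B₁, u e) := by
    intro k hk hk' y z hy hz
    have hik : i ≠ k := by rintro rfl; exact hi2 hk
    have c1 : (insert k (B₁.erase i)).card = r := by
      rw [Finset.card_insert_of_notMem (by grind), Finset.card_erase_of_mem hi1]; omega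
    have c2 : ((insert i B₂).erase k).card = r := by
      rw [Finset.card_erase_of_mem (by grind), Finset.card_insert_of_notMem hi2]; omega
    have m1 := hmin1 _ c1 y hy
    have m2 := hmin1 _ c2 z hz
    have s1 : ∑ e ∈ insert k (B₁.erase i), u e = u k + ∑ e ∈ B₁.erase i, u e :=
      Finset.sum_insert (by grind)
    have s2 : u i + ∑ e ∈ B₁.erase i, u e = ∑ e ∈ B₁, u e := Finset.add_sum_erase _ _ hi1
    have s3 : u k + ∑ e ∈ (insert i B₂).erase k, u e = ∑ e ∈ insert i B₂, u e :=
      Finset.add_sum_erase _ _ (by grind)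
    have s4 : ∑ e ∈ insert i B₂, u e = u i + ∑ e ∈ B₂, u e := Finset.sum_insert hi2
    refine ⟨m1, ?_, ?_⟩
    · grind
    · intro h
      grind
  obtain h | ⟨j, hj, hji, hj'⟩ := hT (B₁.erase i) (insert i B₂)
    (by rw [Finset.card_erase_of_mem hi1]; omega)
    (by rw [Finset.card_insert_of_notMem hi2, hc2]) i (by grind) (by
      intro k hk
      rw [ei, ei', hp, hq]
      by_cases hki : k = i
      · subst hki; rw [ei, ei', hp, hq]
      have hk2 : k ∈ B₂ := by grind
      have hk1 : k ∉ B₁ := by grind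
      rcases hy : P (insert k (B₁.erase i)) with _ | y
      · exact le_top
      rcases hz : P ((insert i B₂).erase k) with _ | z
      · exact le_top
      exact WithTop.coe_le_coe.2 (key k hk2 hk1 y z hy hz).2.1)
  · rw [ei, ei', hp, hq] at h
    exact absurd h (by simp [← WithTop.coe_add])
  · rw [ei, ei', hp, hq] at hj'
    have hj2 : j ∈ B₂ := by grind
    have hj1 : j ∉ B₁ := by grind
    refine ⟨j, hj2, hj1, ?_⟩
    have hne1 : P (insert j (B₁.erase i)) ≠ ⊤ := by
      intro h; rw [h] at hj'; simp [← WithTop.coe_add] at hj'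
    have hne2 : P ((insert i B₂).erase j) ≠ ⊤ := by
      intro h; rw [h] at hj'; simp [← WithTop.coe_add] at hj'
    obtain ⟨y, hy⟩ := WithTop.ne_top_iff_exists.1 hne1
    obtain ⟨z, hz⟩ := WithTop.ne_top_iff_exists.1 hne2
    rw [← hy, ← hz] at hj'
    norm_cast at hj'
    have := (key j hj2 hj1 y z hy.symm hz.symm).2.2 hj'
    rw [initBasis_iff]
    refine ⟨?_, y, hy.symm, ?_⟩
    · rw [Finset.card_insert_of_notMem (by grind), Finset.card_erase_of_mem hi1]; omega
    · rw [this]; exact hmin1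

end Helpers

/-- A function `P` on the `r`-subsets of `E` with values in `Γ ∪ {∞}`, not
identically `∞`, is a valuated matroid iff for every `u : E → Γ` the initial system `𝓑^u(P)`
is the set of bases of a matroid on `E`. -/
theorem tropPlucker_iff_forall_initial_isBaseFamily
    {E : Type*} [Fintype E] [DecidableEq E] {Γ : Type*} [AddCommGroup Γ] [LinearOrder Γ] [IsOrderedAddMonoid Γ]
    (r : ℕ) (hr1 : 1 ≤ r) (hr2 : r ≤ Fintype.card E)
    (P : Finset E → WithTop Γ)
    (hP : ∃ B : Finset E, B.card = r ∧ P B ≠ ⊤) :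
    TropPlucker P r ↔
      ∀ u : E → Γ, ∃ M : Matroid E, M.E = Set.univ ∧
        ∀ B : Finset E, (M.IsBase ↑B ↔ InitBasis P r u B) := by
  constructor
  · intro hT u
    obtain ⟨B₀, hB₀⟩ := exists_init P r hP u
    refine ⟨Matroid.ofIsBaseOfFinite (E := Set.univ) Set.finite_univ
      (fun X => ∃ B : Finset E, (B : Set E) = X ∧ InitBasis P r u B) ⟨_, B₀, rfl, hB₀⟩ ?_
      (fun _ _ => Set.subset_univ _), rfl, fun B => ?_⟩
    · rintro _ _ ⟨B₁, rfl, h1⟩ ⟨B₂, rfl, h2⟩ i hi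
      obtain ⟨j, hj, hj', h⟩ := init_exchange P r hT u B₁ B₂ h1 h2 i (by simpa using hi.1)
        (by simpa using hi.2)
      exact ⟨j, ⟨by simpa using hj, by simpa using hj'⟩, _, by simp, h⟩
    · constructor
      · rintro ⟨B', hB', h⟩
        rwa [← Finset.coe_injective hB']
      · intro h
        exact ⟨B, rfl, h⟩
  · intro h
    apply tropPlucker_of_good
    intro u B₁ B₂ h1 h2 i hi hi'
    obtain ⟨M, -, hM⟩ := h u
    obtain ⟨j, hj, hj', e1, e2⟩ := matroid_strong_exchange M ((hM B₁).2 h1) ((hM B₂).2 h2)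
      (i := i) (by simpa using hi) (by simpa using hi')
    refine ⟨j, by simpa using hj, by simpa using hj', ?_, ?_⟩
    · rw [← hM]; simpa using e1
    · rw [← hM]; simpa using e2
end

section
/- Let K be a field, Γ a linearly ordered abelian group, E a finite linearly ordered set, and 1 ≤ r ≤ |E|. Let (a, v) be a pair where a maps r-subsets of E to K and v maps r-subsets of E to Γ∪{∞}, with a(B) = 0 exactly when v(B) = ∞, and a not identically 0. For u : E → Γ define the initial function a^u by a^u(B) = a(B) if v(B) ≠ ∞ and v(B) − Σ_{i∈B}u_i is minimal among all r-subsets, and a^u(B) = 0 otherwise. Then the following are equivalent: (i) for every (r−1)-subset I and (r+1)-subset J, letting m = min_{j∈J∖I}(v(I∪{j}) + v(J∖{j})) in Γ∪{∞}, either m = ∞ or Σ_{j∈J∖I : v(I∪{j})+v(J∖{j}) = m} sign(j;I,J)·a(I∪{j})·a(J∖{j}) = 0 in K (i.e. (a,v) represents a strong K[Γ]-matroid, where the field K is regarded as a perfect tract); (ii) for every u : E → Γ, the initial function a^u satisfies the classical Grassmann–Plücker relations over K: Σ_{j∈J∖I} sign(j;I,J)·a^u(I∪{j})·a^u(J∖{j})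 = 0 for every (r−1)-subset I and (r+1)-subset J. (This is Theorem A of the paper for F = K a field.) -/
open scoped Classical

/-- `sign(j; I, J) = (-1)^ℓ` in a field `K`, where `ℓ` is the number of `j' ∈ J` with `j < j'`
plus the number of `i ∈ I` with `j < i`. -/
def fsign {K : Type*} [Field K] {E : Type*} [LinearOrder E] (j : E) (I J : Finset E) : K :=
  (-1 : K) ^ ((J.filter fun j' => j < j').card + (I.filter fun i => j < i).card)

/-- The initial function `a^u` of a pair `(a, v)` representing a `K[Γ]`-valued Plücker vector:
`a^u(B) = a(B)` if `v(B) ≠ ∞` and `v(B) - ∑_{i∈B} u_i` is minimal among all `r`-subsets,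
and `a^u(B) = 0` otherwise. -/
noncomputable def initialCoeff {K : Type*} [Field K] {E : Type*} [Fintype E]
    {Γ : Type*} [AddCommGroup Γ] [LinearOrder Γ] [IsOrderedAddMonoid Γ]
    (a : Finset E → K) (v : Finset E → WithTop Γ) (r : ℕ) (u : E → Γ) (B : Finset E) : K :=
  if v B ≠ ⊤ ∧ ∀ B' : Finset E, B'.card = r →
      wsub (v B) (∑ i ∈ B, u i) ≤ wsub (v B') (∑ i ∈ B', u i)
  then a B else 0


section aux
variable {K : Type*} [Field K] {E : Type*} [LinearOrder E]

/-- The sign of `j` relative to the set `S`. -/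
def epsS (K : Type*) [Field K] {E : Type*} [LinearOrder E] (j : E) (S : Finset E) : K :=
  (-1 : K) ^ (S.filter fun i => j < i).card

/-- The covector attached to `I`. -/
noncomputable def covec (p : Finset E → K) (I : Finset E) (j : E) : K :=
  if j ∈ I then 0 else epsS K j I * p (insert j I)

lemma epsS_sq (j : E) (S : Finset E) : epsS K j S * epsS K j S = 1 := by
  unfold epsS
  rw [← pow_add, ← two_mul, pow_mul]; simp

lemma fsign_eq (j : E) (I J : Finset E) : (fsign j I J : K) = epsS K j J * epsS K j I := by
  unfold fsign epsS
  rw [pow_add]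

lemma epsS_insert (j b : E) (S : Finset E) (h : j ∉ S) :
    epsS K b (insert j S) = (if b < j then -1 else 1) * epsS K b S := by
  unfold epsS
  rw [Finset.filter_insert]
  split_ifs with hb
  · rw [Finset.card_insert_of_notMem (by simp [h]), pow_succ]; ring
  · simp

lemma epsS_insert_self (j : E) (S : Finset E) (h : j ∉ S) :
    epsS K j (insert j S) = epsS K j S := by
  rw [epsS_insert j j S h]; simp

lemma epsS_erase_self (j : E) (S : Finset E) (h : j ∈ S) :
    epsS K j (S.erase j) = epsS K j S := by
  conv_rhs => rw [← Finset.insert_erase h]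
  rw [epsS_insert_self _ _ (by simp)]

lemma epsS_swap (j b : E) (B : Finset E) (hj : j ∉ B) (hb : b ∈ B) :
    epsS K j B * epsS K b (insert j B) = - (epsS K b B * epsS K j (B.erase b)) := by
  rw [epsS_insert j b B hj]
  conv_lhs => rw [← Finset.insert_erase hb]
  rw [epsS_insert b j (B.erase b) (by simp), Finset.insert_erase hb]
  have hne : j ≠ b := fun h => hj (h ▸ hb)
  rcases lt_or_gt_of_ne hne with h | h
  · rw [if_pos h, if_neg h.le.not_gt]; ring
  · rw [if_neg h.le.not_gt, if_pos h]; ring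

/-- The Grassmann-Plücker relations. -/
def IsGP (r : ℕ) (p : Finset E → K) : Prop :=
  ∀ I J : Finset E, I.card + 1 = r → J.card = r + 1 →
    ∑ j ∈ J \ I, fsign j I J * p (insert j I) * p (J.erase j) = 0

lemma IsGP.covec_sum {r : ℕ} {p : Finset E → K} (h : IsGP r p) (I J : Finset E)
    (hI : I.card + 1 = r) (hJ : J.card = r + 1) :
    ∑ j ∈ J, epsS K j J * covec p I j * p (J.erase j) = 0 := by
  rw [← h I J hI hJ, Finset.sdiff_eq_filter, Finset.sum_filter]
  refine Finset.sum_congr rfl fun j _ => ?_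
  unfold covec
  by_cases hj : j ∈ I
  · simp [hj]
  · simp only [hj, if_false, not_false_eq_true, if_true, fsign_eq]; ring

lemma IsGP.expand {r : ℕ} {p : Finset E → K} (h : IsGP r p) (I B : Finset E)
    (hI : I.card + 1 = r) (hB : B.card = r) (j : E) :
    p B * covec p I j = ∑ b ∈ B, epsS K b B * covec p I b * covec p (B.erase b) j := by
  by_cases hj : j ∈ B
  · rw [Finset.sum_eq_single_of_mem j hj]
    · have : covec p (B.erase j) j = epsS K j B * p B := by
        unfold covec
        rw [if_neg (by simp), epsS_erase_self _ _ hj, Finset.insert_erase hj]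
      rw [this]
      linear_combination (- p B * covec p I j) * epsS_sq (K := K) j B
    · intro b _ hbj
      have : covec p (B.erase b) j = 0 := by
        unfold covec
        rw [if_pos (Finset.mem_erase.2 ⟨hbj.symm, hj⟩)]
      rw [this, mul_zero]
  · have h1 := h.covec_sum I (insert j B) hI (by rw [Finset.card_insert_of_notMem hj, hB])
    rw [Finset.sum_insert hj, Finset.erase_insert hj, epsS_insert_self j B hj] at h1
    have h2 : ∑ b ∈ B, epsS K b B * covec p I b * covec p (B.erase b) j =
        - epsS K j B * ∑ b ∈ B, epsS K b (insert j B) * covec p I b * p ((insert j B).erase b) := by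
      rw [Finset.mul_sum]
      refine Finset.sum_congr rfl fun b hb => ?_
      have hne : j ≠ b := fun h => hj (h ▸ hb)
      have hc : covec p (B.erase b) j = epsS K j (B.erase b) * p ((insert j B).erase b) := by
        unfold covec
        rw [if_neg (by simp [hj]), Finset.erase_insert_of_ne hne]
      rw [hc]
      linear_combination (covec p I b * p ((insert j B).erase b)) * epsS_swap (K := K) j b B hj hb
    rw [h2]
    linear_combination (epsS K j B) * h1 - (p B * covec p I j) * epsS_sq (K := K) j B

variable [Fintype E]

/-- `C` is orthogonal to all covectors of `p`. -/
def Orth (r : ℕ) (C : E → K) (p : Finset E → K) : Prop :=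
  ∀ I : Finset E, I.card + 1 = r → ∑ j, C j * covec p I j = 0

lemma IsGP.orth_of {r : ℕ} {p : Finset E → K} (h : IsGP r p) (C : E → K) (B : Finset E)
    (hB : B.card = r) (hpB : p B ≠ 0)
    (hC : ∀ b ∈ B, ∑ j, C j * covec p (B.erase b) j = 0) : Orth r C p := by
  intro I hI
  have : p B * ∑ j, C j * covec p I j = 0 := by
    calc p B * ∑ j, C j * covec p I j
        = ∑ j, ∑ b ∈ B, epsS K b B * covec p I b * (C j * covec p (B.erase b) j) := by
          rw [Finset.mul_sum]
          refine Finset.sum_congr rfl fun j _ => ?_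
          rw [mul_left_comm, h.expand I B hI hB j, Finset.mul_sum]
          exact Finset.sum_congr rfl fun b _ => by ring
      _ = ∑ b ∈ B, epsS K b B * covec p I b * ∑ j, C j * covec p (B.erase b) j := by
          rw [Finset.sum_comm]
          exact Finset.sum_congr rfl fun b _ => by rw [Finset.mul_sum]
      _ = 0 := Finset.sum_eq_zero fun b hb => by rw [hC b hb, mul_zero]
  exact (mul_eq_zero.1 this).resolve_left hpB

lemma sum_covec_congr {r : ℕ} {p q : Finset E → K} (C : E → K) (x : E) (hx : C x = 0)
    (I : Finset E) (hI : I.card + 1 = r)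
    (h : ∀ j, j ≠ x → j ∉ I → (insert j I).card = r → p (insert j I) = q (insert j I)) :
    ∑ j, C j * covec p I j = ∑ j, C j * covec q I j := by
  refine Finset.sum_congr rfl fun j _ => ?_
  by_cases hj : j = x
  · simp [hj, hx]
  · unfold covec
    by_cases hjI : j ∈ I
    · simp [hjI]
    · rw [if_neg hjI, if_neg hjI, h j hj hjI (by rw [Finset.card_insert_of_notMem hjI, hI])]

lemma Orth.congr {r : ℕ} {p q : Finset E → K} {C : E → K} (x : E) (hx : C x = 0)
    (h : ∀ B : Finset E, B.card = r → p B = q B) (hp : Orth r C p) : Orth r C q := by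
  intro I hI
  rw [← sum_covec_congr (p := p) C x hx I hI fun j _ _ hc => h _ hc]
  exact hp I hI

variable {Γ : Type*} [AddCommGroup Γ] [LinearOrder Γ] [IsOrderedAddMonoid Γ]

lemma wsub_coe (g h : Γ) : wsub (g : WithTop Γ) h = ((g - h : Γ) : WithTop Γ) := rfl
lemma wsub_top (h : Γ) : wsub (⊤ : WithTop Γ) h = ⊤ := rfl

lemma wsub_add (y : WithTop Γ) (g h : Γ) : wsub y (g + h) = wsub (wsub y g) h := by
  induction y with
  | top => rfl
  | coe y => simp only [wsub_coe, sub_sub]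

lemma wsub_ne_top {y : WithTop Γ} {g : Γ} : wsub y g ≠ ⊤ ↔ y ≠ ⊤ := by
  induction y with
  | top => simp [wsub_top]
  | coe y => simp [wsub_coe]

lemma wsub_mono {y z : WithTop Γ} (g : Γ) : wsub y g ≤ wsub z g ↔ y ≤ z := by
  induction y with
  | top => induction z with
    | top => simp
    | coe z => simp [wsub_top, wsub_coe]
  | coe y => induction z with
    | top => simp [wsub_top]
    | coe z => simp [wsub_coe]

/-- coordinate shift -/
def shiftC (u : E → Γ) (x : E) (t : Γ) : E → Γ := fun i => u i + if i = x then t else 0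

lemma wsub_shift (v : Finset E → WithTop Γ) (u : E → Γ) (x : E) (t : Γ) (B : Finset E) :
    wsub (v B) (∑ i ∈ B, shiftC u x t i) =
      wsub (wsub (v B) (∑ i ∈ B, u i)) (if x ∈ B then t else 0) := by
  unfold shiftC
  rw [Finset.sum_add_distrib, wsub_add, Finset.sum_ite_eq']

lemma step {r : ℕ} (a : Finset E → K) (v : Finset E → WithTop Γ)
    (hav : ∀ B : Finset E, B.card = r → (a B = 0 ↔ v B = ⊤))
    (hGP : ∀ u : E → Γ, IsGP r (initialCoeff a v r u))
    (C : E → K) (x : E) (hx : C x = 0) (u : E → Γ) (s : Γ) (hs : 0 ≤ s)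
    (hP : Orth r C (initialCoeff a v r u)) :
    Orth r C (initialCoeff a v r (shiftC u x s)) := by
  by_cases h1 : ∀ B : Finset E, B.card = r → v B ≠ ⊤ → x ∉ B
  · refine hP.congr x hx fun B hB => ?_
    have : ∀ B : Finset E, B.card = r → wsub (v B) (∑ i ∈ B, shiftC u x s i) =
        wsub (v B) (∑ i ∈ B, u i) := by
      intro B hB
      by_cases hv : v B = ⊤
      · rw [hv]; rfl
      · rw [wsub_shift, if_neg (h1 B hB hv), ← wsub_add, add_zero]
    unfold initialCoeff
    rw [this B hB]
    congr 1
    simp only [eq_iff_iff]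
    refine and_congr_right fun _ => forall_congr' fun B' => forall_congr' fun hB' => ?_
    rw [this B' hB']
  by_cases h0 : ∀ B : Finset E, B.card = r → v B ≠ ⊤ → x ∈ B
  · refine hP.congr x hx fun B hB => ?_
    have : ∀ B : Finset E, B.card = r → wsub (v B) (∑ i ∈ B, shiftC u x s i) =
        wsub (wsub (v B) (∑ i ∈ B, u i)) s := by
      intro B hB
      by_cases hv : v B = ⊤
      · rw [hv]; rfl
      · rw [wsub_shift, if_pos (h0 B hB hv)]
    unfold initialCoeff
    rw [this B hB]
    congr 1
    simp only [eq_iff_iff]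
    refine and_congr_right fun _ => forall_congr' fun B' => forall_congr' fun hB' => ?_
    rw [this B' hB', wsub_mono]
  push Not at h0 h1
  set f : Finset E → WithTop Γ := fun B => wsub (v B) (∑ i ∈ B, u i) with hf
  obtain ⟨B1, hB1, hm1⟩ := Finset.exists_min_image
    (Finset.univ.filter fun B : Finset E => B.card = r ∧ x ∈ B) f
    (by obtain ⟨B, h, _, h'⟩ := h1; exact ⟨B, by simp [h, h']⟩)
  obtain ⟨B0, hB0, hm0⟩ := Finset.exists_min_image
    (Finset.univ.filter fun B : Finset E => B.card = r ∧ x ∉ B) f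
    (by obtain ⟨B, h, _, h'⟩ := h0; exact ⟨B, by simp [h, h']⟩)
  simp only [Finset.mem_filter, Finset.mem_univ, true_and] at hB1 hm1 hB0 hm0
  have ht1 : f B1 ≠ ⊤ := by
    obtain ⟨B, h, h'', h'⟩ := h1
    exact ne_top_of_le_ne_top (wsub_ne_top.2 h'') (hm1 B ⟨h, h'⟩)
  have ht0 : f B0 ≠ ⊤ := by
    obtain ⟨B, h, h'', h'⟩ := h0
    exact ne_top_of_le_ne_top (wsub_ne_top.2 h'') (hm0 B ⟨h, h'⟩)
  obtain ⟨c1, hc1⟩ := WithTop.ne_top_iff_exists.1 ht1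
  obtain ⟨c0, hc0⟩ := WithTop.ne_top_iff_exists.1 ht0
  rw [← hc1] at hm1
  rw [← hc0] at hm0
  have char0 : ∀ t B, B.card = r → x ∉ B → initialCoeff a v r (shiftC u x t) B =
      if f B = c0 ∧ c0 ≤ c1 - t then a B else 0 := by
    intro t B hB hxB
    unfold initialCoeff
    congr 1
    simp only [eq_iff_iff, wsub_shift, if_neg hxB, ← wsub_add _ _ (0:Γ), add_zero]
    constructor
    · rintro ⟨hv, hall⟩
      have e0 := hall B0 hB0.1
      rw [if_neg hB0.2, ← wsub_add, add_zero] at e0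
      have e1 := hall B1 hB1.1
      rw [if_pos hB1.2] at e1
      change f B ≤ f B0 at e0
      change f B ≤ wsub (f B1) t at e1
      have : f B = c0 := le_antisymm (hc0 ▸ e0) (hm0 B ⟨hB, hxB⟩)
      refine ⟨this, ?_⟩
      rw [this, ← hc1, wsub_coe] at e1
      exact_mod_cast e1
    · rintro ⟨hfB, hc⟩
      refine ⟨(wsub_ne_top (g := ∑ i ∈ B, u i)).1 (by change f B ≠ ⊤; rw [hfB]; simp), ?_⟩
      intro B' hB'
      change f B ≤ wsub (f B') _
      rw [hfB]
      split_ifs with hx'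
      · have := (wsub_mono t).2 (hm1 B' ⟨hB', hx'⟩)
        refine le_trans ?_ this
        rw [wsub_coe]; exact_mod_cast hc
      · have := (wsub_mono 0).2 (hm0 B' ⟨hB', hx'⟩)
        refine le_trans ?_ this
        rw [wsub_coe]; simp
  have char1 : ∀ t B, B.card = r → x ∈ B → initialCoeff a v r (shiftC u x t) B =
      if f B = c1 ∧ c1 - t ≤ c0 then a B else 0 := by
    intro t B hB hxB
    unfold initialCoeff
    congr 1
    simp only [eq_iff_iff, wsub_shift, if_pos hxB]
    constructor
    · rintro ⟨hv, hall⟩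
      have e0 := hall B0 hB0.1
      rw [if_neg hB0.2, ← wsub_add _ _ (0:Γ), add_zero] at e0
      have e1 := hall B1 hB1.1
      rw [if_pos hB1.2, wsub_mono] at e1
      change wsub (f B) t ≤ f B0 at e0
      change f B ≤ f B1 at e1
      have : f B = c1 := le_antisymm (hc1 ▸ e1) (hm1 B ⟨hB, hxB⟩)
      refine ⟨this, ?_⟩
      rw [this, ← hc0, wsub_coe] at e0
      exact_mod_cast e0
    · rintro ⟨hfB, hc⟩
      refine ⟨(wsub_ne_top (g := ∑ i ∈ B, u i)).1 (by change f B ≠ ⊤; rw [hfB]; simp), ?_⟩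
      intro B' hB'
      change wsub (f B) t ≤ wsub (f B') _
      rw [hfB]
      split_ifs with hx'
      · exact (wsub_mono t).2 (hm1 B' ⟨hB', hx'⟩)
      · have := (wsub_mono 0).2 (hm0 B' ⟨hB', hx'⟩)
        refine le_trans ?_ this
        rw [wsub_coe, wsub_coe, sub_zero]; exact_mod_cast hc
  have hu : u = shiftC u x 0 := by unfold shiftC; simp
  rw [hu] at hP
  rcases lt_or_ge c1 c0 with hlt | hge
  · refine hP.congr x hx fun B hB => ?_
    by_cases hxB : x ∈ B
    · rw [char1 _ B hB hxB, char1 _ B hB hxB]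
      have e1 : c1 - 0 ≤ c0 := by simpa using hlt.le
      have e2 : c1 - s ≤ c0 := (sub_le_self _ hs).trans hlt.le
      simp [e2, hlt.le]
    · rw [char0 _ B hB hxB, char0 _ B hB hxB]
      have e1 : ¬ c0 ≤ c1 - 0 := by simpa using hlt
      have e2 : ¬ c0 ≤ c1 - s := not_le.2 ((sub_le_self _ hs).trans_lt hlt)
      rw [if_neg (fun h => e1 h.2), if_neg (fun h => e2 h.2)]
  rcases lt_or_ge c0 (c1 - s) with hlt' | hge'
  · refine hP.congr x hx fun B hB => ?_
    have h3 : c0 < c1 := hlt'.trans_le (sub_le_self _ hs)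
    by_cases hxB : x ∈ B
    · rw [char1 _ B hB hxB, char1 _ B hB hxB]
      have e1 : ¬ c1 - 0 ≤ c0 := by simpa using h3
      rw [if_neg (fun h => e1 h.2), if_neg (fun h => hlt'.not_ge h.2)]
    · rw [char0 _ B hB hxB, char0 _ B hB hxB]
      have e1 : c0 ≤ c1 - 0 := by simpa using h3.le
      simp only [e1, hlt'.le]
  -- the wall
  have w0 : c0 ≤ c1 - (c1 - c0) := by simp
  have w1 : c1 - (c1 - c0) ≤ c0 := by simp
  have hW : Orth r C (initialCoeff a v r (shiftC u x (c1 - c0))) := by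
    refine (hGP _).orth_of C B0 hB0.1 ?_ ?_
    · rw [char0 _ B0 hB0.1 hB0.2, if_pos ⟨hc0.symm, w0⟩]
      exact fun h => wsub_ne_top.1 ht0 ((hav B0 hB0.1).1 h)
    · intro b hb
      have hcard : (B0.erase b).card + 1 = r := by
        rw [Finset.card_erase_add_one hb, hB0.1]
      rw [← hP (B0.erase b) hcard]
      refine sum_covec_congr C x hx _ hcard fun j hj _ hc => ?_
      have hxB : x ∉ insert j (B0.erase b) := by
        simp [hj.symm, hB0.2]
      have e1 : c0 ≤ c1 - 0 := by simpa using hge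
      rw [char0 _ _ hc hxB, char0 _ _ hc hxB]
      simp only [w0, e1]
  intro I hI
  by_cases hxI : x ∈ I
  · rw [← hW I hI]
    refine sum_covec_congr C x hx _ hI fun j hj _ hc => ?_
    have hxB : x ∈ insert j I := by simp [hxI]
    rw [char1 _ _ hc hxB, char1 _ _ hc hxB]
    simp only [w1, hge']
  · by_cases hcc : c0 ≤ c1 - s
    · rw [← hW I hI]
      refine sum_covec_congr C x hx _ hI fun j hj _ hc => ?_
      have hxB : x ∉ insert j I := by simp [hxI, hj.symm]
      rw [char0 _ _ hc hxB, char0 _ _ hc hxB]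
      simp only [w0, hcc]
    · have : ∑ j, C j * covec (fun _ : Finset E => (0:K)) I j = 0 := by simp [covec]
      rw [← this]
      refine sum_covec_congr C x hx _ hI fun j hj _ hc => ?_
      have hxB : x ∉ insert j I := by simp [hxI, hj.symm]
      rw [char0 _ _ hc hxB, if_neg (fun h => hcc h.2)]

lemma steps {r : ℕ} (a : Finset E → K) (v : Finset E → WithTop Γ)
    (hav : ∀ B : Finset E, B.card = r → (a B = 0 ↔ v B = ⊤))
    (hGP : ∀ u : E → Γ, IsGP r (initialCoeff a v r u))
    (C : E → K) (u : E → Γ) (s : Γ) (hs : 0 ≤ s)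
    (hP : Orth r C (initialCoeff a v r u)) (S : Finset E) (hS : ∀ x ∈ S, C x = 0) :
    Orth r C (initialCoeff a v r (fun i => u i + if i ∈ S then s else 0)) := by
  induction S using Finset.induction_on with
  | empty => simpa using hP
  | insert x S hxS ih =>
    have := step a v hav hGP C x (hS x (by simp)) _ s hs
      (ih fun y hy => hS y (by simp [hy]))
    convert this using 2
    funext i
    unfold shiftC
    by_cases hi : i = x
    · subst hi; simp [hxS]
    · simp [hi]

lemma exists_big {ι : Type*} [Finite ι] (F : ι → Γ) : ∃ N : Γ, 0 ≤ N ∧ ∀ i, F i ≤ N := by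
  obtain ⟨M, hM⟩ := Finite.exists_le F
  exact ⟨max M 0, le_max_right _ _, fun i => (hM i).trans (le_max_left _ _)⟩

lemma initialCoeff_of_min {r : ℕ} (a : Finset E → K) (v : Finset E → WithTop Γ) (u : E → Γ)
    (c : Γ) (hc : ∀ B : Finset E, B.card = r → (c : WithTop Γ) ≤ wsub (v B) (∑ i ∈ B, u i))
    (B0 : Finset E) (hB0 : B0.card = r) (hc0 : wsub (v B0) (∑ i ∈ B0, u i) = c)
    (B : Finset E) (hB : B.card = r) :
    initialCoeff a v r u B = if wsub (v B) (∑ i ∈ B, u i) = c then a B else 0 := by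
  unfold initialCoeff
  congr 1
  simp only [eq_iff_iff]
  constructor
  · rintro ⟨_, h⟩
    exact le_antisymm (hc0 ▸ h B0 hB0) (hc B hB)
  · intro h
    refine ⟨(wsub_ne_top (g := ∑ i ∈ B, u i)).1 (by rw [h]; simp), fun B' hB' => ?_⟩
    rw [h]; exact hc B' hB'

lemma pair_sum (v : Finset E → WithTop Γ) (u : E → Γ) (I J : Finset E) (j : E) (hj : j ∈ J \ I) :
    v (insert j I) + v (J.erase j) =
      (wsub (v (insert j I)) (∑ i ∈ insert j I, u i) + wsub (v (J.erase j)) (∑ i ∈ J.erase j, u i))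
       + ((∑ i ∈ I, u i + ∑ i ∈ J, u i : Γ) : WithTop Γ) := by
  obtain ⟨hjJ, hjI⟩ := Finset.mem_sdiff.1 hj
  rw [Finset.sum_insert hjI, ← Finset.add_sum_erase J u hjJ]
  generalize v (insert j I) = y
  generalize v (J.erase j) = z
  induction y with
  | top => simp [wsub_top]
  | coe y => induction z with
    | top => simp [wsub_top]
    | coe z =>
      rw [wsub_coe, wsub_coe]
      norm_cast
      abel

lemma sum_eq_iff (c : Γ) (y z : WithTop Γ) (hy : (c : WithTop Γ) ≤ y) (hz : (c : WithTop Γ) ≤ z) :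
    y + z = ((c + c : Γ) : WithTop Γ) ↔ y = c ∧ z = c := by
  induction y with
  | top => simp [-WithTop.coe_add]
  | coe y => induction z with
    | top => simp [-WithTop.coe_add]
    | coe z =>
      norm_cast at *
      constructor
      · intro h
        have h1 : y ≤ c := by
          by_contra hh
          exact absurd h (ne_of_gt (add_lt_add_of_lt_of_le (not_le.1 hh) hz))
        have h2 : y = c := le_antisymm h1 hy
        subst h2
        exact ⟨rfl, add_left_cancel h⟩
      · rintro ⟨rfl, rfl⟩; rfl

lemma forward {r : ℕ} (a : Finset E → K) (v : Finset E → WithTop Γ) (u : E → Γ) (I J : Finset E)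
    (hI : I.card + 1 = r) (hJ : J.card = r + 1)
    (h : (J \ I).inf (fun j => v (insert j I) + v (J.erase j)) = ⊤ ∨
          ∑ j ∈ (J \ I).filter (fun j =>
              v (insert j I) + v (J.erase j) =
                (J \ I).inf (fun j' => v (insert j' I) + v (J.erase j'))),
            fsign j I J * a (insert j I) * a (J.erase j) = 0) :
    ∑ j ∈ J \ I, fsign j I J * initialCoeff a v r u (insert j I) *
          initialCoeff a v r u (J.erase j) = 0 := by
  have hcI : ∀ j ∈ J \ I, (insert j I).card = r := fun j hj => by
    rw [Finset.card_insert_of_notMem (Finset.mem_sdiff.1 hj).2, hI]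
  have hcJ : ∀ j ∈ J \ I, (J.erase j).card = r := fun j hj => by
    rw [Finset.card_erase_of_mem (Finset.mem_sdiff.1 hj).1, hJ]; rfl
  by_cases hex : ∃ j0 ∈ J \ I, initialCoeff a v r u (insert j0 I) ≠ 0 ∧
      initialCoeff a v r u (J.erase j0) ≠ 0
  · obtain ⟨j0, hj0, h1, h2⟩ := hex
    unfold initialCoeff at h1 h2
    have m1 := (ite_ne_right_iff.1 h1).1
    have m2 := (ite_ne_right_iff.1 h2).1
    obtain ⟨c, hc⟩ := WithTop.ne_top_iff_exists.1
      ((wsub_ne_top (g := ∑ i ∈ insert j0 I, u i)).2 m1.1)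
    have hc2 : wsub (v (J.erase j0)) (∑ i ∈ J.erase j0, u i) = c := by
      rw [hc]; exact le_antisymm (m2.2 _ (hcI j0 hj0)) (m1.2 _ (hcJ j0 hj0))
    have hmin : ∀ B : Finset E, B.card = r → (c : WithTop Γ) ≤ wsub (v B) (∑ i ∈ B, u i) := by
      rw [hc]; exact m1.2
    have hch := initialCoeff_of_min a v u c hmin _ (hcI j0 hj0) hc.symm
    have hinf : (J \ I).inf (fun j => v (insert j I) + v (J.erase j)) =
        ((c + c : Γ) : WithTop Γ) + ((∑ i ∈ I, u i + ∑ i ∈ J, u i : Γ) : WithTop Γ) := by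
      apply le_antisymm
      · refine (Finset.inf_le hj0).trans_eq ?_
        rw [pair_sum v u I J j0 hj0, ← hc, hc2]; rfl
      · refine Finset.le_inf fun j hj => ?_
        rw [pair_sum v u I J j hj, WithTop.coe_add c c]
        gcongr
        · exact hmin _ (hcI j hj)
        · exact hmin _ (hcJ j hj)
    rw [hinf] at h
    have h' := h.resolve_left (by rw [← WithTop.coe_add]; exact WithTop.coe_ne_top)
    rw [← h', Finset.sum_filter]
    refine Finset.sum_congr rfl fun j hj => ?_
    have key : v (insert j I) + v (J.erase j) =
        ((c + c : Γ) : WithTop Γ) + ((∑ i ∈ I, u i + ∑ i ∈ J, u i : Γ) : WithTop Γ) ↔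
        wsub (v (insert j I)) (∑ i ∈ insert j I, u i) = c ∧
        wsub (v (J.erase j)) (∑ i ∈ J.erase j, u i) = c := by
      rw [pair_sum v u I J j hj, WithTop.add_right_inj WithTop.coe_ne_top]
      exact sum_eq_iff c _ _ (hmin _ (hcI j hj)) (hmin _ (hcJ j hj))
    rw [hch _ (hcI j hj), hch _ (hcJ j hj)]
    simp only [key]
    by_cases e1 : wsub (v (insert j I)) (∑ i ∈ insert j I, u i) = c <;>
    by_cases e2 : wsub (v (J.erase j)) (∑ i ∈ J.erase j, u i) = c <;> simp [e1, e2]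
  · push Not at hex
    refine Finset.sum_eq_zero fun j hj => ?_
    by_cases e : initialCoeff a v r u (insert j I) = 0
    · rw [e]; ring
    · rw [hex j hj e]; ring

lemma backward {r : ℕ} (a : Finset E → K) (v : Finset E → WithTop Γ)
    (hav : ∀ B : Finset E, B.card = r → (a B = 0 ↔ v B = ⊤))
    (hGP : ∀ u : E → Γ, IsGP r (initialCoeff a v r u)) (I J : Finset E)
    (hI : I.card + 1 = r) (hJ : J.card = r + 1) (c : Γ)
    (hc : (J \ I).inf (fun j => v (insert j I) + v (J.erase j)) = c) :
    ∑ j ∈ (J \ I).filter (fun j => v (insert j I) + v (J.erase j) = c),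
            fsign j I J * a (insert j I) * a (J.erase j) = 0 := by
  have hcI : ∀ j, j ∉ I → (insert j I).card = r := fun j hj => by
    rw [Finset.card_insert_of_notMem hj, hI]
  have hcJ : ∀ j ∈ J, (J.erase j).card = r := fun j hj => by
    rw [Finset.card_erase_of_mem hj, hJ]; rfl
  have hne : (J \ I).Nonempty := by
    rw [Finset.sdiff_nonempty]
    intro hs
    have := Finset.card_le_card hs
    omega
  obtain ⟨j1, hj1, hcj1⟩ := Finset.exists_mem_eq_inf (J \ I) hne
    (fun j => v (insert j I) + v (J.erase j))
  rw [hc] at hcj1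
  have hle : ∀ j ∈ J \ I, (c : WithTop Γ) ≤ v (insert j I) + v (J.erase j) := fun j hj =>
    hc ▸ Finset.inf_le (f := fun j => v (insert j I) + v (J.erase j)) hj
  clear hc
  obtain ⟨w, hw⟩ : ∃ w : Finset E → Γ, ∀ B, v B ≠ ⊤ → v B = w B :=
    ⟨fun B => (v B).untopD 0, fun B hB => by
      obtain ⟨g, hg⟩ := WithTop.ne_top_iff_exists.1 hB
      simp [← hg]⟩
  obtain ⟨N1, -, hN1⟩ := exists_big (fun B : Finset E => c - w B)
  set u' : E → Γ := fun j => if v (insert j I) = ⊤ then N1 else w (insert j I) with hu'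
  obtain ⟨N2, -, hN2⟩ := exists_big (fun B : Finset E => ∑ i ∈ B \ I, u' i - w B)
  obtain ⟨N, hN0, hN⟩ : ∃ N : Γ, 0 ≤ N ∧ ∀ B : Finset E,
      ∑ i ∈ B \ I, u' i - w B ≤ N ∧ c - w B ≤ N := by
    obtain ⟨N, h0, h⟩ := exists_big (fun B : Finset E => max (∑ i ∈ B \ I, u' i - w B) (c - w B))
    exact ⟨N, h0, fun B => max_le_iff.1 (h B)⟩
  set u : E → Γ := fun j => if j ∈ I then N else u' j with hu
  obtain ⟨T, hT0, hT⟩ := exists_big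
    (fun B : Finset E => c - ∑ i ∈ J, u i - (w B - ∑ i ∈ B, u i))
  set u0 : E → Γ := fun j => u j - if j ∈ J then 0 else T with hu0
  set C : E → K := fun j => if j ∈ J then epsS K j J * initialCoeff a v r u0 (J.erase j) else 0
    with hC
  have hP0 : Orth r C (initialCoeff a v r u0) := by
    intro I' hI'
    rw [← (hGP u0).covec_sum I' J hI' hJ]
    symm
    rw [← Finset.sum_subset (Finset.subset_univ J)]
    · refine Finset.sum_congr rfl fun j hj => ?_
      simp only [hC, if_pos hj]; ring
    · intro j _ hj
      simp only [hC, if_neg hj, zero_mul]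
  have hP := steps a v hav hGP C u0 T hT0 hP0 Jᶜ (fun x hx => by
    simp only [hC, if_neg (Finset.mem_compl.1 hx)])
  have huu : (fun i => u0 i + if i ∈ Jᶜ then T else 0) = u := by
    funext i
    by_cases hi : i ∈ J <;> simp [hu0, hi]
  rw [huu] at hP
  have hsum := hP I hI
  -- coefficients at `u`
  have hsumI : ∑ i ∈ I, u i = I.card • N := by
    rw [← Finset.sum_const]
    exact Finset.sum_congr rfl fun i hi => by simp [hu, hi]
  have hfI : ∀ j, j ∉ I → v (insert j I) ≠ ⊤ →
      wsub (v (insert j I)) (∑ i ∈ insert j I, u i) = ((-(I.card • N) : Γ) : WithTop Γ) := by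
    intro j hj hv
    rw [Finset.sum_insert hj, hsumI, hw _ hv, wsub_coe]
    have : u j = w (insert j I) := by simp [hu, hj, hu', hv]
    rw [this]; congr 1; abel
  have hminI : ∀ B : Finset E, B.card = r →
      ((-(I.card • N) : Γ) : WithTop Γ) ≤ wsub (v B) (∑ i ∈ B, u i) := by
    intro B hB
    by_cases hv : v B = ⊤
    · rw [hv, wsub_top]; exact le_top
    by_cases hIB : I ⊆ B
    · obtain ⟨k, hk⟩ : (B \ I).Nonempty := by
        rw [Finset.sdiff_nonempty]
        intro hs
        have := Finset.card_le_card hs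
        omega
      obtain ⟨hkB, hkI⟩ := Finset.mem_sdiff.1 hk
      have hBe : insert k I = B := by
        apply Finset.eq_of_subset_of_card_le
        · exact Finset.insert_subset hkB hIB
        · rw [hcI k hkI, hB]
      rw [← hBe] at hv ⊢
      exact (hfI k hkI hv).ge
    · rw [hw _ hv, wsub_coe]
      have hs : ∑ i ∈ B, u i = (B ∩ I).card • N + ∑ i ∈ B \ I, u' i := by
        rw [← Finset.sum_inter_add_sum_sdiff B I u, ← Finset.sum_const]
        congr 1
        · exact Finset.sum_congr rfl fun i hi => by simp [hu, (Finset.mem_inter.1 hi).2]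
        · exact Finset.sum_congr rfl fun i hi => by simp [hu, (Finset.mem_sdiff.1 hi).2]
      have hlt : (B ∩ I).card + 1 ≤ I.card := by
        apply Finset.card_lt_card
        refine ⟨Finset.inter_subset_right, fun h => hIB fun i hi => (Finset.mem_inter.1 (h hi)).1⟩
      have h1 : (B ∩ I).card • N + N ≤ I.card • N := by
        rw [← succ_nsmul]; exact nsmul_le_nsmul_left hN0 hlt
      have h2 := (hN B).1
      rw [hs]
      norm_cast
      have h3 : ∑ i ∈ B \ I, u' i ≤ N + w B := sub_le_iff_le_add.1 h2
      rw [neg_le_sub_iff_le_add]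
      calc (B ∩ I).card • N + ∑ i ∈ B \ I, u' i ≤ (B ∩ I).card • N + (N + w B) := by gcongr
        _ = ((B ∩ I).card • N + N) + w B := by abel
        _ ≤ I.card • N + w B := by gcongr
        _ = _ := by abel
  -- finiteness at `j1`
  have hj1v : v (insert j1 I) ≠ ⊤ ∧ v (J.erase j1) ≠ ⊤ := by
    constructor
    · intro h; rw [h] at hcj1; simp at hcj1
    · intro h; rw [h] at hcj1; simp at hcj1
  have hchI : ∀ j ∈ J \ I, initialCoeff a v r u (insert j I) = a (insert j I) := by
    intro j hj
    have hjI := (Finset.mem_sdiff.1 hj).2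
    rw [initialCoeff_of_min a v u _ hminI _ (hcI j1 (Finset.mem_sdiff.1 hj1).2)
      (hfI j1 (Finset.mem_sdiff.1 hj1).2 hj1v.1) _ (hcI j hjI)]
    by_cases hv : v (insert j I) = ⊤
    · rw [(hav _ (hcI j hjI)).2 hv, ite_self]
    · rw [if_pos (hfI j hjI hv)]
  -- coefficients at `u0`
  have hsumJ : ∀ j ∈ J, ∑ i ∈ J.erase j, u0 i = ∑ i ∈ J, u i - u j := by
    intro j hj
    rw [← Finset.add_sum_erase J u hj, add_sub_cancel_left]
    exact Finset.sum_congr rfl fun i hi => by simp [hu0, (Finset.mem_erase.1 hi).2]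
  have huj : ∀ j, j ∉ I → v (insert j I) ≠ ⊤ → u j = w (insert j I) := by
    intro j hj hv
    simp [hu, hj, hu', hv]
  have hfJ : ∀ j ∈ J \ I, v (insert j I) ≠ ⊤ →
      (wsub (v (J.erase j)) (∑ i ∈ J.erase j, u0 i) = ((c - ∑ i ∈ J, u i : Γ) : WithTop Γ) ↔
        v (insert j I) + v (J.erase j) = c) := by
    intro j hj hv
    obtain ⟨hjJ, hjI⟩ := Finset.mem_sdiff.1 hj
    rw [hsumJ j hjJ, huj j hjI hv]
    by_cases hv' : v (J.erase j) = ⊤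
    · rw [hv', wsub_top, add_top]
      exact ⟨fun h => absurd h.symm WithTop.coe_ne_top, fun h => absurd h.symm WithTop.coe_ne_top⟩
    · rw [hw _ hv, hw _ hv', wsub_coe, ← WithTop.coe_add, WithTop.coe_inj, WithTop.coe_inj]
      constructor
      · intro h
        have := congrArg (· + ∑ i ∈ J, u i) h
        simp only [sub_add_cancel] at this
        rw [← this]; abel
      · intro h; rw [← h]; abel
  have hminJ : ∀ B : Finset E, B.card = r →
      ((c - ∑ i ∈ J, u i : Γ) : WithTop Γ) ≤ wsub (v B) (∑ i ∈ B, u0 i) := by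
    intro B hB
    by_cases hv : v B = ⊤
    · rw [hv, wsub_top]; exact le_top
    by_cases hBJ : B ⊆ J
    · obtain ⟨k, hk⟩ : (J \ B).Nonempty := by
        rw [Finset.sdiff_nonempty]
        intro hs
        have := Finset.card_le_card hs
        omega
      obtain ⟨hkJ, hkB⟩ := Finset.mem_sdiff.1 hk
      have hBe : B = J.erase k := by
        apply Finset.eq_of_subset_of_card_le
        · intro i hi
          exact Finset.mem_erase.2 ⟨fun h => hkB (h ▸ hi), hBJ hi⟩
        · rw [hcJ k hkJ, hB]
      have hck : c ≤ w B + u k := by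
        by_cases hkI : k ∈ I
        · have := (hN B).2
          have hk' : u k = N := by simp [hu, hkI]
          rw [hk']
          exact sub_le_iff_le_add'.1 this
        · by_cases hvk : v (insert k I) = ⊤
          · have hk' : u k = N1 := by simp [hu, hkI, hu', hvk]
            rw [hk']
            exact sub_le_iff_le_add'.1 (hN1 B)
          · rw [huj k hkI hvk]
            have := hle k (Finset.mem_sdiff.2 ⟨hkJ, hkI⟩)
            rw [← hBe, hw _ hv, hw _ hvk, ← WithTop.coe_add, WithTop.coe_le_coe] at this
            rwa [add_comm]
      have hs : ∑ i ∈ B, u0 i = ∑ i ∈ J, u i - u k := by rw [hBe]; exact hsumJ k hkJ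
      rw [hs, hw _ hv, wsub_coe, WithTop.coe_le_coe]
      calc c - ∑ i ∈ J, u i ≤ (w B + u k) - ∑ i ∈ J, u i := by gcongr
        _ = _ := by abel
    · rw [hw _ hv, wsub_coe, WithTop.coe_le_coe]
      obtain ⟨k, hkB, hkJ⟩ := Finset.not_subset.1 hBJ
      have h1 : ∑ i ∈ B, u0 i = ∑ i ∈ B, u i - ∑ i ∈ B, (if i ∈ J then 0 else T) := by
        rw [← Finset.sum_sub_distrib]
      have h2 : T ≤ ∑ i ∈ B, (if i ∈ J then 0 else T) := by
        have := Finset.single_le_sum (f := fun i => if i ∈ J then (0:Γ) else T) (s := B)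
          (fun i _ => by split_ifs; exacts [le_rfl, hT0]) hkB
        simpa [hkJ] using this
      have h3 : c - ∑ i ∈ J, u i ≤ T + (w B - ∑ i ∈ B, u i) := sub_le_iff_le_add.1 (hT B)
      rw [h1]
      calc c - ∑ i ∈ J, u i ≤ T + (w B - ∑ i ∈ B, u i) := h3
        _ ≤ (∑ i ∈ B, (if i ∈ J then 0 else T)) + (w B - ∑ i ∈ B, u i) := by gcongr
        _ = _ := by abel
  have hchJ : ∀ j ∈ J \ I, v (insert j I) ≠ ⊤ → initialCoeff a v r u0 (J.erase j) =
      if v (insert j I) + v (J.erase j) = c then a (J.erase j) else 0 := by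
    intro j hj hv
    rw [initialCoeff_of_min a v u0 _ hminJ _ (hcJ j1 (Finset.mem_sdiff.1 hj1).1)
      ((hfJ j1 hj1 hj1v.1).2 hcj1.symm) _ (hcJ j (Finset.mem_sdiff.1 hj).1)]
    simp only [hfJ j hj hv]
  rw [← hsum, Finset.sum_filter, ← Finset.sum_subset (Finset.subset_univ (J \ I))]
  · refine Finset.sum_congr rfl fun j hj => ?_
    obtain ⟨hjJ, hjI⟩ := Finset.mem_sdiff.1 hj
    simp only [hC, if_pos hjJ, covec, if_neg hjI, hchI j hj]
    by_cases hv : v (insert j I) = ⊤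
    · rw [(hav _ (hcI j hjI)).2 hv]; simp
    · rw [hchJ j hj hv, fsign_eq]
      split_ifs
      · ring
      · ring
  · intro j _ hj
    by_cases hjJ : j ∈ J
    · have hjI : j ∈ I := by
        by_contra h
        exact hj (Finset.mem_sdiff.2 ⟨hjJ, h⟩)
      simp [covec, hjI]
    · simp [hC, hjJ]

end aux

/-- A pair `(a, v)` (with `a(B) = 0` iff `v(B) = ∞`, `a` not identically `0`)
represents a strong `K[Γ]`-matroid iff every initial function `a^u` satisfies the classical
Grassmann–Plücker relations over the field `K`. -/
theorem fieldTropicalExtension_matroid_iff_forall_initial_plucker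
    {K : Type*} [Field K] {E : Type*} [Fintype E] [LinearOrder E]
    {Γ : Type*} [AddCommGroup Γ] [LinearOrder Γ] [IsOrderedAddMonoid Γ]
    (r : ℕ) (hr1 : 1 ≤ r) (hr2 : r ≤ Fintype.card E)
    (a : Finset E → K) (v : Finset E → WithTop Γ)
    (hav : ∀ B : Finset E, B.card = r → (a B = 0 ↔ v B = ⊤))
    (ha : ∃ B : Finset E, B.card = r ∧ a B ≠ 0) :
    (∀ I J : Finset E, I.card + 1 = r → J.card = r + 1 →
        ((J \ I).inf (fun j => v (insert j I) + v (J.erase j)) = ⊤ ∨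
          ∑ j ∈ (J \ I).filter (fun j =>
              v (insert j I) + v (J.erase j) =
                (J \ I).inf (fun j' => v (insert j' I) + v (J.erase j'))),
            fsign j I J * a (insert j I) * a (J.erase j) = 0)) ↔
      ∀ u : E → Γ, ∀ I J : Finset E, I.card + 1 = r → J.card = r + 1 →
        ∑ j ∈ J \ I, fsign j I J * initialCoeff a v r u (insert j I) *
          initialCoeff a v r u (J.erase j) = 0 := by
  constructor
  · intro h u I J hI hJ
    exact forward a v u I J hI hJ (h I J hI hJ)
  · intro h I J hI hJ
    by_cases ht : (J \ I).inf (fun j => v (insert j I) + v (J.erase j)) = ⊤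
    · exact Or.inl ht
    · right
      obtain ⟨c, hc⟩ := WithTop.ne_top_iff_exists.1 ht
      rw [← hc]
      exact backward a v hav (fun u => h u) I J hI hJ c hc.symm
end

section
/- Let (σ, v) be a signed tropical Plücker function of rank r on a finite linearly ordered set E with values in a linearly ordered abelian group Γ. Then (σ, v) is an oriented valuated matroid (a strong 𝕊[Γ]-matroid) if and only if, for every u : E → Γ, the initial sign function σ^u is a chirotope of rank r on E. (This is Theorem A of the paper for F = 𝕊 the sign hyperfield: an oriented valuated matroid is exactly a signed tropical Plücker function all of whose initial matroids are oriented matroids.) -/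
open scoped Classical

/-- `sign(j; I, J) = (-1)^ℓ ∈ {+1, -1}`, where `ℓ` is the number of `j' ∈ J` with `j < j'` plus
the number of `i ∈ I` with `j < i`. -/
def ssign {E : Type*} [LinearOrder E] (j : E) (I J : Finset E) : SignType :=
  (-1 : SignType) ^ ((J.filter fun j' => j < j').card + (I.filter fun i => j < i).card)

/-- The pair `(σ, v)` is an oriented valuated matroid (a strong `𝕊[Γ]`-matroid) of rank `r`:
for every `(r-1)`-subset `I` and `(r+1)`-subset `J`, letting `m` be the minimum of
`v(I∪{j}) + v(J∖{j})` over `j ∈ J∖I`, either `m = ∞` or both `+1` and `-1` occur among the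
products `sign(j;I,J)·σ(I∪{j})·σ(J∖{j})` over the minimisers. -/
def OrientedValuatedMatroid {E : Type*} [Fintype E] [LinearOrder E]
    {Γ : Type*} [AddCommGroup Γ] [LinearOrder Γ] [IsOrderedAddMonoid Γ]
    (σ : Finset E → SignType) (v : Finset E → WithTop Γ) (r : ℕ) : Prop :=
  ∀ I J : Finset E, I.card + 1 = r → J.card = r + 1 →
    (∀ j ∈ J \ I, v (insert j I) + v (J.erase j) = ⊤) ∨
    ((∃ j ∈ J \ I,
        (∀ k ∈ J \ I, v (insert j I) + v (J.erase j) ≤ v (insert k I) + v (J.erase k)) ∧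
        ssign j I J * σ (insert j I) * σ (J.erase j) = 1) ∧
     (∃ j ∈ J \ I,
        (∀ k ∈ J \ I, v (insert j I) + v (J.erase j) ≤ v (insert k I) + v (J.erase k)) ∧
        ssign j I J * σ (insert j I) * σ (J.erase j) = -1))

/-- `χ` is a chirotope of rank `r` on `E`: it is not identically `0` on `r`-subsets, and for
every `(r-1)`-subset `I` and `(r+1)`-subset `J`, either all products
`sign(j;I,J)·χ(I∪{j})·χ(J∖{j})`, `j ∈ J∖I`, are `0`, or both `+1` and `-1` occur among them. -/
def IsChirotope {E : Type*} [Fintype E] [LinearOrder E]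
    (χ : Finset E → SignType) (r : ℕ) : Prop :=
  (∃ B : Finset E, B.card = r ∧ χ B ≠ 0) ∧
  ∀ I J : Finset E, I.card + 1 = r → J.card = r + 1 →
    (∀ j ∈ J \ I, ssign j I J * χ (insert j I) * χ (J.erase j) = 0) ∨
    ((∃ j ∈ J \ I, ssign j I J * χ (insert j I) * χ (J.erase j) = 1) ∧
     (∃ j ∈ J \ I, ssign j I J * χ (insert j I) * χ (J.erase j) = -1))

/-- The initial sign function `σ^u`: `σ^u(B) = σ(B)` if `v(B) ≠ ∞` and `v(B) - ∑_{i∈B} u_i` is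
minimal among all `r`-subsets, and `σ^u(B) = 0` otherwise. -/
noncomputable def initSign {E : Type*} [Fintype E] {Γ : Type*} [AddCommGroup Γ] [LinearOrder Γ] [IsOrderedAddMonoid Γ]
    (σ : Finset E → SignType) (v : Finset E → WithTop Γ) (r : ℕ) (u : E → Γ)
    (B : Finset E) : SignType :=
  if v B ≠ ⊤ ∧ ∀ B' : Finset E, B'.card = r →
      wsub (v B) (∑ i ∈ B, u i) ≤ wsub (v B') (∑ i ∈ B', u i)
  then σ B else 0

set_option linter.unusedSectionVars false

def BalB {E : Type*} {Γ : Type*} [LinearOrder Γ]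
    (A : Finset E) (f : E → SignType) (g : E → WithTop Γ) : Prop :=
  (∀ j ∈ A, g j = ⊤) ∨
    ((∃ j ∈ A, (∀ k ∈ A, g j ≤ g k) ∧ f j = 1) ∧ (∃ j ∈ A, (∀ k ∈ A, g j ≤ g k) ∧ f j = -1))

def Bal3 {Γ : Type*} [LinearOrder Γ]
    (f1 : SignType) (g1 : WithTop Γ) (f2 : SignType) (g2 : WithTop Γ)
    (f3 : SignType) (g3 : WithTop Γ) : Prop :=
  (g1 = ⊤ ∧ g2 = ⊤ ∧ g3 = ⊤) ∨
  (∀ s : SignType, s ≠ 0 → (f1 = s ∧ g1 ≤ g2 ∧ g1 ≤ g3) ∨ (f2 = s ∧ g2 ≤ g1 ∧ g2 ≤ g3) ∨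
    (f3 = s ∧ g3 ≤ g1 ∧ g3 ≤ g2))

theorem bal3_unique {Γ : Type*} [LinearOrder Γ] {f1 f2 f3 : SignType} {g1 g2 g3 : WithTop Γ}
    (h : Bal3 f1 g1 f2 g2 f3 g3) (h2 : g1 < g2) (h3 : g1 < g3) : False := by
  rcases h with ⟨h, -⟩ | h
  · simp [h] at h2
  · have a := h 1 (by decide)
    have b := h (-1) (by decide)
    have a' : f1 = 1 := by
      rcases a with a | a | a
      · exact a.1
      · exact absurd a.2.1 (not_le.2 h2)
      · exact absurd a.2.1 (not_le.2 h3)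
    have b' : f1 = -1 := by
      rcases b with a | a | a
      · exact a.1
      · exact absurd a.2.1 (not_le.2 h2)
      · exact absurd a.2.1 (not_le.2 h3)
    rw [a'] at b'
    exact absurd b' (by decide)

theorem bal3_two {Γ : Type*} [LinearOrder Γ] {f1 f2 f3 : SignType} {g1 g2 g3 : WithTop Γ}
    (h : Bal3 f1 g1 f2 g2 f3 g3) (h3 : g2 < g3) : g1 = g2 ∧ f1 = - f2 := by
  have h31 : g1 < g3 := by
    by_contra hc
    rcases h with ⟨_, h, -⟩ | h
    · simp [h] at h3
    · have a := h 1 (by decide)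
      have b := h (-1) (by decide)
      push Not at hc
      have hlt := lt_of_lt_of_le h3 hc
      have a' : f2 = 1 := by
        rcases a with a | a | a
        · exact absurd a.2.1 (not_le.2 hlt)
        · exact a.1
        · exact absurd a.2.2 (not_le.2 h3)
      have b' : f2 = -1 := by
        rcases b with a | a | a
        · exact absurd a.2.1 (not_le.2 hlt)
        · exact a.1
        · exact absurd a.2.2 (not_le.2 h3)
      rw [a'] at b'
      exact absurd b' (by decide)
  rcases h with ⟨_, h, -⟩ | h
  · simp [h] at h3
  · have a := h 1 (by decide)
    have b := h (-1) (by decide)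
    rcases a with a | a | a
    · rcases b with b | b | b
      · rw [a.1] at b; exact absurd b.1 (by decide)
      · exact ⟨le_antisymm a.2.1 b.2.1, by rw [a.1, b.1]; decide⟩
      · exact absurd b.2.1 (not_le.2 h31)
    · rcases b with b | b | b
      · exact ⟨le_antisymm b.2.1 a.2.1, by rw [a.1, b.1]⟩
      · rw [a.1] at b; exact absurd b.1 (by decide)
      · exact absurd b.2.1 (not_le.2 h31)
    · exact absurd a.2.1 (not_le.2 h31)

theorem sgn_cancel : ∀ s a b : SignType, s ≠ 0 → s * a = -(s * b) → a = - b := by decide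

theorem core_lemma {E : Type*} [LinearOrder E]
    {Γ : Type*} [AddCommGroup Γ] [LinearOrder Γ] [IsOrderedAddMonoid Γ]
    (A : Finset E) (c : E → SignType) (cv : E → WithTop Γ)
    (Q : E → E → SignType) (q : E → E → WithTop Γ)
    (hc : ∀ a ∈ A, c a = 0 → cv a = ⊤)
    (qs : ∀ a ∈ A, ∀ b ∈ A, a ≠ b → q a b = q b a)
    (Qs : ∀ a ∈ A, ∀ b ∈ A, a ≠ b → Q a b = - Q b a)
    (hQ : ∀ a ∈ A, ∀ b ∈ A, a ≠ b → Q a b = 0 → q a b = ⊤)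
    (h1 : ∀ k ∈ A, BalB (A.erase k) (Q k) (q k))
    (h2 : ∀ a ∈ A, ∀ b ∈ A, ∀ d ∈ A, a ≠ b → b ≠ d → a ≠ d →
      Bal3 (c a * Q b d) (cv a + q b d) (c b * Q d a) (cv b + q d a) (c d * Q a b) (cv d + q a b))
    (h3 : ∀ e ∈ A, cv e ≠ ⊤ → ∃ k ∈ A, k ≠ e ∧ q e k ≠ ⊤) :
    BalB A c cv := by
  by_contra hbal
  have hne : ∃ e ∈ A, cv e ≠ ⊤ := by
    by_contra h
    push Not at h
    exact hbal (Or.inl h)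
  obtain ⟨e', he', he'T⟩ := hne
  obtain ⟨e, he, hemin⟩ := Finset.exists_min_image A cv ⟨e', he'⟩
  have heT : cv e ≠ ⊤ := fun h => he'T (by have := hemin e' he'; rw [h] at this; exact top_le_iff.1 this)
  set cm := cv e with hcm
  -- common sign
  obtain ⟨s, hs0, hs⟩ : ∃ s : SignType, s ≠ 0 ∧ ∀ a ∈ A, cv a = cm → c a = s := by
    by_contra hno
    push Not at hno
    apply hbal
    right
    obtain ⟨x, hx, hxm, hx1⟩ := hno 1 (by decide)
    obtain ⟨y, hy, hym, hy1⟩ := hno (-1) (by decide)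
    have hx0 : c x ≠ 0 := fun h => heT (by rw [← hxm]; exact hc x hx h)
    have hy0 : c y ≠ 0 := fun h => heT (by rw [← hym]; exact hc y hy h)
    have t1 : ∀ z : SignType, z ≠ 0 → z ≠ 1 → z = -1 := by decide
    have t2 : ∀ z : SignType, z ≠ 0 → z ≠ -1 → z = 1 := by decide
    exact ⟨⟨y, hy, fun k hk => by rw [hym]; exact hemin k hk, t2 _ hy0 hy1⟩,
      ⟨x, hx, fun k hk => by rw [hxm]; exact hemin k hk, t1 _ hx0 hx1⟩⟩
  -- minimal q
  obtain ⟨a0, ha0, ha0m, x0, hx0, hx0a, hmin⟩ : ∃ a0 ∈ A, cv a0 = cm ∧ ∃ x0 ∈ A, x0 ≠ a0 ∧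
      ∀ a ∈ A, cv a = cm → ∀ x ∈ A, x ≠ a → q a0 x0 ≤ q a x := by
    obtain ⟨k, hk, hke, -⟩ := h3 e he heT
    obtain ⟨p, hp, hpm⟩ := Finset.exists_min_image
      ((A ×ˢ A).filter (fun p => cv p.1 = cm ∧ p.2 ≠ p.1)) (fun p => q p.1 p.2)
      ⟨(e, k), by simp [he, hk, hke, hcm]⟩
    simp only [Finset.mem_filter, Finset.mem_product] at hp
    refine ⟨p.1, hp.1.1, hp.2.1, p.2, hp.1.2, hp.2.2, fun a ha ham x hx hxa => ?_⟩
    exact hpm (a, x) (by simp [ha, hx, ham, hxa])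
  set μ := q a0 x0 with hμ
  have hμT : μ ≠ ⊤ := by
    obtain ⟨k, hk, hke, hkT⟩ := h3 e he heT
    exact ne_top_of_le_ne_top hkT (hmin e he rfl k hk hke)
  have hgt : ∀ x ∈ A, cv x ≠ cm → ∀ y : WithTop Γ, μ ≤ y → cm + μ < cv x + y := by
    intro x hx hxm y hy
    have : cm < cv x := lt_of_le_of_ne (hemin x hx) (Ne.symm hxm)
    calc cm + μ < cv x + μ := (WithTop.add_lt_add_iff_right hμT).2 this
      _ ≤ cv x + y := by gcongr
  -- Step X
  have stepX : ∀ x ∈ A, cv x ≠ cm → ∀ a ∈ A, cv a = cm → q a x = μ → False := by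
    intro x hx hxm a ha ham hq
    have hxa : x ≠ a := by rintro rfl; exact hxm ham
    have hqx : q x a = μ := by rw [qs x hx a ha hxa, hq]
    have key : ∀ j ∈ A.erase x, (∀ k ∈ A.erase x, q x j ≤ q x k) → Q x j = Q x a := by
      intro j hj hjm
      have hjA := Finset.mem_of_mem_erase hj
      have hjx := Finset.ne_of_mem_erase hj
      have hle : q x j ≤ μ := by
        rw [← hqx]; exact hjm a (Finset.mem_erase.2 ⟨hxa.symm, ha⟩)
      by_cases hjm : cv j = cm
      · by_cases hja : j = a
        · rw [hja]
        · have h := h2 j hjA a ha x hx hja hxa.symm hjx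
          rw [hjm, ham, hs j hjA hjm, hs a ha ham, hq] at h
          -- terms: s*Q a x, cm+μ ; s * Q x j, cm + q x j ; c x * Q j a
          have hqj : q x j = μ := le_antisymm hle (by
            rw [qs x hx j hjA hjx.symm]; exact hmin j hjA hjm x hx hjx.symm)
          rw [hqj] at h
          have := bal3_two h (hgt x hx hxm _ (hmin j hjA hjm a ha (Ne.symm hja)))
          have := sgn_cancel _ _ _ hs0 this.2
          rw [Qs x hx a ha hxa, this, neg_neg]
      · exfalso
        have haj : a ≠ j := by rintro rfl; exact hjm ham
        have h := h2 a ha x hx j hjA hxa.symm hjx.symm haj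
        rw [ham] at h
        refine bal3_unique h ?_ ?_
        · refine lt_of_le_of_lt (add_le_add le_rfl hle) (hgt x hx hxm _ ?_)
          rw [qs j hjA a ha haj.symm]; exact hmin a ha ham j hjA haj.symm
        · refine lt_of_le_of_lt (add_le_add le_rfl hle) (hgt j hjA hjm _ ?_)
          exact hmin a ha ham x hx hxa
    rcases h1 x hx with h | ⟨⟨j, hj, hjm, hj1⟩, ⟨k, hk, hkm, hk1⟩⟩
    · exact hμT (by rw [← hqx]; exact h a (Finset.mem_erase.2 ⟨hxa.symm, ha⟩))
    · have e1 := key j hj hjm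
      have e2 := key k hk hkm
      rw [hj1] at e1
      rw [hk1, ← e1] at e2
      exact absurd e2 (by decide)
  let lt : E → E → Prop := fun a b => a ∈ A ∧ cv a = cm ∧ b ∈ A ∧ cv b = cm ∧ a ≠ b ∧ q a b = μ ∧ Q a b = 1
  have lt_asymm : ∀ a b, lt a b → lt b a → False := by
    rintro a b ⟨ha, _, hb, _, hab, _, h⟩ ⟨_, _, _, _, _, _, h'⟩
    have := Qs a ha b hb hab
    rw [h, h'] at this
    exact absurd this (by decide)
  have lt_trans : ∀ a b d, lt a b → lt b d → lt a d := by
    intro a b d hab hbd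
    have had : a ≠ d := by rintro rfl; exact lt_asymm _ _ hab hbd
    obtain ⟨ha, ham, hb, hbm, nab, qab, Qab⟩ := hab
    obtain ⟨_, _, hd, hdm, nbd, qbd, Qbd⟩ := hbd
    have h := h2 a ha b hb d hd nab nbd had
    rw [ham, hbm, hdm, hs a ha ham, hs b hb hbm, hs d hd hdm, qab, qbd, Qab, Qbd] at h
    have hcμ : cm + μ ≠ ⊤ := by simp [heT, hμT]
    have hge : μ ≤ q d a := hmin d hd hdm a ha had
    rcases h with h | h
    · exact absurd h.1 hcμ
    · have := h (-s) (by clear * - hs0; revert s; decide)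
      have hss : s * 1 ≠ -s := by clear * - hs0; revert s; decide
      rcases this with h | h | h
      · exact absurd h.1 hss
      · have e1 : q d a ≤ μ := (WithTop.add_le_add_iff_left heT).1 h.2.1
        refine ⟨ha, ham, hd, hdm, had, ?_, ?_⟩
        · rw [qs a ha d hd had]; exact le_antisymm e1 hge
        · rw [Qs a ha d hd had]
          have := h.1
          revert this hs0
          generalize Q d a = z
          clear * -
          revert s z; decide
      · exact absurd h.1 hss
  have hx0m : cv x0 = cm := by
    by_contra h
    exact stepX x0 hx0 h a0 ha0 ha0m rfl
  have hP : ∃ a b, lt a b := by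
    have h0 : Q a0 x0 ≠ 0 := fun h => hμT (hQ a0 ha0 x0 hx0 hx0a.symm h)
    by_cases hh : Q a0 x0 = 1
    · exact ⟨a0, x0, ha0, ha0m, hx0, hx0m, hx0a.symm, rfl, hh⟩
    · refine ⟨x0, a0, hx0, hx0m, ha0, ha0m, hx0a, ?_, ?_⟩
      · rw [qs x0 hx0 a0 ha0 hx0a]
      · rw [Qs x0 hx0 a0 ha0 hx0a]
        revert h0 hh
        generalize Q a0 x0 = z
        revert z; decide
  let : DecidablePred (fun a => ∃ b, lt a b) := Classical.decPred _
  let : ∀ a, DecidablePred (fun z => lt z a) := fun a => Classical.decPred _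
  obtain ⟨a, ha, hamin⟩ := Finset.exists_min_image (A.filter (fun a => ∃ b, lt a b))
    (fun a => (A.filter (fun z => lt z a)).card)
    (by obtain ⟨a, b, h⟩ := hP
        exact ⟨a, Finset.mem_filter.2 ⟨h.1, b, h⟩⟩)
  obtain ⟨haA, b, hab⟩ := Finset.mem_filter.1 ha
  have nolt : ∀ z, ¬ lt z a := by
    intro z hz
    have := hamin z (Finset.mem_filter.2 ⟨hz.1, a, hz⟩)
    refine absurd this (not_le.2 (Finset.card_lt_card ?_))
    rw [Finset.ssubset_iff_of_subset]
    · refine ⟨z, Finset.mem_filter.2 ⟨hz.1, hz⟩, fun h => ?_⟩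
      exact lt_asymm _ _ (Finset.mem_filter.1 h).2 (Finset.mem_filter.1 h).2
    · intro y hy
      obtain ⟨hy1, hy2⟩ := Finset.mem_filter.1 hy
      exact Finset.mem_filter.2 ⟨hy1, lt_trans _ _ _ hy2 hz⟩
  obtain ⟨-, ham, hb, hbm, nab, qab, Qab⟩ := hab
  have hbe : b ∈ A.erase a := Finset.mem_erase.2 ⟨nab.symm, hb⟩
  rcases h1 a haA with h | ⟨-, ⟨k, hk, hkm, hk1⟩⟩
  · exact hμT (by rw [← qab]; exact h b hbe)
  · have hkA := Finset.mem_of_mem_erase hk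
    have hka := Finset.ne_of_mem_erase hk
    have hqk : q a k = μ := le_antisymm (by rw [← qab]; exact hkm b hbe) (hmin a haA ham k hkA hka)
    have hkm' : cv k = cm := by
      by_contra h
      exact stepX k hkA h a haA ham hqk
    refine nolt k ⟨hkA, hkm', haA, ham, hka, ?_, ?_⟩
    · rw [qs k hkA a haA hka, hqk]
    · rw [Qs k hkA a haA hka, hk1]; decide

section
variable {E : Type*} [Fintype E] [LinearOrder E]
  {Γ : Type*} [AddCommGroup Γ] [LinearOrder Γ] [IsOrderedAddMonoid Γ]

/-- finite shifted value -/
def wv (v : Finset E → WithTop Γ) (u : E → Γ) (B : Finset E) : Γ :=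
  (v B).untopD 0 - ∑ i ∈ B, u i

def OptU (v : Finset E → WithTop Γ) (r : ℕ) (u : E → Γ) (B : Finset E) : Prop :=
  v B ≠ ⊤ ∧ ∀ B' : Finset E, B'.card = r → v B' ≠ ⊤ → wv v u B ≤ wv v u B'

def OptC (v : Finset E → WithTop Γ) (r : ℕ) (u : E → Γ) (i : E) (B : Finset E) : Prop :=
  v B ≠ ⊤ ∧ ∀ B' : Finset E, B'.card = r → v B' ≠ ⊤ → (i ∈ B' ↔ i ∈ B) → wv v u B ≤ wv v u B'

def OptL (v : Finset E → WithTop Γ) (r : ℕ) (ω : E → ℤ) (u : E → Γ) (i : E) (B : Finset E) : Prop :=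
  v B ≠ ⊤ ∧ ∀ B' : Finset E, B'.card = r → v B' ≠ ⊤ → (i ∈ B' ↔ i ∈ B) →
    (∑ x ∈ B', ω x ≤ ∑ x ∈ B, ω x) ∧ (∑ x ∈ B', ω x = ∑ x ∈ B, ω x → wv v u B ≤ wv v u B')

theorem wsub_le_iff (v : Finset E → WithTop Γ) (u : E → Γ) (B B' : Finset E) (h : v B ≠ ⊤) :
    wsub (v B) (∑ i ∈ B, u i) ≤ wsub (v B') (∑ i ∈ B', u i) ↔
      (v B' ≠ ⊤ → wv v u B ≤ wv v u B') := by
  unfold wsub wv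
  lift v B to Γ using h with b
  cases v B' with
  | top => simp
  | coe b' =>
    rw [WithTop.map_coe, WithTop.map_coe, WithTop.coe_le_coe]
    simp only [WithTop.untopD_coe, ne_eq, WithTop.coe_ne_top, not_false_eq_true, true_imp_iff]

theorem initSign_eq (σ : Finset E → SignType) (v : Finset E → WithTop Γ) (r : ℕ) (u : E → Γ)
    (B : Finset E) : (OptU v r u B → initSign σ v r u B = σ B) ∧
      (¬ OptU v r u B → initSign σ v r u B = 0) := by
  have key : (v B ≠ ⊤ ∧ ∀ B' : Finset E, B'.card = r →
      wsub (v B) (∑ i ∈ B, u i) ≤ wsub (v B') (∑ i ∈ B', u i)) ↔ OptU v r u B := by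
    unfold OptU
    constructor
    · rintro ⟨h, h'⟩
      exact ⟨h, fun B' hB' => (wsub_le_iff v u B B' h).1 (h' B' hB')⟩
    · rintro ⟨h, h'⟩
      exact ⟨h, fun B' hB' => (wsub_le_iff v u B B' h).2 (h' B' hB')⟩
  unfold initSign
  constructor
  · intro h; rw [if_pos (key.2 h)]
  · intro h; rw [if_neg (fun h' => h (key.1 h'))]

theorem ssign_ne (j : E) (I J : Finset E) : ssign j I J ≠ 0 := by
  unfold ssign
  rcases neg_one_pow_eq_or SignType ((J.filter fun j' => j < j').card + (I.filter fun i => j < i).card) with h | h <;>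
  rw [h] <;> decide

theorem card_facts {r : ℕ} {I J : Finset E} (hI : I.card + 1 = r) (hJ : J.card = r + 1) {j : E}
    (hj : j ∈ J \ I) : (insert j I).card = r ∧ (J.erase j).card = r := by
  rw [Finset.mem_sdiff] at hj
  rw [Finset.card_insert_of_notMem hj.2, Finset.card_erase_of_mem hj.1]
  omega

theorem mul3_ne : ∀ a b c : SignType, a ≠ 0 → b ≠ 0 → c ≠ 0 → a * b * c ≠ 0 := by decide

theorem hh_optU {r : ℕ} {σ : Finset E → SignType} {v : Finset E → WithTop Γ}
    (hσv : ∀ B : Finset E, B.card = r → (σ B = 0 ↔ v B = ⊤))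
    {u : E → Γ} (H : IsChirotope (initSign σ v r u) r)
    {I J : Finset E} (hI : I.card + 1 = r) (hJ : J.card = r + 1) {j : E} (hj : j ∈ J \ I)
    (h1 : OptU v r u (insert j I)) (h2 : OptU v r u (J.erase j)) (s : SignType) (hs : s ≠ 0) :
    ∃ k ∈ J \ I, OptU v r u (insert k I) ∧ OptU v r u (J.erase k) ∧
      ssign k I J * σ (insert k I) * σ (J.erase k) = s := by
  have hcf := card_facts hI hJ hj
  have conv : ∀ k ∈ J \ I, ssign k I J * initSign σ v r u (insert k I) * initSign σ v r u (J.erase k) = s →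
      ∃ k ∈ J \ I, OptU v r u (insert k I) ∧ OptU v r u (J.erase k) ∧
      ssign k I J * σ (insert k I) * σ (J.erase k) = s := by
    intro k hk h
    have a1 : OptU v r u (insert k I) := by
      by_contra hc
      rw [(initSign_eq σ v r u _).2 hc] at h
      simp at h
      exact hs h.symm
    have a2 : OptU v r u (J.erase k) := by
      by_contra hc
      rw [(initSign_eq σ v r u (J.erase k)).2 hc] at h
      simp at h
      exact hs h.symm
    rw [(initSign_eq σ v r u _).1 a1, (initSign_eq σ v r u _).1 a2] at h
    exact ⟨k, hk, a1, a2, h⟩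
  rcases H.2 I J hI hJ with h | ⟨⟨k, hk, hk1⟩, ⟨l, hl, hl1⟩⟩
  · exfalso
    have := h j hj
    rw [(initSign_eq σ v r u _).1 h1, (initSign_eq σ v r u _).1 h2] at this
    refine mul3_ne _ _ _ (ssign_ne j I J) ?_ ?_ this
    · rw [Ne, hσv _ hcf.1]; exact h1.1
    · rw [Ne, hσv _ hcf.2]; exact h2.1
  · have : s = 1 ∨ s = -1 := by clear * - hs; revert s; decide
    rcases this with rfl | rfl
    · exact conv k hk hk1
    · exact conv l hl hl1

theorem optC_bal {r : ℕ} {v : Finset E → WithTop Γ} {u : E → Γ} {i : E} {X Y : Finset E}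
    (hXc : X.card = r) (hYc : Y.card = r)
    (hX : OptC v r u i X) (hY : OptC v r u i Y) (hiX : i ∈ X) (hiY : i ∉ Y) :
    ∃ u' : E → Γ, ∀ B : Finset E, B.card = r → (OptU v r u' B ↔ OptC v r u i B) := by
  refine ⟨fun x => u x + if x = i then wv v u X - wv v u Y else 0, fun B hB => ?_⟩
  have hw : ∀ B : Finset E, wv v (fun x => u x + if x = i then wv v u X - wv v u Y else 0) B =
      wv v u B - if i ∈ B then wv v u X - wv v u Y else 0 := by
    intro B
    generalize wv v u X - wv v u Y = δ
    unfold wv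
    rw [Finset.sum_add_distrib, Finset.sum_ite_eq', sub_sub]
  unfold OptU
  simp only [hw]
  constructor
  · rintro ⟨h, h'⟩
    refine ⟨h, fun B' hc ht hi => ?_⟩
    have := h' B' hc ht
    rw [if_congr hi rfl rfl] at this
    exact (sub_le_sub_iff_right _).1 this
  · rintro ⟨h, h'⟩
    refine ⟨h, fun B' hc ht => ?_⟩
    by_cases hiB : i ∈ B
    · have e1 := h' X hXc hX.1 (by simp [hiX, hiB])
      by_cases hiB' : i ∈ B'
      · have e2 := h' B' hc ht (by simp [hiB, hiB'])
        simpa [hiB, hiB'] using e2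
      · have e2 := hY.2 B' hc ht (by simp [hiY, hiB'])
        simp only [hiB, hiB', if_true, if_false, sub_zero]
        calc _ ≤ wv v u X - (wv v u X - wv v u Y) := by gcongr
          _ ≤ _ := by simpa using e2
    · have e1 := h' Y hYc hY.1 (by simp [hiY, hiB])
      by_cases hiB' : i ∈ B'
      · have e2 := hX.2 B' hc ht (by simp [hiX, hiB'])
        simp only [hiB, hiB', if_true, if_false, sub_zero]
        calc _ ≤ wv v u X - (wv v u X - wv v u Y) := by simpa using e1
          _ ≤ _ := by gcongr
      · have e2 := h' B' hc ht (by simp [hiB, hiB'])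
        simpa [hiB, hiB'] using e2

theorem optL_iff [Nontrivial Γ] (r : ℕ) (v : Finset E → WithTop Γ) (ω : E → ℤ) (u : E → Γ) (i : E) :
    ∃ u' : E → Γ, ∀ B : Finset E, (OptC v r u' i B ↔ OptL v r ω u i B) := by
  obtain ⟨p, -, hp⟩ := Finset.exists_max_image (Finset.univ : Finset (Finset E × Finset E))
    (fun p => wv v u p.1 - wv v u p.2) ⟨(∅, ∅), Finset.mem_univ _⟩
  obtain ⟨K, hK⟩ := exists_gt (wv v u p.1 - wv v u p.2)
  have hK' : ∀ B B' : Finset E, wv v u B - wv v u B' < K :=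
    fun B B' => lt_of_le_of_lt (hp (B, B') (Finset.mem_univ _)) hK
  have hK0 : 0 < K := by simpa using hK' ∅ ∅
  refine ⟨fun x => u x + ω x • K, fun B => ?_⟩
  have hw : ∀ B : Finset E, wv v (fun x => u x + ω x • K) B = wv v u B - (∑ x ∈ B, ω x) • K := by
    intro B
    unfold wv
    rw [Finset.sum_add_distrib, Finset.sum_smul, sub_sub]
  have key : ∀ B B' : Finset E, wv v (fun x => u x + ω x • K) B ≤ wv v (fun x => u x + ω x • K) B' ↔
      (∑ x ∈ B', ω x ≤ ∑ x ∈ B, ω x) ∧ (∑ x ∈ B', ω x = ∑ x ∈ B, ω x → wv v u B ≤ wv v u B') := by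
    intro B B'
    rw [hw, hw]
    have aux : ∀ B B' : Finset E, ∑ x ∈ B, ω x < ∑ x ∈ B', ω x →
        wv v u B' - (∑ x ∈ B', ω x) • K < wv v u B - (∑ x ∈ B, ω x) • K := by
      intro B B' h
      have h1 : (1:ℤ) • K ≤ (∑ x ∈ B', ω x - ∑ x ∈ B, ω x) • K :=
        zsmul_le_zsmul_left hK0.le (by omega)
      rw [one_zsmul, sub_zsmul, ← sub_eq_add_neg] at h1
      have h2 := hK' B' B
      have h3 := lt_of_lt_of_le h2 h1
      rw [sub_lt_sub_iff] at h3 ⊢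
      rw [add_comm (wv v u B)]
      exact h3
    rcases lt_trichotomy (∑ x ∈ B, ω x) (∑ x ∈ B', ω x) with h | h | h
    · have := aux B B' h
      constructor
      · intro h'; exact absurd h' (not_le.2 this)
      · intro h'; omega
    · rw [h]; simp
    · have := aux B' B h
      constructor
      · intro _; exact ⟨h.le, fun h' => by omega⟩
      · intro _; exact this.le
  unfold OptC OptL
  simp only [key]

theorem exists_optL [Nontrivial Γ] (r : ℕ) (v : Finset E → WithTop Γ) (ω : E → ℤ) (u : E → Γ) (i : E)
    {B : Finset E} (hB : B.card = r) (hv : v B ≠ ⊤) :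
    ∃ B' : Finset E, B'.card = r ∧ (i ∈ B' ↔ i ∈ B) ∧ OptL v r ω u i B' := by
  obtain ⟨u', hu'⟩ := optL_iff r v ω u i
  obtain ⟨B', hB', hm⟩ := Finset.exists_min_image
    (Finset.univ.filter (fun X : Finset E => X.card = r ∧ v X ≠ ⊤ ∧ (i ∈ X ↔ i ∈ B))) (wv v u')
    ⟨B, by simp [hB, hv]⟩
  simp only [Finset.mem_filter, Finset.mem_univ, true_and] at hB' hm
  refine ⟨B', hB'.1, hB'.2.2, (hu' B').1 ⟨hB'.2.1, fun X hX hXv hi => hm X ⟨hX, hXv, hi.trans hB'.2.2⟩⟩⟩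

theorem hh_optL [Nontrivial Γ] {r : ℕ} {σ : Finset E → SignType} {v : Finset E → WithTop Γ}
    (hσv : ∀ B : Finset E, B.card = r → (σ B = 0 ↔ v B = ⊤))
    (H : ∀ u : E → Γ, IsChirotope (initSign σ v r u) r) (ω : E → ℤ) (u : E → Γ) (i : E)
    {I J : Finset E} (hI : I.card + 1 = r) (hJ : J.card = r + 1) {j : E} (hj : j ∈ J \ I)
    (hi : (i ∈ insert j I ∧ i ∉ J.erase j) ∨ (i ∉ insert j I ∧ i ∈ J.erase j))
    (h1 : OptL v r ω u i (insert j I)) (h2 : OptL v r ω u i (J.erase j)) (s : SignType) (hs : s ≠ 0) :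
    ∃ k ∈ J \ I, OptL v r ω u i (insert k I) ∧ OptL v r ω u i (J.erase k) ∧
      ssign k I J * σ (insert k I) * σ (J.erase k) = s := by
  have hcf := card_facts hI hJ hj
  obtain ⟨u', hu'⟩ := optL_iff r v ω u i
  have h1' := (hu' _).2 h1
  have h2' := (hu' _).2 h2
  obtain ⟨u'', hu''⟩ : ∃ u'' : E → Γ, ∀ B : Finset E, B.card = r → (OptU v r u'' B ↔ OptC v r u' i B) := by
    rcases hi with hi | hi
    · exact optC_bal hcf.1 hcf.2 h1' h2' hi.1 hi.2
    · exact optC_bal hcf.2 hcf.1 h2' h1' hi.2 hi.1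
  obtain ⟨k, hk, a, b, c⟩ := hh_optU hσv (H u'') hI hJ hj ((hu'' _ hcf.1).2 h1') ((hu'' _ hcf.2).2 h2') s hs
  have hck := card_facts hI hJ hk
  exact ⟨k, hk, (hu' _).1 ((hu'' _ hck.1).1 a), (hu' _).1 ((hu'' _ hck.2).1 b), c⟩

end

section
variable {E : Type*} [Fintype E] [LinearOrder E]
  {Γ : Type*} [AddCommGroup Γ] [LinearOrder Γ] [IsOrderedAddMonoid Γ]

theorem sum_ind (B P : Finset E) : ∑ x ∈ B, (if x ∈ P then (1:ℤ) else 0) = ((B ∩ P).card : ℤ) := by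
  rw [Finset.sum_boole, Finset.filter_mem_eq_inter]

theorem supp_exchange [Nontrivial Γ] {r : ℕ} {σ : Finset E → SignType} {v : Finset E → WithTop Γ}
    (hσv : ∀ B : Finset E, B.card = r → (σ B = 0 ↔ v B = ⊤))
    (H : ∀ u : E → Γ, IsChirotope (initSign σ v r u) r)
    {B1 B2 : Finset E} (hc1 : B1.card = r) (hc2 : B2.card = r) (hv1 : v B1 ≠ ⊤) (hv2 : v B2 ≠ ⊤)
    {i : E} (hi2 : i ∈ B2) (hi1 : i ∉ B1) :
    ∃ k ∈ B1, k ∉ B2 ∧ v ((insert i B1).erase k) ≠ ⊤ := by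
  let ω : E → ℤ := fun x => ((r:ℤ) + 1) * (if x ∈ B1 ∩ B2 then (1:ℤ) else 0) +
    (if x ∈ B1 \ B2 then (1:ℤ) else 0)
  have hω : ∀ B : Finset E, ∑ x ∈ B, ω x =
      ((r:ℤ) + 1) * ((B ∩ (B1 ∩ B2)).card : ℤ) + ((B ∩ (B1 \ B2)).card : ℤ) := by
    intro B
    simp only [ω]
    rw [Finset.sum_add_distrib, ← Finset.mul_sum, sum_ind, sum_ind]
  have hsub : ∀ B : Finset E, B.card = r →
      ((r:ℤ) + 1) * ((B1 ∩ B2).card : ℤ) ≤ ∑ x ∈ B, ω x → B1 ∩ B2 ⊆ B := by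
    intro B hB h
    rw [hω] at h
    have h1 : (B ∩ (B1 \ B2)).card ≤ r := by
      rw [← hB]; exact Finset.card_le_card Finset.inter_subset_left
    have h2 : (B1 ∩ B2).card ≤ (B ∩ (B1 ∩ B2)).card := by
      by_contra hc
      push Not at hc
      have : ((B ∩ (B1 ∩ B2)).card : ℤ) + 1 ≤ ((B1 ∩ B2).card : ℤ) := by exact_mod_cast hc
      have h1' : ((B ∩ (B1 \ B2)).card : ℤ) ≤ r := by exact_mod_cast h1
      nlinarith
    have := Finset.eq_of_subset_of_card_le Finset.inter_subset_right h2
    rw [← this]; exact Finset.inter_subset_left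
  obtain ⟨B', hB'c, hB'i, hB'⟩ := exists_optL r v ω (0 : E → Γ) i hc2 hv2
  have hiB' : i ∈ B' := hB'i.2 hi2
  have hsubB' : B1 ∩ B2 ⊆ B' := by
    apply hsub B' hB'c
    have := (hB'.2 B2 hc2 hv2 (by simp [hi2, hiB'])).1
    refine le_trans ?_ this
    rw [hω, Finset.inter_eq_right.2 (Finset.inter_subset_right : B1 ∩ B2 ⊆ B2)]
    simp
  have hB1 : OptL v r ω (0 : E → Γ) i B1 := by
    refine ⟨hv1, fun B hB hBv hiB => ?_⟩
    have e1 : ∑ x ∈ B1, ω x = ((r:ℤ) + 1) * ((B1 ∩ B2).card : ℤ) + ((B1 \ B2).card : ℤ) := by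
      rw [hω, Finset.inter_eq_right.2 (Finset.inter_subset_left : B1 ∩ B2 ⊆ B1),
        Finset.inter_eq_right.2 (Finset.sdiff_subset : B1 \ B2 ⊆ B1)]
    have h1 : ((B ∩ (B1 ∩ B2)).card : ℤ) ≤ ((B1 ∩ B2).card : ℤ) := by
      exact_mod_cast Finset.card_le_card Finset.inter_subset_right
    have h2 : ((B ∩ (B1 \ B2)).card : ℤ) ≤ ((B1 \ B2).card : ℤ) := by
      exact_mod_cast Finset.card_le_card Finset.inter_subset_right
    refine ⟨?_, fun heq => ?_⟩
    · rw [e1, hω]; nlinarith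
    · have : B1 = B := by
        apply Finset.eq_of_subset_of_card_le _ (by rw [hB, hc1])
        have h3 : ((B1 \ B2).card : ℤ) ≤ ((B ∩ (B1 \ B2)).card : ℤ) := by
          rw [e1, hω] at heq; nlinarith
        have h4 := Finset.eq_of_subset_of_card_le (Finset.inter_subset_right : B ∩ (B1 \ B2) ⊆ B1 \ B2)
          (by exact_mod_cast h3)
        have h5 : B1 \ B2 ⊆ B := by rw [← h4]; exact Finset.inter_subset_left
        have h6 : B1 ∩ B2 ⊆ B := hsub B hB (by rw [heq, e1]; simp)
        intro x hx
        by_cases hx2 : x ∈ B2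
        · exact h6 (Finset.mem_inter.2 ⟨hx, hx2⟩)
        · exact h5 (Finset.mem_sdiff.2 ⟨hx, hx2⟩)
      rw [this]
  have hJ : (insert i B1).card = r + 1 := by rw [Finset.card_insert_of_notMem hi1, hc1]
  have hI : (B'.erase i).card + 1 = r := by rw [Finset.card_erase_add_one hiB', hB'c]
  have hj : i ∈ (insert i B1) \ (B'.erase i) := by simp
  have key := hh_optL hσv H ω (0 : E → Γ) i hI hJ hj
    (by left; simp) (by rwa [Finset.insert_erase hiB']) (by rwa [Finset.erase_insert hi1])
  have fin : ∀ k ∈ (insert i B1) \ (B'.erase i), k ≠ i → OptL v r ω (0 : E → Γ) i ((insert i B1).erase k) →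
      ∃ k ∈ B1, k ∉ B2 ∧ v ((insert i B1).erase k) ≠ ⊤ := by
    intro k hk hki ho
    simp only [Finset.mem_sdiff, Finset.mem_insert, Finset.mem_erase, not_and] at hk
    have hk1 : k ∈ B1 := hk.1.resolve_left hki
    exact ⟨k, hk1, fun hk2 => hk.2 hki (hsubB' (Finset.mem_inter.2 ⟨hk1, hk2⟩)), ho.1⟩
  obtain ⟨k, hk, -, hko, hk1⟩ := key 1 (by decide)
  obtain ⟨l, hl, -, hlo, hl1⟩ := key (-1) (by decide)
  by_cases hki : k = i
  · by_cases hli : l = i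
    · rw [hki] at hk1; rw [hli, hk1] at hl1
      exact absurd hl1 (by decide)
    · exact fin l hl hli hlo
  · exact fin k hk hki hko

theorem three_term [Nontrivial Γ] {r : ℕ} {σ : Finset E → SignType} {v : Finset E → WithTop Γ}
    (hσv : ∀ B : Finset E, B.card = r → (σ B = 0 ↔ v B = ⊤))
    (H : ∀ u : E → Γ, IsChirotope (initSign σ v r u) r)
    {I J : Finset E} (hI : I.card + 1 = r) (hJ : J.card = r + 1) {i : E} (hIJ : I \ J = {i}) :
    BalB (J \ I) (fun j => ssign j I J * σ (insert j I) * σ (J.erase j))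
      (fun j => v (insert j I) + v (J.erase j)) := by
  by_cases hall : ∀ j ∈ J \ I, v (insert j I) + v (J.erase j) = ⊤
  · exact Or.inl hall
  push Not at hall
  obtain ⟨e', he', he'T⟩ := hall
  obtain ⟨e, he, hemin⟩ := Finset.exists_min_image (J \ I)
    (fun j => v (insert j I) + v (J.erase j)) ⟨e', he'⟩
  have heT : v (insert e I) + v (J.erase e) ≠ ⊤ := ne_top_of_le_ne_top he'T (hemin e' he')
  rw [WithTop.add_ne_top] at heT
  have hiI : i ∈ I ∧ i ∉ J := by
    rw [← Finset.mem_sdiff, hIJ]; simp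
  have hmemI : ∀ x, x ∈ I → x ∉ J → x = i := by
    intro x h1 h2
    have : x ∈ I \ J := Finset.mem_sdiff.2 ⟨h1, h2⟩
    rw [hIJ] at this; simpa using this
  let S := I ∩ J
  have hScard : S.card + 1 = I.card := by
    have := Finset.card_sdiff_add_card_inter I J
    rw [hIJ] at this; simp at this; simp only [S]; omega
  have hAcard : (J \ I).card = 3 := by
    have := Finset.card_sdiff_add_card_inter J I
    rw [Finset.inter_comm J I] at this
    change (J \ I).card + S.card = J.card at this
    omega
  let Z := (J \ I).filter (fun x => v (insert x I) = ⊤)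
  have hZsub : Z ⊆ J \ I := Finset.filter_subset _ _
  have hZcard : Z.card ≤ 3 := by rw [← hAcard]; exact Finset.card_le_card hZsub
  have heZ : e ∉ Z := by simp [Z, heT.1]
  let ω : E → ℤ := fun x => 4 * (if x ∈ S then (1:ℤ) else 0) + (-4) * (if x ∈ (I ∪ J)ᶜ then (1:ℤ) else 0)
    + (if x ∈ Z then (1:ℤ) else 0)
  have hω : ∀ B : Finset E, ∑ x ∈ B, ω x =
      4 * ((B ∩ S).card : ℤ) + (-4) * ((B ∩ (I ∪ J)ᶜ).card : ℤ) + ((B ∩ Z).card : ℤ) := by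
    intro B
    simp only [ω]
    rw [Finset.sum_add_distrib, Finset.sum_add_distrib, ← Finset.mul_sum, ← Finset.mul_sum, sum_ind,
      sum_ind, sum_ind]
  let u : E → Γ := fun x => if x ∈ J \ I then (v (insert x I)).untopD 0 else 0
  have hsub : ∀ B : Finset E, 4 * (S.card : ℤ) ≤ ∑ x ∈ B, ω x → S ⊆ B ∧ B ⊆ I ∪ J := by
    intro B h
    rw [hω] at h
    have h1 : (B ∩ Z).card ≤ Z.card := Finset.card_le_card Finset.inter_subset_right
    have h2 : (B ∩ S).card ≤ S.card := Finset.card_le_card Finset.inter_subset_right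
    have h3 : S.card ≤ (B ∩ S).card := by omega
    have h4 : (B ∩ (I ∪ J)ᶜ).card = 0 := by omega
    constructor
    · rw [← Finset.eq_of_subset_of_card_le Finset.inter_subset_right h3]
      exact Finset.inter_subset_left
    · intro x hx
      by_contra hc
      rw [Finset.card_eq_zero] at h4
      have : x ∈ B ∩ (I ∪ J)ᶜ := Finset.mem_inter.2 ⟨hx, Finset.mem_compl.2 hc⟩
      rw [h4] at this
      simp at this
  have shape1 : ∀ B : Finset E, B.card = r → i ∈ B → 4 * (S.card : ℤ) ≤ ∑ x ∈ B, ω x →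
      ∃ x ∈ J \ I, B = insert x I := by
    intro B hB hiB h
    obtain ⟨hs1, hs2⟩ := hsub B h
    have hIB : I ⊆ B := by
      intro x hx
      by_cases hxJ : x ∈ J
      · exact hs1 (Finset.mem_inter.2 ⟨hx, hxJ⟩)
      · rw [hmemI x hx hxJ]; exact hiB
    obtain ⟨x, hx⟩ : ∃ x, B \ I = {x} := by
      rw [← Finset.card_eq_one, Finset.card_sdiff_of_subset hIB]; omega
    have hxB : x ∈ B \ I := by rw [hx]; simp
    rw [Finset.mem_sdiff] at hxB
    refine ⟨x, Finset.mem_sdiff.2 ⟨(Finset.mem_union.1 (hs2 hxB.1)).resolve_left hxB.2, hxB.2⟩, ?_⟩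
    rw [← Finset.sdiff_union_of_subset hIB, hx]; rfl
  have shape2 : ∀ B : Finset E, B.card = r → i ∉ B → 4 * (S.card : ℤ) ≤ ∑ x ∈ B, ω x →
      ∃ x ∈ J \ I, B = J.erase x := by
    intro B hB hiB h
    obtain ⟨hs1, hs2⟩ := hsub B h
    have hBJ : B ⊆ J := by
      intro x hx
      by_contra hxJ
      have hxI := (Finset.mem_union.1 (hs2 hx)).resolve_right hxJ
      exact hiB (hmemI x hxI hxJ ▸ hx)
    obtain ⟨x, hx⟩ : ∃ x, J \ B = {x} := by
      rw [← Finset.card_eq_one, Finset.card_sdiff_of_subset hBJ]; omega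
    have hxB : x ∈ J \ B := by rw [hx]; simp
    rw [Finset.mem_sdiff] at hxB
    refine ⟨x, Finset.mem_sdiff.2 ⟨hxB.1, fun hxI => hxB.2 (hs1 (Finset.mem_inter.2 ⟨hxI, hxB.1⟩))⟩, ?_⟩
    rw [← Finset.sdiff_sdiff_eq_self hBJ, hx, Finset.sdiff_singleton_eq_erase]
  have ω1 : ∀ x ∈ J \ I, x ∉ Z → ∑ y ∈ insert x I, ω y = 4 * (S.card : ℤ) := by
    intro x hx hxZ
    rw [hω]
    have e1 : insert x I ∩ S = S := Finset.inter_eq_right.2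
      (Finset.inter_subset_left.trans (Finset.subset_insert _ _))
    have e2 : insert x I ∩ (I ∪ J)ᶜ = ∅ := by
      ext y; simp only [Finset.mem_inter, Finset.mem_insert, Finset.mem_compl, Finset.mem_union,
        Finset.mem_sdiff] at hx ⊢
      simp only [Finset.notMem_empty, iff_false]
      rintro ⟨rfl | h, h'⟩ <;> tauto
    have e3 : insert x I ∩ Z = ∅ := by
      ext y
      simp only [Finset.mem_inter, Finset.mem_insert, Finset.notMem_empty, iff_false]
      rintro ⟨rfl | h, h'⟩
      · exact hxZ h'
      · exact (Finset.mem_sdiff.1 (hZsub h')).2 h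
    rw [e1, e2, e3]; simp
  have ω2 : ∀ x ∈ J \ I, ∑ y ∈ J.erase x, ω y = 4 * (S.card : ℤ) + ((Z.erase x).card : ℤ) := by
    intro x hx
    rw [Finset.mem_sdiff] at hx
    rw [hω]
    have e1 : J.erase x ∩ S = S := by
      apply Finset.inter_eq_right.2
      intro y hy
      have hy := Finset.mem_inter.1 hy
      refine Finset.mem_erase.2 ⟨?_, hy.2⟩
      rintro rfl
      exact hx.2 hy.1
    have e2 : J.erase x ∩ (I ∪ J)ᶜ = ∅ := by
      ext y
      simp only [Finset.mem_inter, Finset.mem_erase, Finset.mem_compl, Finset.mem_union,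
        Finset.notMem_empty, iff_false]
      tauto
    have e3 : J.erase x ∩ Z = Z.erase x := by
      ext y
      simp only [Finset.mem_inter, Finset.mem_erase]
      constructor
      · rintro ⟨⟨h1, h2⟩, h3⟩; exact ⟨h1, h3⟩
      · rintro ⟨h1, h3⟩; exact ⟨⟨h1, (Finset.mem_sdiff.1 (hZsub h3)).1⟩, h3⟩
    rw [e1, e2, e3]; simp
  have w1 : ∀ x ∈ J \ I, wv v u (insert x I) = 0 := by
    intro x hx
    have hx' := Finset.mem_sdiff.1 hx
    unfold wv
    rw [Finset.sum_insert hx'.2, Finset.sum_eq_zero]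
    · simp [u, hx'.1, hx'.2]
    · intro y hy
      simp [u, hy]
  have w2 : ∀ x ∈ J \ I, wv v u (J.erase x) =
      ((v (insert x I)).untopD 0 + (v (J.erase x)).untopD 0) - ∑ y ∈ J, u y := by
    intro x hx
    have hx' := Finset.mem_sdiff.1 hx
    unfold wv
    rw [← Finset.sum_erase_add J u hx'.1]
    have : u x = (v (insert x I)).untopD 0 := by simp [u, hx'.1, hx'.2]
    rw [this]
    abel
  have hcmp : ∀ x ∈ J \ I, ∀ y ∈ J \ I, v (insert x I) ≠ ⊤ → v (J.erase x) ≠ ⊤ →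
      v (insert y I) ≠ ⊤ → v (J.erase y) ≠ ⊤ →
      (wv v u (J.erase x) ≤ wv v u (J.erase y) ↔
        v (insert x I) + v (J.erase x) ≤ v (insert y I) + v (J.erase y)) := by
    intro x hx y hy a b c d
    rw [w2 x hx, w2 y hy, sub_le_sub_iff_right]
    lift v (insert x I) to Γ using a with a'
    lift v (J.erase x) to Γ using b with b'
    lift v (insert y I) to Γ using c with c'
    lift v (J.erase y) to Γ using d with d'
    simp only [WithTop.untopD_coe]
    norm_cast
  have o1 : OptL v r ω u i (insert e I) := by
    refine ⟨heT.1, fun B hB hBv hiB => ?_⟩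
    have hiB' : i ∈ B := hiB.2 (Finset.mem_insert_of_mem hiI.1)
    rw [ω1 e he heZ]
    by_cases h4 : 4 * (S.card : ℤ) ≤ ∑ x ∈ B, ω x
    · obtain ⟨x, hx, rfl⟩ := shape1 B hB hiB' h4
      have hxZ : x ∉ Z := by simp [Z, hBv]
      rw [ω1 x hx hxZ, w1 e he, w1 x hx]
      simp
    · exact ⟨by omega, fun h => by omega⟩
  have hωe : ∑ y ∈ J.erase e, ω y = 4 * (S.card : ℤ) + (Z.card : ℤ) := by
    rw [ω2 e he, Finset.erase_eq_of_notMem heZ]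
  have o2 : OptL v r ω u i (J.erase e) := by
    refine ⟨heT.2, fun B hB hBv hiB => ?_⟩
    have hiB' : i ∉ B := fun h => hiI.2 (Finset.mem_of_mem_erase (hiB.1 h))
    rw [hωe]
    by_cases h4 : 4 * (S.card : ℤ) ≤ ∑ x ∈ B, ω x
    · obtain ⟨x, hx, rfl⟩ := shape2 B hB hiB' h4
      rw [ω2 x hx]
      have hle : (Z.erase x).card ≤ Z.card := Finset.card_le_card (Finset.erase_subset _ _)
      refine ⟨by omega, fun heq => ?_⟩
      have hxZ : x ∉ Z := by
        intro hxZ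
        have := Finset.card_erase_lt_of_mem hxZ
        omega
      have hxT : v (insert x I) ≠ ⊤ := fun h => hxZ (Finset.mem_filter.2 ⟨hx, h⟩)
      exact (hcmp e he x hx heT.1 heT.2 hxT hBv).2 (hemin x hx)
    · exact ⟨by omega, fun h => by omega⟩
  have key := hh_optL hσv H ω u i hI hJ he
    (by left; exact ⟨Finset.mem_insert_of_mem hiI.1, fun h => hiI.2 (Finset.mem_of_mem_erase h)⟩) o1 o2
  have fin : ∀ s : SignType, s ≠ 0 → ∃ j ∈ J \ I, (∀ k ∈ J \ I,
      v (insert j I) + v (J.erase j) ≤ v (insert k I) + v (J.erase k)) ∧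
      ssign j I J * σ (insert j I) * σ (J.erase j) = s := by
    intro s hs
    obtain ⟨k, hk, ho1, ho2, hks⟩ := key s hs
    refine ⟨k, hk, fun l hl => le_trans ?_ (hemin l hl), hks⟩
    have hkZ : k ∉ Z := by simp [Z, ho1.1]
    have := (ho2.2 (J.erase e) (card_facts hI hJ he).2 heT.2
      (by simp [hiI.2])).2 (by rw [hωe, ω2 k hk, Finset.erase_eq_of_notMem hkZ])
    exact (hcmp k hk e he ho1.1 ho2.1 heT.1 heT.2).1 this
  exact Or.inr ⟨fin 1 (by decide), fin (-1) (by decide)⟩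

end

section
variable {E : Type*} [Fintype E] [LinearOrder E]
  {Γ : Type*} [AddCommGroup Γ] [LinearOrder Γ] [IsOrderedAddMonoid Γ]

def sg (X : Finset E) (j : E) : SignType := (-1 : SignType) ^ (X.filter fun i => j < i).card

def tj (x j : E) : SignType := if j < x then -1 else 1

def dd (σ : Finset E → SignType) (I : Finset E) (k : E) : SignType := sg I k * σ (insert k I)

def cc (σ : Finset E → SignType) (J : Finset E) (k : E) : SignType := sg J k * σ (J.erase k)

def RR (σ : Finset E → SignType) (v : Finset E → WithTop Γ) (I J : Finset E) : Prop :=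
  BalB (J \ I) (fun k => dd σ I k * cc σ J k) (fun k => v (insert k I) + v (J.erase k))

theorem ssign_eq (j : E) (I J : Finset E) : ssign j I J = sg J j * sg I j := by
  unfold ssign sg; rw [pow_add]

theorem FF_eq (σ : Finset E → SignType) (j : E) (I J : Finset E) :
    ssign j I J * σ (insert j I) * σ (J.erase j) = dd σ I j * cc σ J j := by
  rw [ssign_eq]; unfold dd cc; ac_rfl

theorem sg_pm (X : Finset E) (j : E) : sg X j = 1 ∨ sg X j = -1 :=
  neg_one_pow_eq_or SignType _

theorem tj_pm (x j : E) : tj x j = 1 ∨ tj x j = -1 := by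
  unfold tj; split_ifs <;> simp

theorem tj_self (x : E) : tj x x = 1 := by simp [tj]

theorem tj_neg {x j : E} (h : x ≠ j) : tj x j = - tj j x := by
  unfold tj
  rcases lt_or_gt_of_ne h with h | h
  · rw [if_neg h.not_gt, if_pos h]; rfl
  · rw [if_pos h, if_neg h.not_gt]

theorem sg_insert {X : Finset E} {x : E} (h : x ∉ X) (j : E) :
    sg (insert x X) j = tj x j * sg X j := by
  unfold sg tj
  rw [Finset.filter_insert]
  split_ifs with hj
  · rw [Finset.card_insert_of_notMem (by simp [h]), pow_succ, mul_comm]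
  · simp

theorem sg_erase {X : Finset E} {x : E} (h : x ∈ X) (j : E) :
    sg (X.erase x) j = tj x j * sg X j := by
  have := sg_insert (Finset.notMem_erase x X) j
  rw [Finset.insert_erase h] at this
  rw [this]
  rcases tj_pm x j with h | h <;> rw [h] <;> simp

theorem sg_ne (X : Finset E) (j : E) : sg X j ≠ 0 := by
  rcases sg_pm X j with h | h <;> rw [h] <;> decide

theorem tj_ne (x j : E) : tj x j ≠ 0 := by
  rcases tj_pm x j with h | h <;> rw [h] <;> decide

theorem balB_scale {A : Finset E} {f f' : E → SignType} {g g' : E → WithTop Γ} (h : BalB A f g)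
    (s : SignType) (hs : s ≠ 0) (hf : ∀ j ∈ A, f' j = s * f j) (t t' : WithTop Γ) (ht : t ≠ ⊤)
    (ht' : t' ≠ ⊤) (hg : ∀ j ∈ A, g' j + t' = g j + t) : BalB A f' g' := by
  have hle : ∀ j ∈ A, ∀ k ∈ A, g j ≤ g k → g' j ≤ g' k := by
    intro j hj k hk h
    rw [← WithTop.add_le_add_iff_right ht', hg j hj, hg k hk, WithTop.add_le_add_iff_right ht]
    exact h
  rcases h with h | ⟨⟨a, ha, ha1, ha2⟩, ⟨b, hb, hb1, hb2⟩⟩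
  · left
    intro j hj
    have := hg j hj
    rw [h j hj, WithTop.top_add, WithTop.add_eq_top] at this
    exact this.resolve_right ht'
  · right
    have : s = 1 ∨ s = -1 := by clear * - hs; revert s; decide
    rcases this with rfl | rfl
    · exact ⟨⟨a, ha, fun k hk => hle a ha k hk (ha1 k hk), by rw [hf a ha, ha2]; rfl⟩,
        ⟨b, hb, fun k hk => hle b hb k hk (hb1 k hk), by rw [hf b hb, hb2]; rfl⟩⟩
    · exact ⟨⟨b, hb, fun k hk => hle b hb k hk (hb1 k hk), by rw [hf b hb, hb2]; rfl⟩,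
        ⟨a, ha, fun k hk => hle a ha k hk (ha1 k hk), by rw [hf a ha, ha2]; rfl⟩⟩

theorem balB_of_erase {A : Finset E} {f : E → SignType} {g : E → WithTop Γ} {z : E}
    (h : BalB (A.erase z) f g) (hz : g z = ⊤) : BalB A f g := by
  have aux : ∀ a, (∀ k ∈ A.erase z, g a ≤ g k) → ∀ k ∈ A, g a ≤ g k := by
    intro a ha k hk
    by_cases hkz : k = z
    · rw [hkz, hz]; exact le_top
    · exact ha k (Finset.mem_erase.2 ⟨hkz, hk⟩)
  rcases h with h | ⟨⟨a, ha, ha1, ha2⟩, ⟨b, hb, hb1, hb2⟩⟩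
  · left
    intro j hj
    by_cases hjz : j = z
    · rw [hjz, hz]
    · exact h j (Finset.mem_erase.2 ⟨hjz, hj⟩)
  · exact Or.inr ⟨⟨a, Finset.mem_of_mem_erase ha, aux a ha1, ha2⟩,
      ⟨b, Finset.mem_of_mem_erase hb, aux b hb1, hb2⟩⟩

theorem balB_two {A : Finset E} {f : E → SignType} {g : E → WithTop Γ} {x y : E}
    (h : BalB A f g) (hx : x ∈ A) (hy : y ∈ A) (hA : ∀ a ∈ A, a = x ∨ a = y ∨ g a = ⊤)
    (hf : ∀ a ∈ A, g a = ⊤ → f a = 0) : g x = g y ∧ f x = - f y := by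
  rcases h with h | ⟨⟨a, ha, ha1, ha2⟩, ⟨b, hb, hb1, hb2⟩⟩
  · rw [h x hx, h y hy, hf x hx (h x hx), hf y hy (h y hy)]; exact ⟨rfl, rfl⟩
  · have ha3 : a = x ∨ a = y := by
      rcases hA a ha with h | h | h
      · exact Or.inl h
      · exact Or.inr h
      · rw [hf a ha h] at ha2; exact absurd ha2 (by decide)
    have hb3 : b = x ∨ b = y := by
      rcases hA b hb with h | h | h
      · exact Or.inl h
      · exact Or.inr h
      · rw [hf b hb h] at hb2; exact absurd hb2 (by decide)
    rcases ha3 with rfl | rfl <;> rcases hb3 with rfl | rfl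
    · rw [ha2] at hb2; exact absurd hb2 (by decide)
    · exact ⟨le_antisymm (ha1 _ hb) (hb1 _ ha), by rw [ha2, hb2]; rfl⟩
    · exact ⟨le_antisymm (hb1 _ ha) (ha1 _ hb), by rw [ha2, hb2]⟩
    · rw [ha2] at hb2; exact absurd hb2 (by decide)

theorem bal3_of {A : Finset E} {f : E → SignType} {g : E → WithTop Γ} {a b d : E}
    (h : BalB A f g) (hA : ∀ x, x ∈ A ↔ x = a ∨ x = b ∨ x = d)
    (s : SignType) (hs : s ≠ 0) (t : WithTop Γ) (ht : t ≠ ⊤) {f1 f2 f3 : SignType}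
    {g1 g2 g3 : WithTop Γ} (e1 : f1 = s * f a) (e2 : f2 = s * f b) (e3 : f3 = s * f d)
    (k1 : g1 = g a + t) (k2 : g2 = g b + t) (k3 : g3 = g d + t) : Bal3 f1 g1 f2 g2 f3 g3 := by
  have h' : BalB A (fun x => s * f x) (fun x => g x + t) :=
    balB_scale h s hs (fun _ _ => rfl) t 0 ht (by simp) (fun j _ => by simp)
  have ha := (hA a).2 (by simp)
  have hb := (hA b).2 (by simp)
  have hd := (hA d).2 (by simp)
  subst e1 e2 e3 k1 k2 k3
  have key : ∀ x ∈ A, ∀ σ : SignType, (∀ k ∈ A, g x + t ≤ g k + t) → s * f x = σ →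
     (s * f a = σ ∧ g a + t ≤ g b + t ∧ g a + t ≤ g d + t) ∨ (s * f b = σ ∧ g b + t ≤ g a + t ∧ g b + t ≤ g d + t) ∨
    (s * f d = σ ∧ g d + t ≤ g a + t ∧ g d + t ≤ g b + t) := by
    intro x hx σ h1 h2
    rcases (hA x).1 hx with rfl | rfl | rfl
    · exact Or.inl ⟨h2, h1 _ hb, h1 _ hd⟩
    · exact Or.inr (Or.inl ⟨h2, h1 _ ha, h1 _ hd⟩)
    · exact Or.inr (Or.inr ⟨h2, h1 _ ha, h1 _ hb⟩)
  rcases h' with h | ⟨⟨x, hx, hx1, hx2⟩, ⟨y, hy, hy1, hy2⟩⟩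
  · exact Or.inl ⟨h a ha, h b hb, h d hd⟩
  · right
    intro σ hσ
    have : σ = 1 ∨ σ = -1 := by clear * - hσ; revert σ; decide
    rcases this with rfl | rfl
    · exact key x hx _ hx1 hx2
    · exact key y hy _ hy1 hy2

theorem RR_zero {r : ℕ} (σ : Finset E → SignType) (v : Finset E → WithTop Γ)
    (hσv : ∀ B : Finset E, B.card = r → (σ B = 0 ↔ v B = ⊤))
    {I J : Finset E} (hI : I.card + 1 = r) (hJ : J.card = r + 1) (hIJ : I ⊆ J) : RR σ v I J := by
  have hc : (J \ I).card = 2 := by rw [Finset.card_sdiff_of_subset hIJ]; omega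
  obtain ⟨a, b, hab, hA⟩ := Finset.card_eq_two.1 hc
  have ha : a ∈ J \ I := by rw [hA]; simp
  have hb : b ∈ J \ I := by rw [hA]; simp
  have ha' := Finset.mem_sdiff.1 ha
  have hb' := Finset.mem_sdiff.1 hb
  have hmem : ∀ x, x ∈ J ↔ x ∈ I ∨ x = a ∨ x = b := by
    intro x
    have : x ∈ J \ I ↔ x = a ∨ x = b := by rw [hA]; simp
    rw [Finset.mem_sdiff] at this
    constructor
    · intro h; by_cases hx : x ∈ I
      · exact Or.inl hx
      · exact Or.inr (this.1 ⟨h, hx⟩)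
    · rintro (h | h)
      · exact hIJ h
      · exact (this.2 h).1
  have e1 : J.erase b = insert a I := by
    ext x; rw [Finset.mem_erase, hmem, Finset.mem_insert]
    constructor
    · tauto
    · rintro (rfl | h)
      · exact ⟨hab, by simp⟩
      · exact ⟨fun h' => hb'.2 (h' ▸ h), Or.inl h⟩
  have e2 : J.erase a = insert b I := by
    ext x; rw [Finset.mem_erase, hmem, Finset.mem_insert]
    constructor
    · tauto
    · rintro (rfl | h)
      · exact ⟨hab.symm, by simp⟩
      · exact ⟨fun h' => ha'.2 (h' ▸ h), Or.inl h⟩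
  have e3 : J = insert a (insert b I) := by
    ext x; rw [hmem]; simp only [Finset.mem_insert]; tauto
  have g0 : v (insert a I) + v (J.erase a) = v (insert b I) + v (J.erase b) := by
    rw [e1, e2, add_comm]
  have s0 : dd σ I a * cc σ J a = - (dd σ I b * cc σ J b) := by
    unfold dd cc
    rw [e1, e2]
    have hn : a ∉ insert b I := by simp [hab, ha'.2]
    rw [e3, sg_insert hn, sg_insert hn, sg_insert hb'.2, sg_insert hb'.2, tj_self, tj_self, tj_neg hab]
    generalize tj b a = p
    rcases sg_pm I a with h | h <;> rcases sg_pm I b with h' | h' <;> rw [h, h'] <;>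
    simp only [mul_neg, neg_mul, neg_neg, one_mul, mul_one] <;> ac_rfl
  unfold RR BalB
  rw [hA]
  by_cases hT : v (insert a I) + v (J.erase a) = ⊤
  · left
    intro j hj
    simp only [Finset.mem_insert, Finset.mem_singleton] at hj
    rcases hj with rfl | rfl
    · exact hT
    · exact g0.symm.trans hT
  · right
    have hne : dd σ I a * cc σ J a ≠ 0 := by
      rw [← FF_eq]
      have hcf := card_facts hI hJ ha
      refine mul3_ne _ _ _ (ssign_ne _ _ _) ?_ ?_
      · rw [Ne, hσv _ hcf.1]; intro h; rw [h] at hT; simp at hT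
      · rw [Ne, hσv _ hcf.2]; intro h; rw [h] at hT; simp at hT
    simp only [Finset.mem_insert, Finset.mem_singleton, exists_eq_or_imp, exists_eq_left,
      forall_eq_or_imp, forall_eq, g0, le_refl, true_and, s0, and_true]
    rw [s0] at hne
    clear s0
    generalize dd σ I b * cc σ J b = p at *
    revert hne; revert p; decide
end

section
variable {E : Type*} [Fintype E] [LinearOrder E]
  {Γ : Type*} [AddCommGroup Γ] [LinearOrder Γ] [IsOrderedAddMonoid Γ]

theorem RR_one [Nontrivial Γ] {r : ℕ} {σ : Finset E → SignType} {v : Finset E → WithTop Γ}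
    (hσv : ∀ B : Finset E, B.card = r → (σ B = 0 ↔ v B = ⊤))
    (H : ∀ u : E → Γ, IsChirotope (initSign σ v r u) r)
    {I J : Finset E} (hI : I.card + 1 = r) (hJ : J.card = r + 1) {i : E} (hIJ : I \ J = {i}) :
    RR σ v I J := by
  have := three_term hσv H hI hJ hIJ
  simp only [FF_eq] at this
  exact this

theorem sgn_aux1 : ∀ p a a' b b' x y z w : SignType, p ≠ 0 → a ≠ 0 → a' ≠ 0 → b ≠ 0 → b' ≠ 0 →
    (a * x) * ((p * a') * y) = - ((b * z) * ((-p * b') * w)) →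
    (a * x) * (b' * y) = (b * z) * (a' * w) := by
  intro p a a' b b' x y z w hp ha ha' hb hb' h
  have pm : ∀ p : SignType, p ≠ 0 → p = 1 ∨ p = -1 := by decide
  have fin : ∀ x y z w : SignType, x * y = z * w → - (x * y) = -(z*w) := by
    intro x y z w h; rw [h]
  rcases pm p hp with rfl | rfl <;> rcases pm a ha with rfl | rfl <;> rcases pm a' ha' with rfl | rfl <;>
  rcases pm b hb with rfl | rfl <;> rcases pm b' hb' with rfl | rfl <;>
  simp only [mul_neg, neg_mul, neg_neg, one_mul, mul_one, neg_inj] at h ⊢ <;>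
  first | exact h | (rw [h, neg_neg]) | (rw [← h, neg_neg]) | (rw [h]) | (rw [← h])

theorem caseI_rel [Nontrivial Γ] {r : ℕ} {σ : Finset E → SignType} {v : Finset E → WithTop Γ}
    (hσv : ∀ B : Finset E, B.card = r → (σ B = 0 ↔ v B = ⊤))
    (H : ∀ u : E → Γ, IsChirotope (initSign σ v r u) r)
    {I : Finset E} (hI : I.card + 1 = r) {z e k i : E} (hz : z ∉ I) (he : e ∉ I) (hk : k ∉ I)
    (hi : i ∈ I) (hze : z ≠ e) (hzk : z ≠ k) (hek : e ≠ k) (hzT : v (insert z I) = ⊤) :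
    v (insert k I) + v (insert e (insert z (I.erase i))) =
      v (insert e I) + v (insert k (insert z (I.erase i))) ∧
    dd σ I k * dd σ (insert z (I.erase i)) e = dd σ I e * dd σ (insert z (I.erase i)) k := by
  have hzi : z ∉ I.erase i := by simp [hz]
  have hki : k ∉ insert z (I.erase i) := by simp [hk, hzk.symm]
  have hei : e ∉ insert z (I.erase i) := by simp [he, hze.symm]
  have hekI : e ∉ insert k (insert z (I.erase i)) := by simp [hek, he, hze.symm]
  have hiz : i ≠ z := fun h => hz (h ▸ hi)
  have hie : i ≠ e := fun h => he (h ▸ hi)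
  have hik : i ≠ k := fun h => hk (h ▸ hi)
  have hcI : 0 < I.card := Finset.card_pos.2 ⟨i, hi⟩
  have hJ : (insert e (insert k (insert z (I.erase i)))).card = r + 1 := by
    rw [Finset.card_insert_of_notMem hekI, Finset.card_insert_of_notMem hki,
      Finset.card_insert_of_notMem hzi, Finset.card_erase_of_mem hi]
    omega
  have hIJ : I \ insert e (insert k (insert z (I.erase i))) = {i} := by
    ext x
    simp only [Finset.mem_sdiff, Finset.mem_insert, Finset.mem_erase, Finset.mem_singleton]
    constructor
    · tauto
    · rintro rfl
      tauto
  have hJI : ∀ x, x ∈ insert e (insert k (insert z (I.erase i))) \ I ↔ x = e ∨ x = k ∨ x = z := by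
    intro x
    simp only [Finset.mem_sdiff, Finset.mem_insert, Finset.mem_erase]
    constructor
    · tauto
    · rintro (rfl | rfl | rfl) <;> tauto
  have ek : (insert e (insert k (insert z (I.erase i)))).erase e = insert k (insert z (I.erase i)) :=
    Finset.erase_insert hekI
  have ee : (insert e (insert k (insert z (I.erase i)))).erase k = insert e (insert z (I.erase i)) := by
    rw [Finset.insert_comm]
    exact Finset.erase_insert (by simp [hek.symm, hk, hzk.symm])
  have R := RR_one hσv H hI hJ hIJ
  have hkJ := (hJI k).2 (by simp)
  have heJ := (hJI e).2 (by simp)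
  obtain ⟨q1, q2⟩ := balB_two (x := k) (y := e) R hkJ heJ (by
      intro a ha
      rcases (hJI a).1 ha with rfl | rfl | rfl
      · simp
      · simp
      · right; right; simp [hzT]) (by
      intro a ha h
      have hcf := card_facts hI hJ ha
      rw [WithTop.add_eq_top, ← hσv _ hcf.1, ← hσv _ hcf.2] at h
      unfold dd cc
      rcases h with h | h <;> rw [h] <;> simp)
  simp only [ek, ee] at q1
  refine ⟨q1, ?_⟩
  unfold dd cc at q2
  rw [ek, ee, sg_insert hekI, sg_insert hekI, sg_insert hki, sg_insert hki, tj_self, tj_self,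
    tj_neg hek.symm, one_mul, one_mul] at q2
  exact sgn_aux1 (tj e k) (sg I k) (sg (insert z (I.erase i)) k) (sg I e) (sg (insert z (I.erase i)) e)
    _ _ _ _ (tj_ne _ _) (sg_ne _ _) (sg_ne _ _) (sg_ne _ _) (sg_ne _ _) q2

theorem caseI [Nontrivial Γ] {r : ℕ} {σ : Finset E → SignType} {v : Finset E → WithTop Γ}
    (hσv : ∀ B : Finset E, B.card = r → (σ B = 0 ↔ v B = ⊤))
    (H : ∀ u : E → Γ, IsChirotope (initSign σ v r u) r)
    {I J : Finset E} (hI : I.card + 1 = r) (hJ : J.card = r + 1)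
    (IH : ∀ I' J' : Finset E, I'.card + 1 = r → J'.card = r + 1 → (I' \ J').card < (I \ J).card →
      RR σ v I' J') {z : E} (hzA : z ∈ J \ I) (hzT : v (insert z I) = ⊤) : RR σ v I J := by
  by_cases hall : ∀ j ∈ J \ I, v (insert j I) + v (J.erase j) = ⊤
  · exact Or.inl hall
  push Not at hall
  obtain ⟨e, heA, hefin⟩ := hall
  rw [Ne, WithTop.add_eq_top, not_or] at hefin
  have hcf := card_facts hI hJ heA
  have hz' := Finset.mem_sdiff.1 hzA
  have he' := Finset.mem_sdiff.1 heA
  have hze : z ≠ e := by rintro rfl; exact hefin.1 hzT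
  obtain ⟨i, hi1, hi2, hi3⟩ := supp_exchange hσv H hcf.1 hcf.2 hefin.1 hefin.2 (i := z)
    (by simp [hze, hz'.1]) (by simp [hze, hz'.2])
  have hie : i ≠ e := by
    rintro rfl
    rw [Finset.insert_comm, Finset.erase_insert (by simp [hze.symm, he'.2])] at hi3
    exact hi3 hzT
  have hiI : i ∈ I := by simpa [hie] using hi1
  have hiJ : i ∉ J := by simpa [hie] using hi2
  have hiz : i ≠ z := fun h => hz'.2 (h ▸ hiI)
  have hset : (insert z (insert e I)).erase i = insert e (insert z (I.erase i)) := by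
    ext x; simp only [Finset.mem_erase, Finset.mem_insert]
    constructor
    · tauto
    · rintro (rfl | rfl | h) <;> tauto
  rw [hset] at hi3
  have hzi : z ∉ I.erase i := by simp [hz'.2]
  have hcI : 0 < I.card := Finset.card_pos.2 ⟨i, hiI⟩
  have hI' : (insert z (I.erase i)).card + 1 = r := by
    rw [Finset.card_insert_of_notMem hzi, Finset.card_erase_of_mem hiI]; omega
  have hJI' : J \ insert z (I.erase i) = (J \ I).erase z := by
    ext x; simp only [Finset.mem_sdiff, Finset.mem_insert, Finset.mem_erase]
    constructor
    · rintro ⟨h1, h2⟩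
      refine ⟨by tauto, h1, fun h => h2 (Or.inr ⟨?_, h⟩)⟩
      rintro rfl; exact hiJ h1
    · tauto
  have hIJ' : insert z (I.erase i) \ J = (I \ J).erase i := by
    ext x; simp only [Finset.mem_sdiff, Finset.mem_insert, Finset.mem_erase]
    constructor
    · rintro ⟨rfl | h, h2⟩ <;> tauto
    · tauto
  have R := IH (insert z (I.erase i)) J hI' hJ (by
    rw [hIJ']; exact Finset.card_erase_lt_of_mem (Finset.mem_sdiff.2 ⟨hiI, hiJ⟩))
  unfold RR at R ⊢
  rw [hJI'] at R
  refine balB_of_erase (z := z) ?_ (by simp [hzT])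
  have hde : dd σ I e ≠ 0 := by
    unfold dd
    refine mul_ne_zero (sg_ne _ _) ?_
    rw [Ne, hσv _ hcf.1]; exact hefin.1
  have hcf' := card_facts hI' hJ (j := e) (by rw [hJI']; simp [hze.symm, he'.1, he'.2])
  have hde' : dd σ (insert z (I.erase i)) e ≠ 0 := by
    unfold dd
    refine mul_ne_zero (sg_ne _ _) ?_
    rw [Ne, hσv _ hcf'.1]; exact hi3
  have rel : ∀ k ∈ (J \ I).erase z, 
    v (insert k I) + v (insert e (insert z (I.erase i))) =
      v (insert e I) + v (insert k (insert z (I.erase i))) ∧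
    dd σ I k * dd σ (insert z (I.erase i)) e = dd σ I e * dd σ (insert z (I.erase i)) k := by
    intro k hk
    by_cases hke : k = e
    · subst hke; exact ⟨rfl, rfl⟩
    · simp only [Finset.mem_erase, Finset.mem_sdiff] at hk
      exact caseI_rel hσv H hI hz'.2 he'.2 hk.2.2 hiI hze (Ne.symm hk.1) (Ne.symm hke) hzT
  refine balB_scale R (dd σ I e * dd σ (insert z (I.erase i)) e) (mul_ne_zero hde hde') ?_
    (v (insert e I)) (v (insert e (insert z (I.erase i)))) hefin.1 hi3 ?_
  · intro j hj
    have h2 := (rel j hj).2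
    have : ∀ a b c d x : SignType, b ≠ 0 → a * b = c * d → a * x = c * b * (d * x) := by decide
    exact this _ _ _ _ _ hde' h2
  · intro j hj
    have h1 := (rel j hj).1
    calc _ = (v (insert j I) + v (insert e (insert z (I.erase i)))) + v (J.erase j) := by ac_rfl
      _ = _ := by rw [h1]; ac_rfl

end

section
variable {E : Type*} [Fintype E] [LinearOrder E]
  {Γ : Type*} [AddCommGroup Γ] [LinearOrder Γ] [IsOrderedAddMonoid Γ]

theorem sgn_pm : ∀ p : SignType, p ≠ 0 → p = 1 ∨ p = -1 := by decide

theorem caseII [Nontrivial Γ] {r : ℕ} {σ : Finset E → SignType} {v : Finset E → WithTop Γ}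
    (hσv : ∀ B : Finset E, B.card = r → (σ B = 0 ↔ v B = ⊤))
    (H : ∀ u : E → Γ, IsChirotope (initSign σ v r u) r)
    {I J : Finset E} (hI : I.card + 1 = r) (hJ : J.card = r + 1)
    (IH : ∀ I' J' : Finset E, I'.card + 1 = r → J'.card = r + 1 → (I' \ J').card < (I \ J).card →
      RR σ v I' J') {i : E} (hi : i ∈ I \ J) (hfin : ∀ z ∈ J \ I, v (insert z I) ≠ ⊤) :
    RR σ v I J := by
  have hi' := Finset.mem_sdiff.1 hi
  obtain ⟨W, hW⟩ : ∃ W, W = insert i J := ⟨_, rfl⟩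
  have hWc : W.card = r + 2 := by rw [hW, Finset.card_insert_of_notMem hi'.2]; omega
  have hWm : ∀ x, x ∈ W ↔ x = i ∨ x ∈ J := by intro x; rw [hW, Finset.mem_insert]
  have hd : ∀ k ∈ J \ I, dd σ I k ≠ 0 := by
    intro k hk
    unfold dd
    refine mul_ne_zero (sg_ne _ _) ?_
    rw [Ne, hσv _ (card_facts hI hJ hk).1]; exact hfin k hk
  have hAW : ∀ k ∈ J \ I, k ∈ W := fun k hk => (hWm k).2 (Or.inr (Finset.mem_sdiff.1 hk).1)
  have hAi : ∀ k ∈ J \ I, k ≠ i := fun k hk h => (Finset.mem_sdiff.1 hk).2 (h ▸ hi'.1)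
  have hW2 : ∀ a ∈ J \ I, ∀ b ∈ J \ I, a ≠ b → ((W.erase a).erase b).card = r := by
    intro a ha b hb hab
    rw [Finset.card_erase_of_mem (Finset.mem_erase.2 ⟨hab.symm, hAW b hb⟩),
      Finset.card_erase_of_mem (hAW a ha)]
    omega
  unfold RR
  refine core_lemma (J \ I) _ _
    (fun k j => dd σ I k * dd σ I j * (sg W k * sg W j * tj k j) * σ ((W.erase k).erase j))
    (fun k j => v (insert k I) + (v (insert j I) + v ((W.erase k).erase j))) ?_ ?_ ?_ ?_ ?_ ?_ ?_
  · intro a ha h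
    have h' := (mul_eq_zero.1 h).resolve_left (hd a ha)
    unfold cc at h'
    have h2 := (mul_eq_zero.1 h').resolve_left (sg_ne _ _)
    rw [hσv _ (card_facts hI hJ ha).2] at h2
    simp [h2]
  · intro a ha b hb hab
    rw [Finset.erase_right_comm]; ac_rfl
  · intro a ha b hb hab
    rw [Finset.erase_right_comm, tj_neg hab]
    simp only [mul_neg, neg_mul]
    congr 1
    ac_rfl
  · intro a ha b hb hab h
    simp only [mul_eq_zero, hd a ha, hd b hb, sg_ne, tj_ne, false_or] at h
    rw [hσv _ (hW2 a ha b hb hab)] at h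
    simp [h]
  · intro k hk
    have hk' := Finset.mem_sdiff.1 hk
    have c1 : (W.erase k).card = r + 1 := by
      rw [Finset.card_erase_of_mem (hAW k hk)]; omega
    have s1 : I \ W.erase k = (I \ J).erase i := by
      ext x
      simp only [Finset.mem_sdiff, Finset.mem_erase, hWm]
      constructor
      · rintro ⟨h1, h2⟩
        have : x ≠ k := fun h => hk'.2 (h ▸ h1)
        tauto
      · tauto
    have s2 : W.erase k \ I = (J \ I).erase k := by
      ext x
      simp only [Finset.mem_sdiff, Finset.mem_erase, hWm]
      constructor
      · rintro ⟨⟨h1, h2 | h2⟩, h3⟩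
        · exact absurd (h2 ▸ hi'.1) h3
        · tauto
      · tauto
    have R := IH I (W.erase k) hI c1 (by rw [s1]; exact Finset.card_erase_lt_of_mem hi)
    unfold RR at R
    rw [s2] at R
    refine balB_scale R (dd σ I k * sg W k) (mul_ne_zero (hd k hk) (sg_ne _ _)) ?_
      (v (insert k I)) 0 (hfin k hk) (by simp) ?_
    · intro j hj
      unfold cc
      rw [sg_erase (hAW k hk)]
      ac_rfl
    · intro j hj
      simp only [add_zero]
      ac_rfl
  · intro a ha b hb d hd' hab hbd had
    have hbW : b ∈ W.erase a := Finset.mem_erase.2 ⟨hab.symm, hAW b hb⟩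
    have hdW : d ∈ (W.erase a).erase b :=
      Finset.mem_erase.2 ⟨hbd.symm, Finset.mem_erase.2 ⟨had.symm, hAW d hd'⟩⟩
    have hdW1 : d ∈ (W.erase a) := Finset.mem_of_mem_erase hdW
    have c1 : (((W.erase a).erase b).erase d).card + 1 = r := by
      have := Finset.card_erase_add_one hdW
      rw [this, hW2 a ha b hb hab]
    have haJ := (Finset.mem_sdiff.1 ha).1
    have hbJ := (Finset.mem_sdiff.1 hb).1
    have hdJ := (Finset.mem_sdiff.1 hd').1
    have hai := (hAi a ha).symm
    have hbi := (hAi b hb).symm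
    have hdi := (hAi d hd').symm
    have s1 : ((W.erase a).erase b).erase d \ J = {i} := by
      ext x
      simp only [Finset.mem_sdiff, Finset.mem_erase, hWm, Finset.mem_singleton]
      constructor
      · tauto
      · rintro rfl
        exact ⟨⟨hdi, hbi, hai, Or.inl rfl⟩, hi'.2⟩
    have s2 : ∀ x, x ∈ J \ ((W.erase a).erase b).erase d ↔ x = a ∨ x = b ∨ x = d := by
      intro x
      simp only [Finset.mem_sdiff, Finset.mem_erase, hWm]
      constructor
      · tauto
      · rintro (rfl | rfl | rfl) <;> tauto
    have i3 : insert d (((W.erase a).erase b).erase d) = (W.erase a).erase b := Finset.insert_erase hdW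
    have i2 : insert b (((W.erase a).erase b).erase d) = (W.erase d).erase a := by
      rw [Finset.erase_right_comm, Finset.insert_erase (Finset.mem_erase.2 ⟨hbd, hbW⟩),
        Finset.erase_right_comm]
    have i1 : insert a (((W.erase a).erase b).erase d) = (W.erase b).erase d := by
      have : ((W.erase a).erase b).erase d = ((W.erase b).erase d).erase a := by
        ext x; simp only [Finset.mem_erase]; tauto
      rw [this, Finset.insert_erase]
      exact Finset.mem_erase.2 ⟨had, Finset.mem_erase.2 ⟨hab, hAW a ha⟩⟩
    have R := RR_one hσv H c1 hJ s1
    have hsg : ∀ x, sg (((W.erase a).erase b).erase d) x = tj d x * (tj b x * (tj a x * sg W x)) := by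
      intro x
      rw [sg_erase hdW, sg_erase hbW, sg_erase (hAW a ha)]
    refine bal3_of R s2 (dd σ I a * dd σ I b * dd σ I d * (sg W a * sg W b * sg W d) *
      (tj b a * tj d a * tj b d)) ?_ (v (insert a I) + v (insert b I) + v (insert d I)) ?_ ?_ ?_ ?_ ?_ ?_ ?_
    · have h1 := hd a ha
      have h2 := hd b hb
      have h3 := hd d hd'
      simp [h1, h2, h3, sg_ne, tj_ne]
    · simp [WithTop.add_eq_top, hfin a ha, hfin b hb, hfin d hd']
    · unfold cc
      generalize dd σ I a = da
      generalize dd σ I b = db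
      generalize dd σ I d = de
      unfold dd
      rw [i1, hsg, tj_self, tj_neg hab.symm]
      rcases tj_pm a b with h | h <;> rcases tj_pm d a with h' | h' <;> rcases sg_pm W a with h'' | h'' <;>
      rw [h, h', h''] <;> simp only [mul_neg, neg_mul, neg_neg, one_mul, mul_one, neg_inj] <;> ac_rfl
    · unfold cc
      generalize dd σ I a = da
      generalize dd σ I b = db
      generalize dd σ I d = de
      unfold dd
      rw [i2, hsg, tj_self, tj_neg hab.symm, tj_neg hbd.symm]
      rcases tj_pm a b with h | h <;> rcases tj_pm b d with h' | h' <;> rcases sg_pm W b with h'' | h'' <;>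
      rw [h, h', h''] <;> simp only [mul_neg, neg_mul, neg_neg, one_mul, mul_one, neg_inj] <;> ac_rfl
    · unfold cc
      generalize dd σ I a = da
      generalize dd σ I b = db
      generalize dd σ I d = de
      unfold dd
      rw [i3, hsg, tj_self, tj_neg hab.symm, tj_neg had]
      rcases tj_pm d a with h | h <;> rcases tj_pm b d with h' | h' <;> rcases sg_pm W d with h'' | h'' <;>
      rw [h, h', h''] <;> simp only [mul_neg, neg_mul, neg_neg, one_mul, mul_one, neg_inj] <;> ac_rfl
    · simp only [i1]; ac_rfl
    · simp only [i2]; ac_rfl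
    · simp only [i3]; ac_rfl
  · intro e he hc
    rw [Ne, WithTop.add_eq_top, not_or] at hc
    have hcf := card_facts hI hJ he
    obtain ⟨k, hk1, hk2, hk3⟩ := supp_exchange hσv H hcf.2 hcf.1 hc.2 hc.1 (i := i)
      (by simp [hi'.1]) (by simp [hi'.2])
    rw [Finset.mem_erase] at hk1
    rw [Finset.mem_insert, not_or] at hk2
    have hkA : k ∈ J \ I := Finset.mem_sdiff.2 ⟨hk1.2, hk2.2⟩
    refine ⟨k, hkA, hk1.1, ?_⟩
    have : insert i (J.erase e) = W.erase e := by
      rw [hW, Finset.erase_insert_of_ne (hAi e he).symm]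
    rw [this] at hk3
    simp [WithTop.add_eq_top, hfin e he, hfin k hkA, hk3]

theorem RR_all [Nontrivial Γ] {r : ℕ} {σ : Finset E → SignType} {v : Finset E → WithTop Γ}
    (hσv : ∀ B : Finset E, B.card = r → (σ B = 0 ↔ v B = ⊤))
    (H : ∀ u : E → Γ, IsChirotope (initSign σ v r u) r) :
    ∀ (n : ℕ) (I J : Finset E), I.card + 1 = r → J.card = r + 1 → (I \ J).card = n → RR σ v I J := by
  intro n
  induction n using Nat.strong_induction_on with
  | _ n ih =>
    intro I J hI hJ hn
    rcases Finset.eq_empty_or_nonempty (I \ J) with h | ⟨i, hi⟩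
    · exact RR_zero σ v hσv hI hJ (Finset.sdiff_eq_empty_iff_subset.1 h)
    · have IH : ∀ I' J' : Finset E, I'.card + 1 = r → J'.card = r + 1 →
          (I' \ J').card < (I \ J).card → RR σ v I' J' :=
        fun I' J' h1 h2 h3 => ih _ (hn ▸ h3) I' J' h1 h2 rfl
      by_cases hz : ∃ z ∈ J \ I, v (insert z I) = ⊤
      · obtain ⟨z, hz1, hz2⟩ := hz
        exact caseI hσv H hI hJ IH hz1 hz2
      · push Not at hz
        exact caseII hσv H hI hJ IH hi hz

theorem backward_s7 {r : ℕ} {σ : Finset E → SignType} {v : Finset E → WithTop Γ}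
    (hσv : ∀ B : Finset E, B.card = r → (σ B = 0 ↔ v B = ⊤))
    (H : ∀ u : E → Γ, IsChirotope (initSign σ v r u) r) : OrientedValuatedMatroid σ v r := by
  rcases subsingleton_or_nontrivial Γ with hΓ | hΓ
  · intro I J hI hJ
    by_cases hall : ∀ j ∈ J \ I, v (insert j I) + v (J.erase j) = ⊤
    · exact Or.inl hall
    right
    push Not at hall
    obtain ⟨e, heA, hefin⟩ := hall
    rw [Ne, WithTop.add_eq_top, not_or] at hefin
    have hopt : ∀ B : Finset E, v B ≠ ⊤ → OptU v r 0 B :=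
      fun B hB => ⟨hB, fun B' _ _ => (Subsingleton.elim _ _).le⟩
    have hle : ∀ x y : WithTop Γ, x ≠ ⊤ → x ≤ y := by
      intro x y hx
      cases y with
      | top => exact le_top
      | coe y =>
        lift x to Γ using hx
        rw [Subsingleton.elim x y]
    have key := hh_optU hσv (H 0) hI hJ heA (hopt _ hefin.1) (hopt _ hefin.2)
    constructor
    · obtain ⟨k, hk, a, b, c⟩ := key 1 (by decide)
      exact ⟨k, hk, fun l _ => hle _ _ (WithTop.add_ne_top.2 ⟨a.1, b.1⟩), c⟩
    · obtain ⟨k, hk, a, b, c⟩ := key (-1) (by decide)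
      exact ⟨k, hk, fun l _ => hle _ _ (WithTop.add_ne_top.2 ⟨a.1, b.1⟩), c⟩
  · intro I J hI hJ
    have R := RR_all hσv H _ I J hI hJ rfl
    unfold RR at R
    simp only [← FF_eq] at R
    exact R

theorem forward_s7 {r : ℕ} {σ : Finset E → SignType} {v : Finset E → WithTop Γ}
    (hσv : ∀ B : Finset E, B.card = r → (σ B = 0 ↔ v B = ⊤))
    (hσ : ∃ B : Finset E, B.card = r ∧ σ B ≠ 0)
    (H : OrientedValuatedMatroid σ v r) (u : E → Γ) : IsChirotope (initSign σ v r u) r := by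
  constructor
  · obtain ⟨B, hB, hB0⟩ := hσ
    obtain ⟨B', hB', hm⟩ := Finset.exists_min_image
      (Finset.univ.filter (fun X : Finset E => X.card = r ∧ v X ≠ ⊤)) (wv v u)
      ⟨B, by simp only [Finset.mem_filter, Finset.mem_univ, true_and]; exact ⟨hB, fun h => hB0 ((hσv B hB).2 h)⟩⟩
    simp only [Finset.mem_filter, Finset.mem_univ, true_and] at hB' hm
    refine ⟨B', hB'.1, ?_⟩
    rw [(initSign_eq σ v r u B').1 ⟨hB'.2, fun X h1 h2 => hm X ⟨h1, h2⟩⟩, Ne, hσv _ hB'.1]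
    exact hB'.2
  · intro I J hI hJ
    by_cases hall : ∀ j ∈ J \ I, ssign j I J * initSign σ v r u (insert j I) * initSign σ v r u (J.erase j) = 0
    · exact Or.inl hall
    right
    push Not at hall
    obtain ⟨e, he, hne⟩ := hall
    have o1 : OptU v r u (insert e I) := by
      by_contra hc
      rw [(initSign_eq σ v r u _).2 hc] at hne
      simp at hne
    have o2 : OptU v r u (J.erase e) := by
      by_contra hc
      rw [(initSign_eq σ v r u (J.erase e)).2 hc] at hne
      simp at hne
    have hcfe := card_facts hI hJ he
    have hsum : ∀ k ∈ J \ I, v (insert k I) ≠ ⊤ → v (J.erase k) ≠ ⊤ →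
        v (insert k I) + v (J.erase k) =
          ((wv v u (insert k I) + wv v u (J.erase k) + (∑ x ∈ I, u x + ∑ x ∈ J, u x) : Γ) : WithTop Γ) := by
      intro k hk h1 h2
      have hk' := Finset.mem_sdiff.1 hk
      unfold wv
      rw [Finset.sum_insert hk'.2, ← Finset.add_sum_erase J u hk'.1]
      lift v (insert k I) to Γ using h1 with x
      lift v (J.erase k) to Γ using h2 with y
      simp only [WithTop.untopD_coe]
      rw [← WithTop.coe_add]
      congr 1
      abel
    have key : ∀ j ∈ J \ I, (∀ k ∈ J \ I, v (insert j I) + v (J.erase j) ≤ v (insert k I) + v (J.erase k)) →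
        ssign j I J * initSign σ v r u (insert j I) * initSign σ v r u (J.erase j) =
        ssign j I J * σ (insert j I) * σ (J.erase j) := by
      intro j hj hmin
      have h := hmin e he
      have hcf := card_facts hI hJ hj
      have hfin : v (insert j I) + v (J.erase j) ≠ ⊤ :=
        ne_top_of_le_ne_top (WithTop.add_ne_top.2 ⟨o1.1, o2.1⟩) h
      obtain ⟨f1, f2⟩ := WithTop.add_ne_top.1 hfin
      rw [hsum j hj f1 f2, hsum e he o1.1 o2.1, WithTop.coe_le_coe, add_le_add_iff_right] at h
      have q1 := o1.2 _ hcf.1 f1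
      have q2 := o2.2 _ hcf.2 f2
      have p1 : wv v u (insert j I) ≤ wv v u (insert e I) := by
        by_contra hc
        exact absurd h (not_le.2 (add_lt_add_of_lt_of_le (not_le.1 hc) q2))
      have p2 : wv v u (J.erase j) ≤ wv v u (J.erase e) := by
        by_contra hc
        exact absurd h (not_le.2 (add_lt_add_of_le_of_lt q1 (not_le.1 hc)))
      rw [(initSign_eq σ v r u _).1 ⟨f1, fun B h1 h2 => p1.trans (o1.2 B h1 h2)⟩,
        (initSign_eq σ v r u _).1 ⟨f2, fun B h1 h2 => p2.trans (o2.2 B h1 h2)⟩]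
    rcases H I J hI hJ with h | ⟨⟨a, ha, ha1, ha2⟩, ⟨b, hb, hb1, hb2⟩⟩
    · exact absurd (h e he) (WithTop.add_ne_top.2 ⟨o1.1, o2.1⟩)
    · exact ⟨⟨a, ha, (key a ha ha1).trans ha2⟩, ⟨b, hb, (key b hb hb1).trans hb2⟩⟩

end

/-- A signed tropical Plücker function `(σ, v)` of rank `r` is an oriented
valuated matroid (a strong `𝕊[Γ]`-matroid) iff for every `u : E → Γ` the initial sign function
`σ^u` is a chirotope of rank `r` on `E`. -/
theorem orientedValuatedMatroid_iff_forall_initial_chirotope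
    {E : Type*} [Fintype E] [LinearOrder E] {Γ : Type*} [AddCommGroup Γ] [LinearOrder Γ] [IsOrderedAddMonoid Γ]
    (r : ℕ) (σ : Finset E → SignType) (v : Finset E → WithTop Γ)
    (hσv : ∀ B : Finset E, B.card = r → (σ B = 0 ↔ v B = ⊤))
    (hσ : ∃ B : Finset E, B.card = r ∧ σ B ≠ 0) :
    OrientedValuatedMatroid σ v r ↔
      ∀ u : E → Γ, IsChirotope (initSign σ v r u) r := by
  exact ⟨fun H u => forward_s7 hσv hσ H u, fun H => backward_s7 hσv H⟩
end
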